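/- arXiv:1406.5675 — 3 statements merged into one kernel-verified Lean document; each statement's English description precedes it below -/
import Mathlib

section
/- Let K be an n×n real symmetric positive semidefinite matrix with rank(K) > k, so that δ̄ = (1/(n−k))(tr(K) − Σ_{j=1}^k σ_j(K)) > 0, and let l ≥ k. Let Ω ∈ R^{n×l} be a random matrix with i.i.d. standard Gaussian entries, assume rank(K) ≥ l so that almost surely rank(KΩ) = l, let Q ∈ R^{n×l} have orthonormal columns spanning the column space of KΩ, let s be the sum of the top k singular values of Q^T K ∈ R^{l×n}, and set δ̃ = (1/(n−k))(tr(K) − s). Then E[ |δ̄ − δ̃| / δ̄ ] ≤ k/√l, where the expectation is over the Gaussian matrix Ω. -/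
open Matrix BigOperators
open scoped Classical

noncomputable section

/-- `B` satisfies the four Penrose conditions for `A`. -/
def IsMoorePenrose {m n : Type*} [Fintype m] [Fintype n]
    (A : Matrix m n ℝ) (B : Matrix n m ℝ) : Prop :=
  A * B * A = A ∧ B * A * B = B ∧ (A * B)ᵀ = A * B ∧ (B * A)ᵀ = B * A

/-- The Moore–Penrose pseudoinverse of a real matrix (defined via the unique
matrix satisfying the four Penrose conditions, which always exists). -/
def pinv {m n : Type*} [Fintype m] [Fintype n] (A : Matrix m n ℝ) : Matrix n m ℝ :=
  if h : ∃ B, IsMoorePenrose A B then h.choose else 0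

/-- Squared Frobenius norm. -/
def frobSq {m n : Type*} [Fintype m] [Fintype n] (A : Matrix m n ℝ) : ℝ :=
  ∑ i, ∑ j, (A i j) ^ 2

/-- Frobenius norm. -/
def frobNorm {m n : Type*} [Fintype m] [Fintype n] (A : Matrix m n ℝ) : ℝ :=
  Real.sqrt (frobSq A)

/-- Eigenvalues of a (hermitian) real matrix, sorted in descending order
(junk value `0` if the matrix is not hermitian). -/
def eigsDesc {n : ℕ} (A : Matrix (Fin n) (Fin n) ℝ) : Fin n → ℝ :=
  if hA : A.IsHermitian then
    fun i => hA.eigenvalues (Tuple.sort (fun j => -hA.eigenvalues j) i)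
  else 0

/-- Singular values of a real matrix, sorted in descending order. -/
def svalsDesc {m n : ℕ} (A : Matrix (Fin m) (Fin n) ℝ) : Fin n → ℝ :=
  fun i => Real.sqrt (eigsDesc (Aᵀ * A) i)

/-- Spectral norm (largest singular value). -/
def specNorm {m n : ℕ} (A : Matrix (Fin m) (Fin n) ℝ) : ℝ := ⨆ i, svalsDesc A i

/-- `Ak` is a best rank-`k` approximation of `A` in Frobenius norm. -/
def IsBestRankApprox {m n : Type*} [Fintype m] [Fintype n]
    (A Ak : Matrix m n ℝ) (k : ℕ) : Prop :=
  Ak.rank ≤ k ∧ ∀ X : Matrix m n ℝ, X.rank ≤ k → frobSq (A - Ak) ≤ frobSq (A - X)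

/-- `P` is a column selection matrix: each column is a distinct standard basis vector. -/
def IsColSelection {n c : ℕ} (P : Matrix (Fin n) (Fin c) ℝ) : Prop :=
  ∃ f : Fin c → Fin n, Function.Injective f ∧
    P = Matrix.of fun i j => if i = f j then 1 else 0

/-- Adaptive sampling probabilities for a residual matrix `B`
(uniform in the degenerate case `B = 0`). -/
def adaptP {m n : Type*} [Fintype m] [Fintype n] (B : Matrix m n ℝ) : n → ℝ :=
  fun j => if frobSq B = 0 then (Fintype.card n : ℝ)⁻¹ else (∑ i, (B i j) ^ 2) / frobSq B

/-- Uniform sampling matrix with entries `√(n/s)` at positions `(t j, j)`. -/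
def uSamp (n : ℕ) {s : ℕ} (t : Fin s → Fin n) : Matrix (Fin n) (Fin s) ℝ :=
  Matrix.of fun i j => if i = t j then Real.sqrt ((n : ℝ) / s) else 0

/-- Weighted sampling matrix with entries `1/√(s p i)` at positions `(t j, j)`. -/
def wSamp {n s : ℕ} (p : Fin n → ℝ) (t : Fin s → Fin n) : Matrix (Fin n) (Fin s) ℝ :=
  Matrix.of fun i j => if i = t j then 1 / Real.sqrt (s * p i) else 0

end

open MeasureTheory ProbabilityTheory

/-- standard Gaussian product measure -/
noncomputable abbrev GG (ι : Type*) [Fintype ι] : Measure (ι → ℝ) :=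
  Measure.pi fun _ : ι => gaussianReal 0 1

theorem GG_map_mulVec {ι κ : Type*} [Fintype ι] [Fintype κ] (A : Matrix κ ι ℝ)
    (hA : A * Aᵀ = 1) : (GG ι).map (fun x => A *ᵥ x) = GG κ := by
  have hmeas : Measurable (fun x : ι → ℝ => A *ᵥ x) := by
    apply Continuous.measurable; fun_prop
  have hinj : Function.Injective (fun μ : Measure (κ → ℝ) => μ.map (WithLp.toLp 2)) := by
    intro μ ν h
    have := congrArg (fun μ : Measure (EuclideanSpace ℝ κ) => μ.map (WithLp.ofLp)) h
    simp only at this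
    rwa [Measure.map_map (by fun_prop) (by fun_prop), Measure.map_map (by fun_prop) (by fun_prop),
      show (WithLp.ofLp ∘ (WithLp.toLp 2) : (κ → ℝ) → (κ → ℝ)) = id from rfl,
      Measure.map_id, Measure.map_id] at this
  apply hinj
  simp only
  rw [Measure.map_map (by fun_prop) hmeas]
  haveI : IsProbabilityMeasure ((GG ι).map (WithLp.toLp 2 ∘ fun x : ι → ℝ => A *ᵥ x)) := 
    Measure.isProbabilityMeasure_map (by
      apply Measurable.aemeasurable; exact Measurable.comp (by fun_prop) hmeas)
  rw [map_pi_eq_stdGaussian]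
  apply Measure.ext_of_charFun (E := EuclideanSpace ℝ κ)
  ext t
  rw [charFun_stdGaussian, charFun_apply, integral_map (Measurable.aemeasurable (Measurable.comp (by fun_prop) hmeas)) (by fun_prop)]
  have h2 := charFun_stdGaussian (E := EuclideanSpace ℝ ι) (WithLp.toLp 2 (Aᵀ *ᵥ t.ofLp))
  rw [← map_pi_eq_stdGaussian, charFun_apply, integral_map (by fun_prop) (by fun_prop)] at h2
  have h3 : ‖(WithLp.toLp 2 (Aᵀ *ᵥ t.ofLp) : EuclideanSpace ℝ ι)‖ ^ 2 = ‖t‖ ^ 2 := by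
    have e1 : ∀ {ι' : Type _} [Fintype ι'] (v : EuclideanSpace ℝ ι'), ‖v‖^2 = v.ofLp ⬝ᵥ v.ofLp := by
      intro ι' _ v
      rw [EuclideanSpace.real_norm_sq_eq]; simp [dotProduct, sq]
    have e2 : ∀ {ι' : Type _} [Fintype ι'] (v : EuclideanSpace ℝ ι'), ‖v‖^2 = v.ofLp ⬝ᵥ v.ofLp := by
      intro ι' _ v
      rw [EuclideanSpace.real_norm_sq_eq]; simp [dotProduct, sq]
    rw [e1, e2]
    rw [Matrix.dotProduct_mulVec, Matrix.vecMul_mulVec, ← Matrix.dotProduct_mulVec]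
    simp [hA]
  rw [← Complex.ofReal_pow, h3, Complex.ofReal_pow] at h2
  rw [← h2]
  congr 1
  ext x
  congr 3
  simp only [Function.comp, EuclideanSpace.inner_eq_star_dotProduct]
  simp [Matrix.dotProduct_mulVec, Matrix.vecMul_transpose, Matrix.mulVec_transpose]

theorem GG_map_adj {ι κ : Type*} [Fintype ι] [Fintype κ] (T : (ι → ℝ) → (κ → ℝ))
    (S : (κ → ℝ) → (ι → ℝ)) (h1 : ∀ x y, T x ⬝ᵥ y = x ⬝ᵥ S y) (h2 : ∀ y, T (S y) = y) :
    Measurable T ∧ (GG ι).map T = GG κ := by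
  set A : Matrix κ ι ℝ := fun i j => S (Pi.single i 1) j with hAdef
  have hT : T = fun x => A *ᵥ x := by
    funext x
    funext i
    have := h1 x (Pi.single i 1)
    simp only [dotProduct_single, mul_one] at this
    rw [this, dotProduct_comm]; rfl
  have hA : A * Aᵀ = 1 := by
    ext i j
    have h := h1 (S (Pi.single j 1)) (Pi.single i 1)
    rw [h2] at h
    have : (A * Aᵀ) i j = S (Pi.single j 1) ⬝ᵥ S (Pi.single i 1) := by
      rw [dotProduct_comm]; rfl
    rw [this, ← h]
    simp [Matrix.one_apply, Pi.single_apply]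
  refine ⟨?_, ?_⟩
  · rw [hT]; apply Continuous.measurable; fun_prop
  · rw [hT]; exact GG_map_mulVec A hA

theorem GG_lint_adj {ι κ : Type*} [Fintype ι] [Fintype κ] (T : (ι → ℝ) → (κ → ℝ))
    (S : (κ → ℝ) → (ι → ℝ)) (h1 : ∀ x y, T x ⬝ᵥ y = x ⬝ᵥ S y) (h2 : ∀ y, T (S y) = y)
    (f : (κ → ℝ) → ENNReal) (hf : Measurable f) :
    ∫⁻ x, f (T x) ∂(GG ι) = ∫⁻ y, f y ∂(GG κ) := by
  obtain ⟨hm, he⟩ := GG_map_adj T S h1 h2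
  rw [← he, lintegral_map hf hm]

theorem GG_ae_adj {ι κ : Type*} [Fintype ι] [Fintype κ] (T : (ι → ℝ) → (κ → ℝ))
    (S : (κ → ℝ) → (ι → ℝ)) (h1 : ∀ x y, T x ⬝ᵥ y = x ⬝ᵥ S y) (h2 : ∀ y, T (S y) = y)
    (p : (κ → ℝ) → Prop) (hp : ∀ᵐ y ∂(GG κ), p y) :
    ∀ᵐ x ∂(GG ι), p (T x) := by
  obtain ⟨hm, he⟩ := GG_map_adj T S h1 h2
  rw [← he] at hp
  exact ae_of_ae_map hm.aemeasurable hp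

theorem GG_sum {ι κ : Type*} [Fintype ι] [Fintype κ] (f : (ι ⊕ κ → ℝ) → ENNReal)
    (hf : Measurable f) :
    ∫⁻ y, f y ∂(GG (ι ⊕ κ)) = ∫⁻ x, ∫⁻ y, f (Sum.elim x y) ∂(GG κ) ∂(GG ι) := by
  have h := (measurePreserving_sumPiEquivProdPi_symm (X := fun _ : ι ⊕ κ => ℝ)
    (fun _ : ι ⊕ κ => gaussianReal 0 1))
  rw [GG, ← h.map_eq, lintegral_map hf h.measurable]
  refine (lintegral_prod _ (hf.comp h.measurable).aemeasurable).trans ?_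
  apply lintegral_congr; intro x; apply lintegral_congr; intro y
  congr 1

theorem GG_lint_adj2 {ι ι' κ : Type*} [Fintype ι] [Fintype ι'] [Fintype κ]
    (T : (ι → ℝ) → (ι' → ℝ) → (κ → ℝ))
    (S : (κ → ℝ) → (ι → ℝ)) (S' : (κ → ℝ) → (ι' → ℝ))
    (h1 : ∀ x x' y, T x x' ⬝ᵥ y = x ⬝ᵥ S y + x' ⬝ᵥ S' y) (h2 : ∀ y, T (S y) (S' y) = y)
    (f : (κ → ℝ) → ENNReal) (hf : Measurable f) :
    ∫⁻ x, ∫⁻ x', f (T x x') ∂(GG ι') ∂(GG ι) = ∫⁻ y, f y ∂(GG κ) := by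
  have h1' : ∀ (x : ι ⊕ ι' → ℝ) y, T (x ∘ Sum.inl) (x ∘ Sum.inr) ⬝ᵥ y = x ⬝ᵥ Sum.elim (S y) (S' y) := by
    intro x y
    rw [h1]
    simp [dotProduct, Fintype.sum_sum_type]
  have h2' : ∀ y, T (Sum.elim (S y) (S' y) ∘ Sum.inl) (Sum.elim (S y) (S' y) ∘ Sum.inr) = y := by
    intro y; simp [h2]
  have hm := (GG_map_adj _ _ h1' h2').1
  rw [← GG_lint_adj (ι := ι ⊕ ι') (fun x => T (x ∘ Sum.inl) (x ∘ Sum.inr))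
    (fun y => Sum.elim (S y) (S' y)) h1' h2' f hf]
  exact (GG_sum _ (hf.comp hm)).symm

/-- prod to prod -/
theorem GG_lint_adj3 {ι ι' κ κ' : Type*} [Fintype ι] [Fintype ι'] [Fintype κ] [Fintype κ']
    (T : (ι → ℝ) → (ι' → ℝ) → (κ → ℝ)) (T' : (ι → ℝ) → (ι' → ℝ) → (κ' → ℝ))
    (S : (κ → ℝ) → (κ' → ℝ) → (ι → ℝ)) (S' : (κ → ℝ) → (κ' → ℝ) → (ι' → ℝ))
    (h1 : ∀ x x' y y', T x x' ⬝ᵥ y + T' x x' ⬝ᵥ y' = x ⬝ᵥ S y y' + x' ⬝ᵥ S' y y')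
    (h2 : ∀ y y', T (S y y') (S' y y') = y) (h2' : ∀ y y', T' (S y y') (S' y y') = y')
    (f : (κ → ℝ) → (κ' → ℝ) → ENNReal) (hf : Measurable (Function.uncurry f)) :
    ∫⁻ x, ∫⁻ x', f (T x x') (T' x x') ∂(GG ι') ∂(GG ι) = ∫⁻ y, ∫⁻ y', f y y' ∂(GG κ') ∂(GG κ) := by
  have hm : Measurable (fun y : κ ⊕ κ' → ℝ => f (y ∘ Sum.inl) (y ∘ Sum.inr)) := by
    apply hf.comp (g := Function.uncurry f) (f := fun y : κ ⊕ κ' → ℝ => (y ∘ Sum.inl, y ∘ Sum.inr))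
    apply Measurable.prodMk
    · exact measurable_pi_lambda _ fun i => measurable_pi_apply _
    · exact measurable_pi_lambda _ fun i => measurable_pi_apply _
  have := GG_lint_adj2 (κ := κ ⊕ κ') (fun x x' => Sum.elim (T x x') (T' x x'))
    (fun y => S (y ∘ Sum.inl) (y ∘ Sum.inr)) (fun y => S' (y ∘ Sum.inl) (y ∘ Sum.inr))
    (by intro x x' y; rw [← h1]; simp [dotProduct, Fintype.sum_sum_type])
    (by intro y; simp only [h2, h2']; simp)
    (fun y => f (y ∘ Sum.inl) (y ∘ Sum.inr)) hm
  rw [GG_sum _ hm] at this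
  exact this

theorem lint_abs_gauss : ∫⁻ x, ENNReal.ofReal |x| ∂(gaussianReal 0 1) =
    ENNReal.ofReal (Real.sqrt (2 / Real.pi)) := by
  have hint : Integrable (fun x : ℝ => |x|) (gaussianReal 0 1) :=
    ((memLp_id_gaussianReal (μ := 0) (v := 1) 1).integrable (by simp)).abs
  rw [← ofReal_integral_eq_lintegral_ofReal hint (Filter.Eventually.of_forall fun x => abs_nonneg x)]
  congr 1
  rw [integral_gaussianReal_eq_integral_smul (by simp)]
  have h1 : ∀ x : ℝ, gaussianPDFReal 0 1 x • |x| =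
      (fun y : ℝ => (Real.sqrt (2 * Real.pi))⁻¹ * (y ^ (1:ℝ) * Real.exp (-(1/2) * y ^ (2:ℝ)))) |x| := by
    intro x
    simp only [gaussianPDFReal, smul_eq_mul, Real.rpow_one, Real.rpow_two, sq_abs]
    simp
    ring_nf
  simp_rw [h1]
  rw [integral_comp_abs (f := fun y : ℝ => (Real.sqrt (2 * Real.pi))⁻¹ * (y ^ (1:ℝ) * Real.exp (-(1/2) * y ^ (2:ℝ))))]
  rw [integral_const_mul, integral_rpow_mul_exp_neg_mul_rpow (by norm_num) (by norm_num) (by norm_num)]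
  norm_num
  have := Real.pi_pos
  have h2 : √2 * √2 = 2 := Real.mul_self_sqrt (by norm_num)
  have h3 : √Real.pi ≠ 0 := by positivity
  have h4 : √2 ≠ 0 := by positivity
  field_simp
  nlinarith

theorem lint_dot_abs {ι : Type*} [Fintype ι] (w : ι → ℝ) :
    ∫⁻ θ, ENNReal.ofReal |w ⬝ᵥ θ| ∂(GG ι) =
      ENNReal.ofReal (Real.sqrt (2 / Real.pi) * Real.sqrt (w ⬝ᵥ w)) := by
  by_cases hw : w = 0
  · subst hw; simp
  have hpos : 0 < w ⬝ᵥ w := by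
    have h0 : 0 ≤ w ⬝ᵥ w := by
      simp only [dotProduct]; exact Finset.sum_nonneg fun i _ => mul_self_nonneg _
    have h1 : w ⬝ᵥ w ≠ 0 := by simpa [dotProduct_self_eq_zero] using hw
    exact lt_of_le_of_ne h0 (Ne.symm h1)
  set r := Real.sqrt (w ⬝ᵥ w) with hr
  have hrp : 0 < r := Real.sqrt_pos.mpr hpos
  have hrr : r * r = w ⬝ᵥ w := Real.mul_self_sqrt hpos.le
  have key := GG_lint_adj (ι := ι) (κ := Unit) (fun θ _ => r⁻¹ * (w ⬝ᵥ θ)) (fun y => (r⁻¹ * y ()) • w)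
    (by intro x y; simp [dotProduct_comm, dotProduct_smul]; ring)
    (by intro y; funext u; simp [dotProduct_smul, ← hrr]; field_simp)
    (fun y => ENNReal.ofReal (r * |y ()|)) (by fun_prop)
  have e1 : ∀ θ, r * |r⁻¹ * (w ⬝ᵥ θ)| = |w ⬝ᵥ θ| := by
    intro θ; rw [abs_mul, abs_of_pos (inv_pos.mpr hrp)]; field_simp
  simp only [e1] at key
  rw [key]
  have hmp := measurePreserving_eval (fun _ : Unit => gaussianReal 0 1) ()
  have h2 : ∫⁻ y, ENNReal.ofReal (r * |y ()|) ∂(GG Unit) =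
      ∫⁻ x, ENNReal.ofReal (r * |x|) ∂(gaussianReal 0 1) := by
    conv_rhs => rw [← hmp.map_eq]
    rw [lintegral_map (by fun_prop) hmp.measurable]
  rw [h2]
  simp_rw [ENNReal.ofReal_mul hrp.le]
  rw [lintegral_const_mul _ (by fun_prop), lint_abs_gauss, mul_comm, ENNReal.ofReal_mul (by positivity)]

theorem lint_sq_gauss : ∫⁻ x, ENNReal.ofReal (x * x) ∂(gaussianReal 0 1) = 1 := by
  have hm : MemLp id 2 (gaussianReal 0 1) := memLp_id_gaussianReal (μ := 0) (v := 1) 2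
  have hint : Integrable (fun x : ℝ => x * x) (gaussianReal 0 1) := by
    simpa [sq] using hm.integrable_sq
  rw [← ofReal_integral_eq_lintegral_ofReal hint (Filter.Eventually.of_forall fun x => mul_self_nonneg x)]
  have h := variance_id_gaussianReal (μ := 0) (v := 1)
  rw [variance_eq_sub hm] at h
  simp [sq] at h
  simp [h]

theorem lint_dot_self {ι : Type*} [Fintype ι] :
    ∫⁻ w, ENNReal.ofReal (w ⬝ᵥ w) ∂(GG ι) = ENNReal.ofReal (Fintype.card ι) := by
  have : ∀ w : ι → ℝ, ENNReal.ofReal (w ⬝ᵥ w) = ∑ i, ENNReal.ofReal (w i * w i) := by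
    intro w
    rw [← ENNReal.ofReal_sum_of_nonneg (fun i _ => mul_self_nonneg _)]; rfl
  simp_rw [this]
  rw [lintegral_finsetSum _ (by fun_prop)]
  have h2 : ∀ i : ι, ∫⁻ w, ENNReal.ofReal (w i * w i) ∂(GG ι) = 1 := by
    intro i
    have hmp := measurePreserving_eval (fun _ : ι => gaussianReal 0 1) i
    rw [← lint_sq_gauss]
    conv_rhs => rw [← hmp.map_eq]
    rw [lintegral_map (by fun_prop) hmp.measurable]
  simp [h2]

theorem int_exp_gauss (s : ℝ) (hs : 0 ≤ s) :
    ∫ x, Real.exp (-s * (x * x)) ∂(gaussianReal 0 1) = (1 + 2 * s) ^ (-(1/2) : ℝ) := by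
  rw [integral_gaussianReal_eq_integral_smul (by simp)]
  have : ∀ x : ℝ, gaussianPDFReal 0 1 x • Real.exp (-s * (x * x)) =
      (Real.sqrt (2 * Real.pi))⁻¹ * Real.exp (-(1/2 + s) * x ^ 2) := by
    intro x
    simp only [gaussianPDFReal, smul_eq_mul]
    rw [mul_assoc, ← Real.exp_add]
    simp only [NNReal.coe_one, mul_one, sub_zero]
    ring_nf
  simp_rw [this]
  rw [integral_const_mul, integral_gaussian, Real.rpow_neg (by positivity), ← Real.sqrt_eq_rpow,
    ← Real.sqrt_inv, ← Real.sqrt_inv, ← Real.sqrt_mul (by positivity)]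
  congr 1
  have := Real.pi_pos
  field_simp

theorem lint_exp_dot (m : ℕ) (s : ℝ) (hs : 0 ≤ s) :
    ∫⁻ g, ENNReal.ofReal (Real.exp (-s * (g ⬝ᵥ g))) ∂(GG (Fin m)) =
      ENNReal.ofReal ((1 + 2 * s) ^ (-(m/2) : ℝ)) := by
  have hint : Integrable (fun g : Fin m → ℝ => Real.exp (-s * (g ⬝ᵥ g))) (GG (Fin m)) := by
    apply Integrable.of_bound (C := 1)
    · apply Continuous.aestronglyMeasurable
      fun_prop
    · refine Filter.Eventually.of_forall fun g => ?_
      rw [Real.norm_eq_abs, Real.abs_exp, Real.exp_le_one_iff]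
      have : 0 ≤ g ⬝ᵥ g := Finset.sum_nonneg fun i _ => mul_self_nonneg _
      nlinarith
  rw [← ofReal_integral_eq_lintegral_ofReal hint (Filter.Eventually.of_forall fun x => (Real.exp_pos _).le)]
  congr 1
  have : ∀ g : Fin m → ℝ, Real.exp (-s * (g ⬝ᵥ g)) = ∏ i, (fun x : ℝ => Real.exp (-s * (x * x))) (g i) := by
    intro g
    simp only
    rw [← Real.exp_sum, dotProduct, Finset.mul_sum]
  simp_rw [this]
  rw [integral_fintype_prod_eq_prod (fun _ : Fin m => fun x : ℝ => Real.exp (-s * (x * x)))]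
  simp only [int_exp_gauss s hs, Finset.prod_const, Finset.card_univ, Fintype.card_fin]
  rw [← Real.rpow_natCast, ← Real.rpow_mul (by positivity)]
  congr 1; ring

theorem lint_inv_dot (m : ℕ) (hm : 3 ≤ m) :
    ∫⁻ g, ENNReal.ofReal ((g ⬝ᵥ g)⁻¹) ∂(GG (Fin m)) ≤ ENNReal.ofReal (1 / ((m:ℝ) - 2)) := by
  have hm' : (3:ℝ) ≤ m := by exact_mod_cast hm
  have h1 : ∀ g : Fin m → ℝ, ENNReal.ofReal ((g ⬝ᵥ g)⁻¹) ≤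
      ∫⁻ s in Set.Ioi (0:ℝ), ENNReal.ofReal (Real.exp (-s * (g ⬝ᵥ g))) := by
    intro g
    have h0 : 0 ≤ g ⬝ᵥ g := Finset.sum_nonneg fun i _ => mul_self_nonneg _
    rcases h0.eq_or_lt with h0 | h0
    · rw [← h0]; simp
    · have i1 := integrableOn_exp_mul_Ioi (a := -(g ⬝ᵥ g)) (by linarith) 0
      have i2 := integral_exp_mul_Ioi (a := -(g ⬝ᵥ g)) (by linarith) 0
      have e : ∀ s : ℝ, Real.exp (-s * (g ⬝ᵥ g)) = Real.exp (-(g ⬝ᵥ g) * s) := by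
        intro s; congr 1; ring
      simp_rw [e]
      rw [← ofReal_integral_eq_lintegral_ofReal i1 (Filter.Eventually.of_forall fun x => (Real.exp_pos _).le), i2]
      simp
  refine (lintegral_mono h1).trans ?_
  rw [lintegral_lintegral_swap (by
    apply Measurable.aemeasurable
    apply ENNReal.measurable_ofReal.comp
    apply Continuous.measurable
    have : Continuous fun p : (Fin m → ℝ) × ℝ => Real.exp (-p.2 * (p.1 ⬝ᵥ p.1)) := by fun_prop
    exact this)]
  have h2 : ∫⁻ s in Set.Ioi (0:ℝ), ∫⁻ g, ENNReal.ofReal (Real.exp (-s * (g ⬝ᵥ g))) ∂(GG (Fin m)) =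
      ∫⁻ s in Set.Ioi (0:ℝ), ENNReal.ofReal ((1 + 2 * s) ^ (-(m/2) : ℝ)) := by
    apply setLIntegral_congr_fun measurableSet_Ioi
    intro s hs
    exact lint_exp_dot m s (le_of_lt hs)
  rw [h2]
  have hd : ∀ x ∈ Set.Ici (0:ℝ), HasDerivAt (fun s : ℝ => -(1 + 2 * s) ^ (1 - m/2 : ℝ) / ((m:ℝ) - 2))
      ((1 + 2 * x) ^ (-(m/2) : ℝ)) x := by
    intro x hx
    have hx : 0 ≤ x := hx
    have a1 : HasDerivAt (fun s : ℝ => 1 + 2 * s) 2 x := by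
      simpa using ((hasDerivAt_id x).const_mul 2).const_add 1
    have a2 := ((a1.rpow_const (p := (1 - m/2 : ℝ)) (Or.inl (by positivity))).neg).div_const ((m:ℝ) - 2)
    refine a2.congr_deriv ?_
    have : (1 - (m:ℝ)/2 - 1) = -(m/2) := by ring
    rw [this]
    have : (m:ℝ) - 2 ≠ 0 := by linarith
    field_simp
    ring
  have hpos : ∀ x ∈ Set.Ioi (0:ℝ), 0 ≤ (1 + 2 * x) ^ (-(m/2) : ℝ) := by
    intro x hx
    have hx : 0 < x := hx
    positivity
  have ht : Filter.Tendsto (fun s : ℝ => -(1 + 2 * s) ^ (1 - m/2 : ℝ) / ((m:ℝ) - 2)) Filter.atTop (nhds 0) := by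
    have b1 : Filter.Tendsto (fun s : ℝ => 1 + 2 * s) Filter.atTop Filter.atTop :=
      Filter.tendsto_atTop_add_const_left _ _ (Filter.tendsto_id.const_mul_atTop (by norm_num))
    have b2 := (tendsto_rpow_neg_atTop (y := (m/2 - 1 : ℝ)) (by linarith)).comp b1
    have b3 := (b2.neg).div_const ((m:ℝ) - 2)
    simp only [neg_zero, zero_div] at b3
    convert b3 using 1
    funext s
    simp only [Function.comp]
    congr 3; ring
  rw [← ofReal_integral_eq_lintegral_ofReal (integrableOn_Ioi_deriv_of_nonneg' hd hpos ht)
    (by rw [Filter.EventuallyLE, ae_restrict_iff' measurableSet_Ioi]; exact Filter.Eventually.of_forall hpos)]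
  rw [integral_Ioi_of_hasDerivAt_of_nonneg' hd hpos ht]
  apply le_of_eq
  congr 1
  simp
  ring

theorem lint_mono_piece (a b s c : ℝ) (hab : a ≤ b) (hs : 0 ≤ s) (g g' : ℝ → ℝ)
    (hc : ContinuousOn g (Set.Icc a b)) (hd : ∀ x ∈ Set.Ioo a b, HasDerivAt g (g' x) x)
    (hp : ∀ x ∈ Set.Ioo a b, 0 ≤ g' x) (hr : ∀ x, c ≤ g x ∧ g x ≤ c + s) :
    ∫⁻ x in Set.Ioo a b, ENNReal.ofReal (g' x) ≤ ENNReal.ofReal s := by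
  have hi := intervalIntegral.integrableOn_deriv_of_nonneg hc hd hp
  have h1 := intervalIntegral.integral_eq_sub_of_hasDerivAt_of_le hab hc hd
    ((intervalIntegrable_iff_integrableOn_Ioc_of_le hab).mpr hi)
  rw [intervalIntegral.integral_of_le hab, integral_Ioc_eq_integral_Ioo] at h1
  rw [← ofReal_integral_eq_lintegral_ofReal (hi.mono_set Set.Ioo_subset_Ioc_self)
    (by rw [Filter.EventuallyLE, ae_restrict_iff' measurableSet_Ioo]; exact Filter.Eventually.of_forall hp), h1]
  apply ENNReal.ofReal_le_ofReal
  linarith [hr a, hr b]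

/-- the directional derivative of `|u| - √(|u|²+s²)` in direction `v` -/
noncomputable def DD {κ : Type*} [Fintype κ] (s : ℝ) (u v : κ → ℝ) : ℝ :=
  (u ⬝ᵥ v) * (1 / Real.sqrt (u ⬝ᵥ u) - 1 / Real.sqrt (u ⬝ᵥ u + s ^ 2))

theorem dot_self_nn {κ : Type*} [Fintype κ] (u : κ → ℝ) : 0 ≤ u ⬝ᵥ u :=
  Finset.sum_nonneg fun i _ => mul_self_nonneg _

theorem half_circle (A R s : ℝ) (hs : 0 ≤ s) (hR : 0 ≤ R) (hAR : R ≤ A) :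
    ∫⁻ b in Set.Ioc 0 Real.pi, ENNReal.ofReal
      |(-R * Real.sin (2 * b)) * (1 / Real.sqrt (A + R * Real.cos (2 * b))
        - 1 / Real.sqrt (A + R * Real.cos (2 * b) + s ^ 2))| ≤ ENNReal.ofReal (2 * s) := by
  rcases hR.eq_or_lt with hR0 | hR0
  · subst hR0; simp
  set q : ℝ → ℝ := fun b => A + R * Real.cos (2 * b) with hq
  set c : ℝ → ℝ := fun b => 1 / Real.sqrt (q b) - 1 / Real.sqrt (q b + s ^ 2) with hcdef
  set Φ : ℝ → ℝ := fun b => Real.sqrt (q b) - Real.sqrt (q b + s ^ 2) with hΦ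
  have hq0 : ∀ b, 0 ≤ q b := by
    intro b; have := Real.neg_one_le_cos (2 * b); simp only [hq]; nlinarith
  have hcn : ∀ b, 0 < q b → 0 ≤ c b := by
    intro b hb
    simp only [hcdef]
    rw [sub_nonneg]
    apply one_div_le_one_div_of_le (Real.sqrt_pos.mpr hb)
    apply Real.sqrt_le_sqrt; nlinarith
  have hder : ∀ b, 0 < q b → HasDerivAt Φ ((-R * Real.sin (2 * b)) * c b) b := by
    intro b hb
    have d1 : HasDerivAt (fun b : ℝ => 2 * b) 2 b := by simpa using (hasDerivAt_id b).const_mul 2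
    have d2 : HasDerivAt q (R * (-Real.sin (2 * b) * 2)) b := ((d1.cos).const_mul R).const_add A
    have d3 := d2.sqrt hb.ne'
    have d4 := (d2.add_const (s ^ 2)).sqrt (by positivity)
    have d5 := d3.sub d4
    refine d5.congr_deriv ?_
    simp only [hcdef]
    have : √(q b) ≠ 0 := (Real.sqrt_pos.mpr hb).ne'
    have : √(q b + s ^ 2) ≠ 0 := (Real.sqrt_pos.mpr (by positivity)).ne'
    field_simp
    ring
  have hcont : Continuous Φ := by simp only [hΦ, hq]; fun_prop
  have hrange : ∀ b, -s ≤ Φ b ∧ Φ b ≤ 0 := by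
    intro b
    simp only [hΦ]
    constructor
    · have : √(q b + s ^ 2) ≤ √(q b) + s := by
        rw [Real.sqrt_le_left (by positivity)]
        nlinarith [Real.sq_sqrt (hq0 b), mul_nonneg (Real.sqrt_nonneg (q b)) hs]
      linarith
    · have : √(q b) ≤ √(q b + s ^ 2) := Real.sqrt_le_sqrt (by nlinarith)
      linarith
  have hpi := Real.pi_pos
  have hqpos1 : ∀ b ∈ Set.Ioo 0 (Real.pi / 2), 0 < q b := by
    intro b hb
    have : Real.cos Real.pi < Real.cos (2 * b) :=
      Real.cos_lt_cos_of_nonneg_of_le_pi (by linarith [hb.1]) le_rfl (by linarith [hb.2])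
    rw [Real.cos_pi] at this
    simp only [hq]; nlinarith
  have hqpos2 : ∀ b ∈ Set.Ioo (Real.pi / 2) Real.pi, 0 < q b := by
    intro b hb
    have h := hqpos1 (Real.pi - b) ⟨by linarith [hb.2], by linarith [hb.1]⟩
    have e : q (Real.pi - b) = q b := by
      simp only [hq]
      rw [show 2 * (Real.pi - b) = 2 * Real.pi - 2 * b by ring, Real.cos_two_pi_sub]
    rwa [e] at h
  have hs1 : ∀ b ∈ Set.Ioo 0 (Real.pi / 2), 0 < Real.sin (2 * b) := by
    intro b hb
    exact Real.sin_pos_of_pos_of_lt_pi (by linarith [hb.1]) (by linarith [hb.2])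
  have hs2 : ∀ b ∈ Set.Ioo (Real.pi / 2) Real.pi, Real.sin (2 * b) < 0 := by
    intro b hb
    have h := hs1 (Real.pi - b) ⟨by linarith [hb.2], by linarith [hb.1]⟩
    rw [show 2 * (Real.pi - b) = 2 * Real.pi - 2 * b by ring, Real.sin_two_pi_sub] at h
    linarith
  have hg1 : ∀ b ∈ Set.Ioo 0 (Real.pi / 2), (-R * Real.sin (2 * b)) * c b ≤ 0 := by
    intro b hb
    have := hs1 b hb
    have := hcn b (hqpos1 b hb)
    have : 0 ≤ R * Real.sin (2 * b) * c b := by positivity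
    linarith
  have hg2 : ∀ b ∈ Set.Ioo (Real.pi / 2) Real.pi, 0 ≤ (-R * Real.sin (2 * b)) * c b := by
    intro b hb
    have h1 := hs2 b hb
    have := hcn b (hqpos2 b hb)
    have : 0 ≤ -R * Real.sin (2 * b) := by nlinarith
    positivity
  have p1 := lint_mono_piece 0 (Real.pi / 2) s 0 (by positivity) hs (fun b => -Φ b)
    (fun b => -((-R * Real.sin (2 * b)) * c b)) (by fun_prop)
    (fun b hb => (hder b (hqpos1 b hb)).neg) (fun b hb => by linarith [hg1 b hb])
    (fun b => by constructor <;> linarith [hrange b])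
  have p2 := lint_mono_piece (Real.pi / 2) Real.pi s (-s) (by linarith) hs Φ
    (fun b => (-R * Real.sin (2 * b)) * c b) (by fun_prop)
    (fun b hb => (hder b (hqpos2 b hb))) hg2
    (fun b => by constructor <;> linarith [hrange b])
  have hun : Set.Ioc 0 Real.pi = Set.Ioc 0 (Real.pi / 2) ∪ Set.Ioc (Real.pi / 2) Real.pi :=
    (Set.Ioc_union_Ioc_eq_Ioc (by positivity) (by linarith)).symm
  rw [hun]
  refine (lintegral_union_le _ _ _).trans ?_
  rw [two_mul, ENNReal.ofReal_add hs hs]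
  apply add_le_add
  · rw [setLIntegral_congr Ioo_ae_eq_Ioc.symm]
    refine le_trans (le_of_eq ?_) p1
    apply setLIntegral_congr_fun measurableSet_Ioo
    intro b hb
    simp only
    rw [abs_of_nonpos (hg1 b hb)]
  · rw [setLIntegral_congr Ioo_ae_eq_Ioc.symm]
    refine le_trans (le_of_eq ?_) p2
    apply setLIntegral_congr_fun measurableSet_Ioo
    intro b hb
    simp only
    rw [abs_of_nonneg (hg2 b hb)]

theorem circle_DD {κ : Type*} [Fintype κ] (s : ℝ) (hs : 0 ≤ s) (u v : κ → ℝ) :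
    ∫⁻ a in Set.Ioc 0 Real.pi, ENNReal.ofReal
      |DD s (Real.cos a • u + Real.sin a • v) (Real.cos a • v - Real.sin a • u)| ≤ ENNReal.ofReal (2 * s) := by
  set A := (u ⬝ᵥ u + v ⬝ᵥ v) / 2 with hA
  set B := (u ⬝ᵥ u - v ⬝ᵥ v) / 2 with hB
  set C := u ⬝ᵥ v with hC
  set w : ℂ := ⟨B, C⟩ with hw
  set R := ‖w‖ with hR
  set φ := w.arg / 2 with hφ
  have hBR : B = R * Real.cos (2 * φ) := by
    have := Complex.norm_mul_cos_arg w
    rw [hφ, show 2 * (w.arg / 2) = w.arg by ring, this]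
  have hCR : C = R * Real.sin (2 * φ) := by
    have := Complex.norm_mul_sin_arg w
    rw [hφ, show 2 * (w.arg / 2) = w.arg by ring, this]
  have hvu : v ⬝ᵥ u = C := dotProduct_comm _ _
  have e1 : ∀ a, (Real.cos a • u + Real.sin a • v) ⬝ᵥ (Real.cos a • u + Real.sin a • v) =
      A + R * Real.cos (2 * (a - φ)) := by
    intro a
    rw [show 2 * (a - φ) = 2 * a - 2 * φ by ring, Real.cos_sub, mul_add]
    have : R * (Real.cos (2 * a) * Real.cos (2 * φ)) + R * (Real.sin (2 * a) * Real.sin (2 * φ)) =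
      Real.cos (2 * a) * B + Real.sin (2 * a) * C := by rw [hBR, hCR]; ring
    rw [this]
    simp only [add_dotProduct, dotProduct_add, smul_dotProduct, dotProduct_smul, smul_eq_mul, hvu, ← hC]
    rw [Real.cos_two_mul, Real.sin_two_mul, hA, hB]
    have := Real.sin_sq_add_cos_sq a
    have h2 : Real.sin a ^ 2 = 1 - Real.cos a ^ 2 := by linarith
    linear_combination (v ⬝ᵥ v) * h2
  have e2 : ∀ a, (Real.cos a • u + Real.sin a • v) ⬝ᵥ (Real.cos a • v - Real.sin a • u) =
      -R * Real.sin (2 * (a - φ)) := by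
    intro a
    rw [show 2 * (a - φ) = 2 * a - 2 * φ by ring, Real.sin_sub]
    have : -R * (Real.sin (2 * a) * Real.cos (2 * φ) - Real.cos (2 * a) * Real.sin (2 * φ)) =
      Real.cos (2 * a) * C - Real.sin (2 * a) * B := by rw [hBR, hCR]; ring
    rw [this]
    simp only [add_dotProduct, dotProduct_sub, smul_dotProduct, dotProduct_smul, smul_eq_mul, hvu, ← hC]
    rw [Real.cos_two_mul, Real.sin_two_mul, hB]
    have := Real.sin_sq_add_cos_sq a
    linear_combination (-C) * this
  have hAR : R ≤ A := by
    have h := dot_self_nn (Real.cos (φ + Real.pi / 2) • u + Real.sin (φ + Real.pi / 2) • v)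
    rw [e1, show 2 * (φ + Real.pi / 2 - φ) = Real.pi by ring, Real.cos_pi] at h
    linarith
  set F : ℝ → ENNReal := fun b => ENNReal.ofReal
      |(-R * Real.sin (2 * b)) * (1 / Real.sqrt (A + R * Real.cos (2 * b))
        - 1 / Real.sqrt (A + R * Real.cos (2 * b) + s ^ 2))| with hF
  have hmain := half_circle A R s hs (norm_nonneg _) hAR
  have hFper : Function.Periodic F Real.pi := by
    intro b
    simp only [hF]
    rw [show 2 * (b + Real.pi) = 2 * b + 2 * Real.pi by ring, Real.sin_add_two_pi, Real.cos_add_two_pi]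
  calc _ = ∫⁻ a in Set.Ioc 0 Real.pi, F (a - φ) := by
        apply lintegral_congr; intro a
        simp only [DD, e1, e2, hF]
    _ = ∫⁻ a in Set.Ioc (0 - φ) (Real.pi - φ), F a := by
        have := (measurePreserving_sub_right (volume : Measure ℝ) φ).setLIntegral_comp_preimage_emb
          (MeasurableEquiv.subRight φ).measurableEmbedding F (Set.Ioc (0 - φ) (Real.pi - φ))
        rw [← this]
        congr 2
        ext x; simp
    _ = ∫⁻ a in Set.Ioc 0 Real.pi, F a := by
        have h1 := isAddFundamentalDomain_Ioc Real.pi_pos (0 - φ)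
        have h2 := isAddFundamentalDomain_Ioc Real.pi_pos 0
        have h3 := h1.setLIntegral_eq h2 F (by
          intro g x
          obtain ⟨g, hg⟩ := g
          obtain ⟨k, rfl⟩ := AddSubgroup.mem_zmultiples_iff.mp hg
          have := hFper.zsmul k x
          rw [← this, add_comm]; rfl)
        rw [show (0 - φ + Real.pi) = Real.pi - φ by ring, zero_add] at h3
        exact h3
    _ ≤ _ := hmain

/-- the core loss function -/
noncomputable def coreF {ι κ : Type*} [Fintype ι] [Fintype κ] (M : Matrix κ ι ℝ) (s : ℝ) (z : ι → ℝ) : ℝ :=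
  Real.sqrt ((Mᵀ *ᵥ (M *ᵥ z)) ⬝ᵥ (Mᵀ *ᵥ (M *ᵥ z))) *
    (1 / Real.sqrt ((M *ᵥ z) ⬝ᵥ (M *ᵥ z)) - 1 / Real.sqrt ((M *ᵥ z) ⬝ᵥ (M *ᵥ z) + s ^ 2))

theorem core_lemma {ι κ : Type*} [Fintype ι] [Fintype κ] (M : Matrix κ ι ℝ) (s : ℝ) (hs : 0 ≤ s) :
    ∫⁻ z, ENNReal.ofReal (coreF M s z) ∂(GG ι) ≤ ENNReal.ofReal (Real.sqrt (2 / Real.pi) * s) := by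
  have hpi := Real.pi_pos
  have hDm : Measurable (fun p : (ι → ℝ) × (ι → ℝ) => ENNReal.ofReal |DD s (M *ᵥ p.1) (M *ᵥ p.2)|) := by
    have m1 : Measurable fun p : (ι → ℝ) × (ι → ℝ) => M *ᵥ p.1 := by
      apply Continuous.measurable; fun_prop
    have c1 : Continuous fun p : (ι → ℝ) × (ι → ℝ) => (M *ᵥ p.1) ⬝ᵥ (M *ᵥ p.1) := by fun_prop
    have c2 : Continuous fun p : (ι → ℝ) × (ι → ℝ) => (M *ᵥ p.1) ⬝ᵥ (M *ᵥ p.2) := by fun_prop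
    have c3 := c1.measurable
    have c4 := c2.measurable
    unfold DD
    fun_prop
  -- step 1
  have h1 : ∀ z, ENNReal.ofReal (coreF M s z) =
      ENNReal.ofReal (Real.sqrt (Real.pi / 2)) * ∫⁻ θ, ENNReal.ofReal |DD s (M *ᵥ z) (M *ᵥ θ)| ∂(GG ι) := by
    intro z
    set c := 1 / Real.sqrt ((M *ᵥ z) ⬝ᵥ (M *ᵥ z)) - 1 / Real.sqrt ((M *ᵥ z) ⬝ᵥ (M *ᵥ z) + s ^ 2) with hc
    by_cases hz : M *ᵥ z = 0
    · simp [coreF, DD, hz]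
    have hq : 0 < (M *ᵥ z) ⬝ᵥ (M *ᵥ z) := by
      refine lt_of_le_of_ne (dot_self_nn _) (Ne.symm ?_)
      simpa [dotProduct_self_eq_zero] using hz
    have hcn : 0 ≤ c := by
      rw [hc, sub_nonneg]
      apply one_div_le_one_div_of_le (Real.sqrt_pos.mpr hq)
      apply Real.sqrt_le_sqrt; nlinarith
    have e : ∀ θ, |DD s (M *ᵥ z) (M *ᵥ θ)| = c * |(Mᵀ *ᵥ (M *ᵥ z)) ⬝ᵥ θ| := by
      intro θ
      rw [DD, abs_mul, ← hc, abs_of_nonneg hcn, mul_comm]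
      congr 2
      rw [Matrix.dotProduct_mulVec, Matrix.mulVec_transpose]
    simp_rw [e, ENNReal.ofReal_mul hcn]
    have hm : Measurable fun θ : ι → ℝ => ENNReal.ofReal |(Mᵀ *ᵥ (M *ᵥ z)) ⬝ᵥ θ| := by
      have : Continuous fun θ : ι → ℝ => (Mᵀ *ᵥ (M *ᵥ z)) ⬝ᵥ θ := by fun_prop
      have := this.measurable
      fun_prop
    rw [lintegral_const_mul _ hm, lint_dot_abs, ← ENNReal.ofReal_mul hcn, ← ENNReal.ofReal_mul (by positivity)]
    congr 1
    rw [coreF, ← hc]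
    have : √(Real.pi / 2) * √(2 / Real.pi) = 1 := by
      rw [← Real.sqrt_mul (by positivity)]
      rw [show Real.pi / 2 * (2 / Real.pi) = 1 by field_simp]; simp
    linear_combination (-c * Real.sqrt ((Mᵀ *ᵥ (M *ᵥ z)) ⬝ᵥ (Mᵀ *ᵥ (M *ᵥ z)))) * this
  simp_rw [h1]
  have hmz : Measurable fun z : ι → ℝ => ∫⁻ θ, ENNReal.ofReal |DD s (M *ᵥ z) (M *ᵥ θ)| ∂(GG ι) :=
    Measurable.lintegral_prod_right hDm
  rw [lintegral_const_mul _ hmz]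
  set E := ∫⁻ z, ∫⁻ θ, ENNReal.ofReal |DD s (M *ᵥ z) (M *ᵥ θ)| ∂(GG ι) ∂(GG ι) with hE
  have hrot : ∀ a : ℝ, ∫⁻ z, ∫⁻ θ, ENNReal.ofReal |DD s (Real.cos a • (M *ᵥ z) + Real.sin a • (M *ᵥ θ))
      (Real.cos a • (M *ᵥ θ) - Real.sin a • (M *ᵥ z))| ∂(GG ι) ∂(GG ι) = E := by
    intro a
    have hsc := Real.sin_sq_add_cos_sq a
    have := GG_lint_adj3 (ι := ι) (ι' := ι) (κ := ι) (κ' := ι)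
      (fun z θ => Real.cos a • z + Real.sin a • θ) (fun z θ => Real.cos a • θ - Real.sin a • z)
      (fun z θ => Real.cos a • z - Real.sin a • θ) (fun z θ => Real.cos a • θ + Real.sin a • z)
      (by intro x x' y y'
          simp only [add_dotProduct, dotProduct_add, sub_dotProduct, dotProduct_sub, smul_dotProduct, dotProduct_smul, smul_eq_mul]
          ring)
      (by intro y y'; funext i; simp; linear_combination (y i) * hsc)
      (by intro y y'; funext i; simp; linear_combination (y' i) * hsc)
      (fun z θ => ENNReal.ofReal |DD s (M *ᵥ z) (M *ᵥ θ)|) hDm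
    rw [hE, ← this]
    simp only [mulVec_add, mulVec_sub, mulVec_smul]
  have hm3 : Measurable (fun p : ((ι → ℝ) × (ι → ℝ)) × ℝ => ENNReal.ofReal
      |DD s (Real.cos p.2 • (M *ᵥ p.1.1) + Real.sin p.2 • (M *ᵥ p.1.2))
      (Real.cos p.2 • (M *ᵥ p.1.2) - Real.sin p.2 • (M *ᵥ p.1.1))|) := by
    have c0 : Continuous fun p : ((ι → ℝ) × (ι → ℝ)) × ℝ =>
      ((Real.cos p.2 • p.1.1 + Real.sin p.2 • p.1.2 : ι → ℝ), (Real.cos p.2 • p.1.2 - Real.sin p.2 • p.1.1 : ι → ℝ)) := by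
      fun_prop
    have := hDm.comp c0.measurable
    convert this using 1
    funext p
    simp only [Function.comp, mulVec_add, mulVec_sub, mulVec_smul]
  have hint : ENNReal.ofReal Real.pi * E ≤ ENNReal.ofReal (2 * s) := by
    calc ENNReal.ofReal Real.pi * E = ∫⁻ a in Set.Ioc 0 Real.pi, E := by
          rw [setLIntegral_const, Real.volume_Ioc, mul_comm]; simp
      _ = ∫⁻ a in Set.Ioc 0 Real.pi, ∫⁻ p : (ι → ℝ) × (ι → ℝ), ENNReal.ofReal |DD s (Real.cos a • (M *ᵥ p.1) + Real.sin a • (M *ᵥ p.2))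
            (Real.cos a • (M *ᵥ p.2) - Real.sin a • (M *ᵥ p.1))| ∂((GG ι).prod (GG ι)) := by
          apply lintegral_congr; intro a
          rw [← hrot a, lintegral_prod]
          exact (hm3.comp (measurable_id.prodMk measurable_const)).aemeasurable
      _ = ∫⁻ p : (ι → ℝ) × (ι → ℝ), (∫⁻ a in Set.Ioc 0 Real.pi, ENNReal.ofReal |DD s (Real.cos a • (M *ᵥ p.1) + Real.sin a • (M *ᵥ p.2))
            (Real.cos a • (M *ᵥ p.2) - Real.sin a • (M *ᵥ p.1))|) ∂((GG ι).prod (GG ι)) := by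
          rw [lintegral_lintegral_swap]
          exact (hm3.comp measurable_swap).aemeasurable
      _ ≤ ∫⁻ p : (ι → ℝ) × (ι → ℝ), ENNReal.ofReal (2 * s) ∂((GG ι).prod (GG ι)) :=
          lintegral_mono fun p => circle_DD s hs _ _
      _ = ENNReal.ofReal (2 * s) := by simp
  have hEle : E ≤ ENNReal.ofReal (2 * s / Real.pi) := by
    rw [ENNReal.ofReal_div_of_pos hpi, ENNReal.le_div_iff_mul_le (Or.inl (by simpa using hpi)) (Or.inl (by simp)), mul_comm]
    exact hint
  calc _ ≤ ENNReal.ofReal (Real.sqrt (Real.pi / 2)) * ENNReal.ofReal (2 * s / Real.pi) := by gcongr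
    _ = _ := by
      rw [← ENNReal.ofReal_mul (by positivity)]
      congr 1
      rw [Real.sqrt_div hpi.le, Real.sqrt_div (by norm_num)]
      have h2 : √2 * √2 = 2 := Real.mul_self_sqrt (by norm_num)
      have h3 : √Real.pi * √Real.pi = Real.pi := Real.mul_self_sqrt hpi.le
      have h4 : √Real.pi ≠ 0 := by positivity
      have h5 : √2 ≠ 0 := by positivity
      field_simp
      rw [sq, sq, h2, h3]; ring

/-- contraction -/
def Contr {m k : Type*} [Fintype m] [Fintype k] (X : Matrix m k ℝ) : Prop :=
  ∀ v, (X *ᵥ v) ⬝ᵥ (X *ᵥ v) ≤ v ⬝ᵥ v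

theorem dot_nn {κ : Type*} [Fintype κ] (u : κ → ℝ) : 0 ≤ u ⬝ᵥ u :=
  Finset.sum_nonneg fun _ _ => mul_self_nonneg _

theorem dot_cs {κ : Type*} [Fintype κ] (u v : κ → ℝ) : (u ⬝ᵥ v) ^ 2 ≤ (u ⬝ᵥ u) * (v ⬝ᵥ v) := by
  have := Finset.sum_mul_sq_le_sq_mul_sq Finset.univ u v
  simpa [dotProduct, sq] using this

theorem Contr.mul {m k p : Type*} [Fintype m] [Fintype k] [Fintype p] {X : Matrix m k ℝ} {Y : Matrix k p ℝ}
    (hX : Contr X) (hY : Contr Y) : Contr (X * Y) := by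
  intro v
  rw [← Matrix.mulVec_mulVec]
  exact (hX _).trans (hY _)

theorem mulVec_dot {m k : Type*} [Fintype m] [Fintype k] (X : Matrix m k ℝ) (v : k → ℝ) (w : m → ℝ) :
    (X *ᵥ v) ⬝ᵥ w = v ⬝ᵥ (Xᵀ *ᵥ w) := by
  rw [Matrix.mulVec_transpose, dotProduct_comm, Matrix.dotProduct_mulVec, dotProduct_comm]

theorem Contr.transpose {m k : Type*} [Fintype m] [Fintype k] {X : Matrix m k ℝ}
    (hX : Contr X) : Contr Xᵀ := by
  intro u
  set a := (Xᵀ *ᵥ u) ⬝ᵥ (Xᵀ *ᵥ u) with ha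
  have h1 : a = (X *ᵥ (Xᵀ *ᵥ u)) ⬝ᵥ u := by
    rw [mulVec_dot]
  have h2 := dot_cs (X *ᵥ (Xᵀ *ᵥ u)) u
  rw [← h1] at h2
  have h3 := hX (Xᵀ *ᵥ u)
  rw [← ha] at h3
  have h4 : 0 ≤ a := dot_nn _
  have h5 : 0 ≤ u ⬝ᵥ u := dot_nn _
  by_contra hlt
  push Not at hlt
  nlinarith

theorem Contr.of_iso {m k : Type*} [Fintype m] [Fintype k] [DecidableEq k] {X : Matrix m k ℝ}
    (hX : Xᵀ * X = 1) : Contr X := by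
  intro u
  rw [mulVec_dot, Matrix.mulVec_mulVec, hX, Matrix.one_mulVec]

theorem Contr.row_le {m k : Type*} [Fintype m] [Fintype k] {X : Matrix m k ℝ}
    (hX : Contr X) (i : m) : ∑ t, X i t ^ 2 ≤ 1 := by
  have := hX.transpose (Pi.single i 1)
  rw [dotProduct_single] at this
  simp [dotProduct] at this
  simpa [sq] using this

theorem Contr.frob_le {m : Type*} {k : ℕ} [Fintype m] {X : Matrix m (Fin k) ℝ}
    (hX : Contr X) : ∑ i, ∑ t, X i t ^ 2 ≤ k := by
  rw [Finset.sum_comm]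
  have : ∀ t ∈ (Finset.univ : Finset (Fin k)), ∑ i, X i t ^ 2 ≤ 1 := fun t _ => hX.transpose.row_le t
  simpa using Finset.sum_le_sum this

theorem weighted_sum {n k : ℕ} (hkn : k < n) (σ w : Fin n → ℝ) (hσ : Antitone σ) (hσ0 : ∀ j, 0 ≤ σ j)
    (hw0 : ∀ j, 0 ≤ w j) (hw1 : ∀ j, w j ≤ 1) (hw : ∑ j, w j ≤ k) :
    ∑ j, σ j * w j ≤ ∑ j : Fin k, σ (Fin.castLE hkn.le j) := by
  set τ := σ ⟨k, hkn⟩ with hτ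
  have h1 : ∑ j, (σ j - τ) * w j ≤ ∑ j : Fin n, if (j:ℕ) < k then (σ j - τ) else 0 := by
    apply Finset.sum_le_sum
    intro j _
    split_ifs with h
    · have : τ ≤ σ j := hσ (by simp [Fin.le_def]; omega)
      nlinarith [hw1 j]
    · have : σ j ≤ τ := hσ (by simp [Fin.le_def]; omega)
      nlinarith [hw0 j]
  have h2 : ∀ f : Fin n → ℝ, (∑ j : Fin n, if (j:ℕ) < k then f j else 0) =
      ∑ j : Fin k, f (Fin.castLE hkn.le j) := by
    intro f
    rw [← Finset.sum_filter]
    symm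
    apply Finset.sum_bij (fun (j : Fin k) _ => Fin.castLE hkn.le j)
    · intro j _; simp
    · intro a _ b _ h; simpa using h
    · intro b hb; simp at hb; exact ⟨⟨b, hb⟩, by simp, by ext; simp⟩
    · intro j _; rfl
  rw [h2 (fun j => σ j - τ)] at h1
  simp only [Finset.sum_sub_distrib, sub_mul, Finset.sum_const, Finset.card_univ, Fintype.card_fin, nsmul_eq_mul] at h1
  rw [← Finset.mul_sum] at h1
  have := hσ0 ⟨k, hkn⟩
  nlinarith

theorem KF_upper {m p : Type*} [Fintype m] [Fintype p] {n k : ℕ} (hkn : k < n)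
    (A : Matrix m p ℝ) (W : Matrix m (Fin n) ℝ) (V : Matrix p (Fin n) ℝ)
    (σ : Fin n → ℝ) (hσ : Antitone σ) (hσ0 : ∀ j, 0 ≤ σ j) (hA : A = W * Matrix.diagonal σ * Vᵀ)
    (hW : Contr W) (hV : Contr V) (X : Matrix m (Fin k) ℝ) (Y : Matrix p (Fin k) ℝ)
    (hX : Contr X) (hY : Contr Y) :
    (Xᵀ * A * Y).trace ≤ ∑ j : Fin k, σ (Fin.castLE hkn.le j) := by
  set X' := Wᵀ * X with hX'
  set Y' := Vᵀ * Y with hY'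
  have cX : Contr X' := hW.transpose.mul hX
  have cY : Contr Y' := hV.transpose.mul hY
  have e : Xᵀ * A * Y = X'ᵀ * (Matrix.diagonal σ * Y') := by
    rw [hA, hX', hY', Matrix.transpose_mul, Matrix.transpose_transpose]
    simp only [Matrix.mul_assoc]
  have e2 : (Xᵀ * A * Y).trace = ∑ j, σ j * ∑ t, X' j t * Y' j t := by
    rw [e]
    simp only [Matrix.trace, Matrix.diag, Matrix.mul_apply, Matrix.transpose_apply, Matrix.diagonal_mul]
    rw [Finset.sum_comm]
    apply Finset.sum_congr rfl; intro j _
    rw [Finset.mul_sum]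
    apply Finset.sum_congr rfl; intro t _
    simp [Matrix.diagonal_apply]
    ring
  rw [e2]
  refine le_trans ?_ (weighted_sum hkn σ (fun j => (∑ t, X' j t ^ 2 + ∑ t, Y' j t ^ 2) / 2) hσ hσ0
    (fun j => ?_) (fun j => ?_) ?_)
  · apply Finset.sum_le_sum; intro j _
    apply mul_le_mul_of_nonneg_left _ (hσ0 j)
    rw [← Finset.sum_add_distrib, Finset.sum_div]
    apply Finset.sum_le_sum; intro t _
    nlinarith [sq_nonneg (X' j t - Y' j t)]
  · positivity
  · linarith [cX.row_le j, cY.row_le j]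
  · rw [← Finset.sum_div, Finset.sum_add_distrib]
    linarith [cX.frob_le, cY.frob_le]

theorem eig_exists {n : ℕ} (H : Matrix (Fin n) (Fin n) ℝ) (hH : H.IsHermitian) :
    Antitone (eigsDesc H) ∧ ∃ V : Matrix (Fin n) (Fin n) ℝ, Vᵀ * V = 1 ∧ V * Vᵀ = 1 ∧
      H * V = V * Matrix.diagonal (eigsDesc H) := by
  set τ := Tuple.sort (fun j => -hH.eigenvalues j) with hτ
  have he : eigsDesc H = fun i => hH.eigenvalues (τ i) := by
    unfold eigsDesc; rw [dif_pos hH]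
  refine ⟨?_, ?_⟩
  · have := Tuple.monotone_sort (fun j => -hH.eigenvalues j)
    rw [he]
    intro i j hij
    have := this hij
    simp only [Function.comp] at this
    simp only [hτ]; linarith
  · set V : Matrix (Fin n) (Fin n) ℝ := fun i j => hH.eigenvectorBasis (τ j) i with hV
    have h1 : Vᵀ * V = 1 := by
      ext i j
      have := hH.eigenvectorBasis.inner_eq_ite (τ i) (τ j)
      rw [Matrix.one_apply]
      simp only [EmbeddingLike.apply_eq_iff_eq] at this
      rw [← this, EuclideanSpace.inner_eq_star_dotProduct, dotProduct_comm]
      rfl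
    refine ⟨V, h1, mul_eq_one_comm.mp h1, ?_⟩
    ext i j
    have := congrFun (hH.mulVec_eigenvectorBasis (τ j)) i
    rw [Matrix.mul_diagonal, he]
    simp at this
    rw [mul_comm]
    exact this

theorem svd_exists {m n : ℕ} (A : Matrix (Fin m) (Fin n) ℝ) :
    Antitone (svalsDesc A) ∧ (∀ j, 0 ≤ svalsDesc A j) ∧
    ∃ (W : Matrix (Fin m) (Fin n) ℝ) (V : Matrix (Fin n) (Fin n) ℝ), Contr W ∧ Vᵀ * V = 1 ∧
      A = W * Matrix.diagonal (svalsDesc A) * Vᵀ ∧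
      Wᵀ * W * Matrix.diagonal (svalsDesc A) = Matrix.diagonal (svalsDesc A) := by
  have hH : (Aᵀ * A).IsHermitian := by
    simpa using Matrix.isHermitian_conjTranspose_mul_self A
  obtain ⟨hanti, V, hV, hV', hAV⟩ := eig_exists _ hH
  set μ := eigsDesc (Aᵀ * A) with hμ
  set σ := svalsDesc A with hσ
  have hσμ : ∀ j, σ j = Real.sqrt (μ j) := fun j => rfl
  have hG : (A * V)ᵀ * (A * V) = Matrix.diagonal μ := by
    rw [Matrix.transpose_mul, Matrix.mul_assoc, ← Matrix.mul_assoc Aᵀ, hAV, ← Matrix.mul_assoc, hV, Matrix.one_mul]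
  have hcol : ∀ j, ∑ i, (A * V) i j ^ 2 = μ j := by
    intro j
    have := congrFun (congrFun hG j) j
    rw [Matrix.mul_apply] at this
    simpa [sq] using this
  have hμ0 : ∀ j, 0 ≤ μ j := by
    intro j; rw [← hcol j]; positivity
  have hσσ : ∀ j, σ j * σ j = μ j := fun j => Real.mul_self_sqrt (hμ0 j)
  refine ⟨fun i j hij => Real.sqrt_le_sqrt (hanti hij), fun j => Real.sqrt_nonneg _,
    A * V * Matrix.diagonal (fun j => (σ j)⁻¹), V, ?_, hV, ?_, ?_⟩
  · have hWW : (A * V * Matrix.diagonal (fun j => (σ j)⁻¹))ᵀ * (A * V * Matrix.diagonal (fun j => (σ j)⁻¹)) =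
        Matrix.diagonal (fun j => (σ j)⁻¹ * μ j * (σ j)⁻¹) := by
      rw [Matrix.transpose_mul, Matrix.diagonal_transpose, Matrix.mul_assoc, ← Matrix.mul_assoc _ (A * V), hG]
      simp [Matrix.diagonal_mul_diagonal, mul_assoc]
    intro v
    rw [mulVec_dot, Matrix.mulVec_mulVec, hWW]
    apply Finset.sum_le_sum
    intro j _
    rw [Matrix.mulVec_diagonal, ← hσσ]
    by_cases h : σ j = 0
    · simp [h, mul_self_nonneg]
    · apply le_of_eq; field_simp
  · have : A * V * Matrix.diagonal (fun j => (σ j)⁻¹) * Matrix.diagonal σ = A * V := by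
      ext i j
      rw [Matrix.mul_assoc, Matrix.diagonal_mul_diagonal, Matrix.mul_diagonal]
      by_cases h : σ j = 0
      · have h0 : μ j = 0 := by rw [← hσσ, h, mul_zero]
        have := hcol j
        rw [h0, Finset.sum_eq_zero_iff_of_nonneg (fun _ _ => sq_nonneg _)] at this
        have := this i (Finset.mem_univ _)
        rw [pow_eq_zero_iff (by norm_num)] at this
        rw [this]; simp
      · rw [inv_mul_cancel₀ h, mul_one]
    rw [this, Matrix.mul_assoc, hV', Matrix.mul_one]
  · have hWW : (A * V * Matrix.diagonal (fun j => (σ j)⁻¹))ᵀ * (A * V * Matrix.diagonal (fun j => (σ j)⁻¹)) =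
        Matrix.diagonal (fun j => (σ j)⁻¹ * μ j * (σ j)⁻¹) := by
      rw [Matrix.transpose_mul, Matrix.diagonal_transpose, Matrix.mul_assoc, ← Matrix.mul_assoc _ (A * V), hG]
      simp [Matrix.diagonal_mul_diagonal, mul_assoc]
    rw [hWW, Matrix.diagonal_mul_diagonal]
    congr 1
    funext j
    rw [← hσσ]
    by_cases h : σ j = 0
    · simp [h]
    · field_simp

theorem KF_svals {m n k : ℕ} (hkn : k < n) (A : Matrix (Fin m) (Fin n) ℝ)
    (X : Matrix (Fin m) (Fin k) ℝ) (Y : Matrix (Fin n) (Fin k) ℝ) (hX : Contr X) (hY : Contr Y) :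
    (Xᵀ * A * Y).trace ≤ ∑ j : Fin k, svalsDesc A (Fin.castLE hkn.le j) := by
  obtain ⟨h1, h2, W, V, hW, hV, hA, -⟩ := svd_exists A
  exact KF_upper hkn A W V _ h1 h2 hA hW (Contr.of_iso hV) X Y hX hY

theorem submat_trace {n k : ℕ} (hkn : k < n) (σ : Fin n → ℝ) :
    ((Matrix.diagonal σ).submatrix (Fin.castLE hkn.le) (Fin.castLE hkn.le) : Matrix (Fin k) (Fin k) ℝ).trace
      = ∑ j : Fin k, σ (Fin.castLE hkn.le j) := by
  simp [Matrix.trace]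

theorem Contr.submat {m n k : ℕ} (hkn : k < n) {W : Matrix (Fin m) (Fin n) ℝ} (hW : Contr W) :
    Contr (W.submatrix id (Fin.castLE hkn.le) : Matrix (Fin m) (Fin k) ℝ) := by
  have : (W.submatrix id (Fin.castLE hkn.le) : Matrix (Fin m) (Fin k) ℝ) =
      W * (1 : Matrix (Fin n) (Fin n) ℝ).submatrix id (Fin.castLE hkn.le) := by
    ext i j; simp [Matrix.mul_apply, Matrix.one_apply]
  rw [this]
  apply hW.mul
  apply Contr.of_iso
  rw [Matrix.transpose_submatrix, Matrix.transpose_one]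
  ext i j
  simp [Matrix.mul_apply, Matrix.one_apply]

theorem KF_attain {m n k : ℕ} (hkn : k < n) (A : Matrix (Fin m) (Fin n) ℝ) :
    ∃ (X : Matrix (Fin m) (Fin k) ℝ) (Y : Matrix (Fin n) (Fin k) ℝ), Contr X ∧ Contr Y ∧
    (Xᵀ * A * Y).trace = ∑ j : Fin k, svalsDesc A (Fin.castLE hkn.le j) := by
  obtain ⟨h1, h2, W, V, hW, hV, hA, hWW⟩ := svd_exists A
  refine ⟨W.submatrix id (Fin.castLE hkn.le), V.submatrix id (Fin.castLE hkn.le), hW.submat hkn,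
    (Contr.of_iso hV).submat hkn, ?_⟩
  rw [← submat_trace hkn]
  congr 1
  have : Wᵀ * A * V = Matrix.diagonal (svalsDesc A) := by
    conv_lhs => rw [hA]
    rw [← Matrix.mul_assoc, ← Matrix.mul_assoc, hWW, Matrix.mul_assoc, hV, Matrix.mul_one]
  rw [← this, Matrix.transpose_submatrix]
  ext i j
  simp [Matrix.mul_apply]

/-- Ky Fan sums for a PSD matrix given a diagonalization. -/
theorem svals_psd {n k : ℕ} (hkn : k < n) (K U : Matrix (Fin n) (Fin n) ℝ) (lam : Fin n → ℝ)
    (hl : Antitone lam) (hl0 : ∀ j, 0 ≤ lam j) (hU : Uᵀ * U = 1) (hK : K = U * Matrix.diagonal lam * Uᵀ) :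
    ∑ j : Fin k, svalsDesc K (Fin.castLE hkn.le j) = ∑ j : Fin k, lam (Fin.castLE hkn.le j) := by
  apply le_antisymm
  · obtain ⟨X, Y, hX, hY, h⟩ := KF_attain hkn K
    rw [← h]
    exact KF_upper hkn K U U lam hl hl0 hK (Contr.of_iso hU) (Contr.of_iso hU) X Y hX hY
  · have := KF_svals hkn K _ _ ((Contr.of_iso hU).submat hkn) ((Contr.of_iso hU).submat hkn)
    refine le_trans (le_of_eq ?_) this
    rw [← submat_trace hkn]
    congr 1
    have : Uᵀ * K * U = Matrix.diagonal lam := by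
      conv_lhs => rw [hK]
      rw [← Matrix.mul_assoc, ← Matrix.mul_assoc, hU, Matrix.mul_assoc, hU, Matrix.mul_one, Matrix.one_mul]
    rw [← this, Matrix.transpose_submatrix]
    ext i j
    simp [Matrix.mul_apply]

theorem svals_QK_le {n l k : ℕ} (hkn : k < n) (K : Matrix (Fin n) (Fin n) ℝ) (Q : Matrix (Fin n) (Fin l) ℝ)
    (hQ : Qᵀ * Q = 1) :
    ∑ j : Fin k, svalsDesc (Qᵀ * K) (Fin.castLE hkn.le j) ≤ ∑ j : Fin k, svalsDesc K (Fin.castLE hkn.le j) := by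
  obtain ⟨X, Y, hX, hY, h⟩ := KF_attain hkn (Qᵀ * K)
  rw [← h]
  have := KF_svals hkn K (Q * X) Y ((Contr.of_iso hQ).mul hX) hY
  rw [Matrix.transpose_mul] at this
  simpa [Matrix.mul_assoc] using this

theorem svals_QK_ge {n l k : ℕ} (hkn : k < n) (K : Matrix (Fin n) (Fin n) ℝ) (Q : Matrix (Fin n) (Fin l) ℝ)
    (hQ : Qᵀ * Q = 1) (Z Y : Matrix (Fin n) (Fin k) ℝ) (hZ : Contr Z) (hY : Contr Y) (hQZ : Q * (Qᵀ * Z) = Z) :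
    (Zᵀ * K * Y).trace ≤ ∑ j : Fin k, svalsDesc (Qᵀ * K) (Fin.castLE hkn.le j) := by
  have := KF_svals hkn (Qᵀ * K) (Qᵀ * Z) Y ((Contr.of_iso hQ).transpose.mul hZ) hY
  refine le_trans (le_of_eq ?_) this
  congr 1
  conv_lhs => rw [← hQZ]
  simp [Matrix.mul_assoc, Matrix.transpose_mul]

/-- matrix from a function on pairs -/
def mat {p q : Type*} (ω : p × q → ℝ) : Matrix p q ℝ := Matrix.of fun i j => ω (i, j)

theorem continuous_mat {p q : Type*} : Continuous (mat : (p × q → ℝ) → Matrix p q ℝ) := by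
  unfold mat
  fun_prop

theorem unit_gauss_finite (S : Set ℝ) (hS : S.Finite) :
    ∫⁻ t, S.indicator (fun _ => (1 : ENNReal)) (t ()) ∂(GG Unit) = 0 := by
  have hmp := measurePreserving_eval (fun _ : Unit => gaussianReal 0 1) ()
  have hSm : MeasurableSet S := hS.measurableSet
  have hm : Measurable (S.indicator (fun _ => (1 : ENNReal))) := measurable_const.indicator hSm
  have h2 : ∫⁻ t, S.indicator (fun _ => (1 : ENNReal)) (t ()) ∂(GG Unit) =
      ∫⁻ x, S.indicator (fun _ => (1 : ENNReal)) x ∂(gaussianReal 0 1) := by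
    conv_rhs => rw [← hmp.map_eq]
    rw [lintegral_map hm hmp.measurable]
  rw [h2, lintegral_indicator hSm]
  simp only [lintegral_const, one_mul, Measure.restrict_apply_univ]
  have : NullSingletonClass (gaussianReal 0 1) := nullSingletonClass_gaussianReal (by simp)
  exact hS.measure_zero _

theorem ae_det_ne_zero (p : ℕ) : ∀ᵐ ω ∂(GG (Fin p × Fin p)), (mat ω).det ≠ 0 := by
  rcases Nat.eq_zero_or_pos p with rfl | hp
  · refine Filter.Eventually.of_forall fun ω => ?_
    simp
  have hp' : (0:ℝ) < p := by exact_mod_cast hp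
  set c : ℝ := (Real.sqrt p)⁻¹ with hc
  have hcpos : 0 < c := by positivity
  have hcc : p * (c * c) = 1 := by
    rw [hc, ← mul_inv, Real.mul_self_sqrt hp'.le]; field_simp
  set d : Fin p × Fin p → ℝ := fun x => if x.1 = x.2 then c else 0 with hd
  have hdd : d ⬝ᵥ d = 1 := by
    rw [← hcc]
    simp [dotProduct, hd, Fintype.sum_prod_type, ite_mul]
  have hcd : Continuous fun ω : Fin p × Fin p → ℝ => (mat ω).det := by
    have := continuous_mat (p := Fin p) (q := Fin p)
    fun_prop
  have hms : MeasurableSet {ω : Fin p × Fin p → ℝ | (mat ω).det = 0} :=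
    (isClosed_singleton.preimage hcd).measurableSet
  have hmeas : Measurable ({ω : Fin p × Fin p → ℝ | (mat ω).det = 0}.indicator (fun _ => (1 : ENNReal))) :=
    measurable_const.indicator hms
  have key := GG_lint_adj2 (ι := Fin p × Fin p) (ι' := Unit) (κ := Fin p × Fin p)
    (fun x t => x - (d ⬝ᵥ x) • d + t () • d) (fun y => y - (d ⬝ᵥ y) • d) (fun y _ => d ⬝ᵥ y)
    (by intro x x' y
        simp only [add_dotProduct, sub_dotProduct, dotProduct_sub, smul_dotProduct, dotProduct_smul, smul_eq_mul]
        rw [dotProduct_comm x d]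
        simp [dotProduct]; ring)
    (by intro y
        simp only [dotProduct_sub, dotProduct_smul, hdd, smul_eq_mul]
        funext i; simp)
    _ hmeas
  have h0 : ∀ x : Fin p × Fin p → ℝ, ∫⁻ t, {ω : Fin p × Fin p → ℝ | (mat ω).det = 0}.indicator (fun _ => (1 : ENNReal))
      (x - (d ⬝ᵥ x) • d + t () • d) ∂(GG Unit) = 0 := by
    intro x
    set N := mat (x - (d ⬝ᵥ x) • d) with hN
    have e : ∀ t : ℝ, (mat (x - (d ⬝ᵥ x) • d + t • d)).det = (Matrix.charpoly (-N)).eval (t * c) := by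
      intro t
      rw [Matrix.eval_charpoly]
      congr 1
      ext i j
      simp only [mat, hN, hd, Matrix.of_apply, Pi.add_apply, Pi.smul_apply, smul_eq_mul, Matrix.sub_apply,
        Matrix.neg_apply, sub_neg_eq_add, Matrix.scalar_apply, Matrix.diagonal_apply]
      rw [add_comm]
      congr 1
      split_ifs <;> simp
    have hfin : {t : ℝ | (mat (x - (d ⬝ᵥ x) • d + t • d)).det = 0}.Finite := by
      have h1 : {y : ℝ | (Matrix.charpoly (-N)).eval y = 0}.Finite := by
        have := (Matrix.charpoly (-N)).roots.toFinset.finite_toSet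
        refine this.subset ?_
        intro y hy
        have hne : Matrix.charpoly (-N) ≠ 0 := (Matrix.charpoly_monic _).ne_zero
        simp [Polynomial.mem_roots hne]
        exact hy
      have h2 : {t : ℝ | (mat (x - (d ⬝ᵥ x) • d + t • d)).det = 0} = (fun t => t * c) ⁻¹' {y : ℝ | (Matrix.charpoly (-N)).eval y = 0} := by
        ext t; simp [e]
      rw [h2]
      exact h1.preimage (mul_left_injective₀ hcpos.ne').injOn
    rw [← unit_gauss_finite _ hfin]
    rfl
  simp only [h0, lintegral_zero] at key
  rw [lintegral_indicator hms] at key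
  simp only [lintegral_const, one_mul, Measure.restrict_apply_univ] at key
  rw [ae_iff]
  simpa using key.symm

theorem ae_submat_det_ne_zero {n l p : ℕ} (r : Fin p → Fin n) (c : Fin p → Fin l)
    (hr : Function.Injective r) (hc : Function.Injective c) :
    ∀ᵐ ω ∂(GG (Fin n × Fin l)), ((mat ω).submatrix r c).det ≠ 0 := by
  have hinj : Function.Injective (fun x : Fin p × Fin p => (r x.1, c x.2)) := by
    intro x y h
    simp only [Prod.mk.injEq] at h
    exact Prod.ext (hr h.1) (hc h.2)
  have := GG_ae_adj (ι := Fin n × Fin l) (κ := Fin p × Fin p) (fun ω x => ω (r x.1, c x.2))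
    (fun y z => if h : ∃ x : Fin p × Fin p, (r x.1, c x.2) = z then y h.choose else 0)
    (by
      intro x y
      simp only [dotProduct]
      have hz : ∀ a : Fin p × Fin p, (if h : ∃ x : Fin p × Fin p, (r x.1, c x.2) = (r a.1, c a.2) then y h.choose else 0) = y a := by
        intro a
        have hex : ∃ x : Fin p × Fin p, (r x.1, c x.2) = (r a.1, c a.2) := ⟨a, rfl⟩
        rw [dif_pos hex]
        congr 1
        exact hinj hex.choose_spec
      rw [← Finset.sum_subset (Finset.subset_univ (Finset.univ.image (fun x : Fin p × Fin p => (r x.1, c x.2))))]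
      · rw [Finset.sum_image (fun a _ b _ h => hinj h)]
        apply Finset.sum_congr rfl
        intro a _
        rw [hz a]
      · intro z _ hz2
        rw [dif_neg, mul_zero]
        rintro ⟨a, ha⟩
        apply hz2
        rw [← ha]
        exact Finset.mem_image_of_mem _ (Finset.mem_univ a))
    (by
      intro y
      funext a
      have hex : ∃ x : Fin p × Fin p, (r x.1, c x.2) = (r a.1, c a.2) := ⟨a, rfl⟩
      rw [dif_pos hex]
      congr 1
      exact hinj hex.choose_spec) _ (ae_det_ne_zero p)
  exact this

/-- vector from a matrix -/
def unmat {p q : Type*} (A : Matrix p q ℝ) : p × q → ℝ := fun x => A x.1 x.2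

theorem mat_unmat {p q : Type*} (A : Matrix p q ℝ) : mat (unmat A) = A := rfl

theorem unmat_mat {p q : Type*} (ω : p × q → ℝ) : unmat (mat ω) = ω := rfl

theorem unmat_dot {p q : Type*} [Fintype p] [Fintype q] (A B : Matrix p q ℝ) :
    unmat A ⬝ᵥ unmat B = (Aᵀ * B).trace := by
  simp only [dotProduct, unmat, Matrix.trace, Matrix.diag, Matrix.mul_apply, Matrix.transpose_apply,
    Fintype.sum_prod_type]
  rw [Finset.sum_comm]

theorem dot_unmat {p q : Type*} [Fintype p] [Fintype q] (x y : p × q → ℝ) :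
    x ⬝ᵥ y = ((mat x)ᵀ * mat y).trace := unmat_dot (mat x) (mat y)

/-- the tail sum -/
noncomputable def tailS {n : ℕ} (k : ℕ) (lam : Fin n → ℝ) : ℝ :=
  ∑ i : Fin n, if (i:ℕ) < k then 0 else lam i

theorem sum_split {n k : ℕ} (hkn : k ≤ n) (f : Fin n → ℝ) :
    ∑ i, f i = ∑ j : Fin k, f (Fin.castLE hkn j) + tailS k f := by
  have h2 : (∑ j : Fin n, if (j:ℕ) < k then f j else 0) =
      ∑ j : Fin k, f (Fin.castLE hkn j) := by
    rw [← Finset.sum_filter]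
    symm
    apply Finset.sum_bij (fun (j : Fin k) _ => Fin.castLE hkn j)
    · intro j _; simp
    · intro a _ b _ h; simpa using h
    · intro b hb; simp at hb; exact ⟨⟨b, hb⟩, by simp, by ext; simp⟩
    · intro j _; rfl
  rw [← h2, tailS, ← Finset.sum_add_distrib]
  apply Finset.sum_congr rfl
  intro i _
  split_ifs <;> simp

/-- what each case has to provide -/
def GoodBound {n l k : ℕ} (hkn : k < n) (lam : Fin n → ℝ) : Prop :=
  ∃ bound : (Fin n × Fin l → ℝ) → ℝ, Measurable bound ∧
    (∀ᵐ ω ∂(GG (Fin n × Fin l)), ∃ B : Matrix (Fin l) (Fin k) ℝ,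
      Contr (Matrix.diagonal lam * mat ω * B) ∧
      ∑ j : Fin k, lam (Fin.castLE hkn.le j) *
        (1 - (Matrix.diagonal lam * mat ω * B) (Fin.castLE hkn.le j) j) ≤ bound ω) ∧
    ∫⁻ ω, ENNReal.ofReal (bound ω) ∂(GG (Fin n × Fin l)) ≤
      ENNReal.ofReal ((k : ℝ) / Real.sqrt l * tailS k lam)

theorem inj_of_block {n l : ℕ} (hln : l ≤ n) (lam : Fin n → ℝ) (hpos : ∀ j : Fin n, (j:ℕ) < l → 0 < lam j)
    (Ω : Matrix (Fin n) (Fin l) ℝ) (hdet : (Ω.submatrix (Fin.castLE hln) id).det ≠ 0)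
    (v : Fin l → ℝ) (hv : (Matrix.diagonal lam * Ω) *ᵥ v = 0) : v = 0 := by
  apply Matrix.eq_zero_of_mulVec_eq_zero hdet
  funext j
  have := congrFun hv (Fin.castLE hln j)
  rw [← Matrix.mulVec_mulVec, Matrix.mulVec_diagonal] at this
  have hp := hpos (Fin.castLE hln j) (by simp)
  simp only [Pi.zero_apply, mul_eq_zero, hp.ne', false_or] at this
  exact this

theorem main_of_good {n l k : ℕ} (hkl : k ≤ l) (hkn : k < n)
    (K : Matrix (Fin n) (Fin n) ℝ) (hK : K.PosSemidef) (hrl : l ≤ K.rank)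
    (hgood : ∀ lam : Fin n → ℝ, l ≤ n → Antitone lam → (∀ j, 0 ≤ lam j) →
      (∀ j : Fin n, (j:ℕ) < l → 0 < lam j) → GoodBound (l := l) hkn lam)
    (δbar : ℝ)
    (hδbar : δbar = (K.trace - ∑ j : Fin k, svalsDesc K (Fin.castLE hkn.le j)) / ((n : ℝ) - k))
    (Q : ((Fin n × Fin l) → ℝ) → Matrix (Fin n) (Fin l) ℝ)
    (hQ : ∀ ω : (Fin n × Fin l) → ℝ,
        (K * Matrix.of fun i j => ω (i, j)).rank = l →
          (Q ω)ᵀ * Q ω = 1 ∧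
            LinearMap.range (Q ω).mulVecLin =
              LinearMap.range (K * Matrix.of fun i j => ω (i, j)).mulVecLin)
    (δtil : ((Fin n × Fin l) → ℝ) → ℝ)
    (hδtil : ∀ ω, δtil ω =
        (K.trace - ∑ j : Fin k, svalsDesc ((Q ω)ᵀ * K) (Fin.castLE hkn.le j)) / ((n : ℝ) - k)) :
    ∫⁻ ω, ENNReal.ofReal (|δbar - δtil ω| / δbar)
        ∂(Measure.pi fun _ : Fin n × Fin l => gaussianReal 0 1) ≤
      ENNReal.ofReal ((k : ℝ) / Real.sqrt l) := by
  obtain ⟨hanti, U, hU, hU', hKU⟩ := eig_exists K hK.isHermitian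
  set lam := eigsDesc K with hlam
  have hKd : K = U * Matrix.diagonal lam * Uᵀ := by
    rw [← hKU, Matrix.mul_assoc, hU', Matrix.mul_one]
  have hl0 : ∀ j, 0 ≤ lam j := by
    intro j
    rw [hlam, eigsDesc, dif_pos hK.isHermitian]
    exact hK.eigenvalues_nonneg _
  have hln : l ≤ n := hrl.trans (by simpa using K.rank_le_width)
  have hdU : IsUnit U.det := by
    rw [← Matrix.isUnit_iff_isUnit_det]
    exact IsUnit.of_mul_eq_one _ hU'
  have hdU' : IsUnit Uᵀ.det := by rwa [Matrix.det_transpose]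
  have hrank : K.rank = Fintype.card {i // lam i ≠ 0} := by
    rw [hKd, Matrix.rank_mul_eq_left_of_isUnit_det _ _ hdU', Matrix.rank_mul_eq_right_of_isUnit_det _ _ hdU,
      Matrix.rank_diagonal]
  have hpos : ∀ j : Fin n, (j:ℕ) < l → 0 < lam j := by
    intro j hj
    by_contra hcon
    have h0 : lam j = 0 := le_antisymm (not_lt.mp hcon) (hl0 j)
    have h1 : Fintype.card {i // lam i ≠ 0} ≤ j := by
      rw [Fintype.card_subtype]
      have : (Finset.univ.filter fun i => lam i ≠ 0) ⊆ Finset.Iio j := by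
        intro i hi
        simp only [Finset.mem_filter, Finset.mem_univ, true_and] at hi
        rw [Finset.mem_Iio]
        by_contra hji
        exact hi (le_antisymm ((hanti (not_lt.mp hji)).trans h0.le) (hl0 i))
      simpa using Finset.card_le_card this
    omega
  obtain ⟨bound, hbm, hb, hbi⟩ := hgood lam hln hanti hl0 hpos
  have htr : K.trace = ∑ i, lam i := by
    rw [hKd, Matrix.mul_assoc, Matrix.trace_mul_comm, Matrix.mul_assoc, hU, Matrix.mul_one, Matrix.trace_diagonal]
  have hκ := svals_psd hkn K U lam hanti hl0 hU hKd
  have htail : 0 ≤ tailS k lam := by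
    apply Finset.sum_nonneg; intro i _; split_ifs; exacts [le_rfl, hl0 i]
  have hnk : (0:ℝ) < (n:ℝ) - k := by
    rw [sub_pos]; exact_mod_cast hkn
  have hδ : δbar = tailS k lam / ((n:ℝ) - k) := by
    rw [hδbar, hκ, htr, sum_split hkn.le lam]; ring
  set T : (Fin n × Fin l → ℝ) → (Fin n × Fin l → ℝ) := fun ω => unmat (Uᵀ * mat ω) with hT
  have hT1 : ∀ x y, T x ⬝ᵥ y = x ⬝ᵥ unmat (U * mat y) := by
    intro x y
    rw [dot_unmat, dot_unmat, hT]
    simp only [mat_unmat]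
    rw [Matrix.transpose_mul, Matrix.transpose_transpose, Matrix.mul_assoc]
  have hT2 : ∀ y, T (unmat (U * mat y)) = y := by
    intro y
    rw [hT]
    simp only [mat_unmat]
    rw [← Matrix.mul_assoc, hU, Matrix.one_mul, unmat_mat]
  have hb' := GG_ae_adj T _ hT1 hT2 _ hb
  have hd' := GG_ae_adj T _ hT1 hT2 _ (ae_submat_det_ne_zero (Fin.castLE hln) id
    (Fin.castLE_injective hln) Function.injective_id)
  have hae : ∀ᵐ ω ∂(GG (Fin n × Fin l)), ENNReal.ofReal (|δbar - δtil ω| / δbar) ≤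
      ENNReal.ofReal (bound (T ω)) * ENNReal.ofReal (tailS k lam)⁻¹ := by
    filter_upwards [hb', hd'] with ω hω hdω
    obtain ⟨B, hBc, hBb⟩ := hω
    have hUT : U * mat (T ω) = mat ω := by
      rw [hT]; simp only [mat_unmat]; rw [← Matrix.mul_assoc, hU', Matrix.one_mul]
    have hTT : mat (T ω) = Uᵀ * mat ω := by rw [hT]; simp only [mat_unmat]
    have hKO : K * mat ω = U * (Matrix.diagonal lam * mat (T ω)) := by
      rw [hKd, hTT]; simp only [Matrix.mul_assoc]
    have hinj : Function.Injective (K * mat ω).mulVecLin := by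
      rw [← LinearMap.ker_eq_bot, LinearMap.ker_eq_bot']
      intro v hv
      apply inj_of_block hln lam hpos (mat (T ω)) hdω
      rw [Matrix.mulVecLin_apply, hKO, ← Matrix.mulVec_mulVec] at hv
      have := congrArg (fun w => Uᵀ *ᵥ w) hv
      simpa [Matrix.mulVec_mulVec, hU, ← Matrix.mul_assoc] using this
    have hrk : (K * mat ω).rank = l := by
      rw [Matrix.rank, LinearMap.finrank_range_of_inj hinj]; simp
    obtain ⟨hQ1, hQ2⟩ := hQ ω hrk
    set Z := U * (Matrix.diagonal lam * mat (T ω) * B) with hZ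
    have hZc : Contr Z := (Contr.of_iso hU).mul hBc
    have hZK : Z = K * mat ω * B := by rw [hKO, hZ]; simp only [Matrix.mul_assoc]
    have hQZ : Q ω * ((Q ω)ᵀ * Z) = Z := by
      have hcol : ∀ v, (Q ω * ((Q ω)ᵀ * Z)) *ᵥ v = Z *ᵥ v := by
        intro v
        have hmem : Z *ᵥ v ∈ LinearMap.range (Q ω).mulVecLin := by
          rw [hQ2, hZK]
          exact ⟨B *ᵥ v, by rw [Matrix.mulVecLin_apply, Matrix.mulVec_mulVec]; rfl⟩
        obtain ⟨w, hw⟩ := hmem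
        rw [Matrix.mulVecLin_apply] at hw
        rw [← Matrix.mulVec_mulVec, ← Matrix.mulVec_mulVec, ← hw, Matrix.mulVec_mulVec w (Q ω)ᵀ, hQ1, Matrix.one_mulVec]
      ext i j
      have := congrFun (hcol (Pi.single j 1)) i
      simpa using this
    have hge := svals_QK_ge hkn K (Q ω) hQ1 Z (U.submatrix id (Fin.castLE hkn.le)) hZc
      ((Contr.of_iso hU).submat hkn) hQZ
    have hle := svals_QK_le hkn K (Q ω) hQ1
    have htrZ : (Zᵀ * K * (U.submatrix id (Fin.castLE hkn.le))).trace =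
        ∑ j : Fin k, lam (Fin.castLE hkn.le j) *
          (Matrix.diagonal lam * mat (T ω) * B) (Fin.castLE hkn.le j) j := by
      set Z' := Matrix.diagonal lam * mat (T ω) * B with hZ'
      have h1 : Zᵀ * K * U = Z'ᵀ * Matrix.diagonal lam := by
        rw [Matrix.mul_assoc, hKU, hZ, Matrix.transpose_mul, Matrix.mul_assoc, ← Matrix.mul_assoc Uᵀ, hU, Matrix.one_mul]
      have h2 : Zᵀ * K * (U.submatrix id (Fin.castLE hkn.le)) = (Zᵀ * K * U).submatrix id (Fin.castLE hkn.le) := by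
        ext i j; simp [Matrix.mul_apply]
      rw [h2, h1]
      simp only [Matrix.trace, Matrix.diag, Matrix.submatrix_apply, id, Matrix.mul_diagonal, Matrix.transpose_apply]
      apply Finset.sum_congr rfl; intro j _; ring
    rw [hκ] at hle
    set s := ∑ j : Fin k, svalsDesc ((Q ω)ᵀ * K) (Fin.castLE hkn.le j) with hs
    have hbd : ∑ j : Fin k, lam (Fin.castLE hkn.le j) - s ≤ bound (T ω) := by
      refine le_trans ?_ hBb
      simp only [mul_sub, mul_one, Finset.sum_sub_distrib]
      rw [← htrZ]; linarith
    have hdiff : |δbar - δtil ω| / δbar = (∑ j : Fin k, lam (Fin.castLE hkn.le j) - s) / tailS k lam := by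
      rw [hδtil ω, ← hs]
      have : δbar - (K.trace - s) / ((n:ℝ) - k) = - ((∑ j : Fin k, lam (Fin.castLE hkn.le j) - s) / ((n:ℝ) - k)) := by
        rw [hδbar, hκ]; ring
      rw [this, abs_neg, abs_of_nonneg (div_nonneg (by linarith) hnk.le), hδ, div_div_div_cancel_right₀ hnk.ne']
    rw [hdiff, div_eq_mul_inv, ENNReal.ofReal_mul (by linarith)]
    gcongr
  calc _ ≤ ∫⁻ ω, ENNReal.ofReal (bound (T ω)) * ENNReal.ofReal (tailS k lam)⁻¹ ∂(GG (Fin n × Fin l)) :=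
        lintegral_mono_ae hae
    _ = ∫⁻ ω, ENNReal.ofReal (bound ω) * ENNReal.ofReal (tailS k lam)⁻¹ ∂(GG (Fin n × Fin l)) :=
        GG_lint_adj T _ hT1 hT2 (fun ω => ENNReal.ofReal (bound ω) * ENNReal.ofReal (tailS k lam)⁻¹) (by fun_prop)
    _ = (∫⁻ ω, ENNReal.ofReal (bound ω) ∂(GG (Fin n × Fin l))) * ENNReal.ofReal (tailS k lam)⁻¹ :=
        lintegral_mul_const _ (by fun_prop)
    _ ≤ ENNReal.ofReal ((k : ℝ) / Real.sqrt l * tailS k lam) * ENNReal.ofReal (tailS k lam)⁻¹ := by gcongr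
    _ ≤ _ := by
        rw [← ENNReal.ofReal_mul (by positivity)]
        apply ENNReal.ofReal_le_ofReal
        rw [mul_assoc]
        have : tailS k lam * (tailS k lam)⁻¹ ≤ 1 := mul_inv_le_one
        have h2 : 0 ≤ (k : ℝ) / Real.sqrt l := by positivity
        nlinarith

theorem proj_of_gram {n l : ℕ} (G : Matrix (Fin n) (Fin l) ℝ) (hG : ∀ v, G *ᵥ v = 0 → v = 0) :
    (Gᵀ * G).det ≠ 0 := by
  intro h0
  obtain ⟨v, hv, hv0⟩ := Matrix.exists_mulVec_eq_zero_iff.mpr h0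
  apply hv
  apply hG
  have : (G *ᵥ v) ⬝ᵥ (G *ᵥ v) = 0 := by
    rw [mulVec_dot, Matrix.mulVec_mulVec, hv0, dotProduct_zero]
  exact dotProduct_self_eq_zero.mp this

theorem gram_symm {n l : ℕ} (G : Matrix (Fin n) (Fin l) ℝ) :
    (G * (Gᵀ * G)⁻¹ * Gᵀ)ᵀ = G * (Gᵀ * G)⁻¹ * Gᵀ := by
  rw [Matrix.transpose_mul, Matrix.transpose_mul, Matrix.transpose_nonsing_inv]
  simp [Matrix.mul_assoc]

theorem caseA_det {n l k : ℕ} (hkn : k < n) (lam : Fin n → ℝ) (hl0 : ∀ j, 0 ≤ lam j)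
    (Ω : Matrix (Fin n) (Fin l) ℝ) (X : Matrix (Fin l) (Fin k) ℝ)
    (hX : Ω.submatrix (Fin.castLE hkn.le) id * X = 1)
    (hinj : ∀ v, (Matrix.diagonal lam * Ω) *ᵥ v = 0 → v = 0) (a : ℝ) (ha : 0 < a) :
    ∃ B : Matrix (Fin l) (Fin k) ℝ,
      Contr (Matrix.diagonal lam * Ω * B) ∧
      ∑ j : Fin k, lam (Fin.castLE hkn.le j) *
        (1 - (Matrix.diagonal lam * Ω * B) (Fin.castLE hkn.le j) j) ≤
      ∑ i : Fin n, if (i:ℕ) < k then 0 else lam i * (a / 4 + (∑ j, (Ω * X) i j ^ 2) / (4 * a)) := by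
  set G := Matrix.diagonal lam * Ω with hGdef
  have hdet := proj_of_gram G hinj
  have hu : IsUnit (Gᵀ * G).det := isUnit_iff_ne_zero.mpr hdet
  set P := G * (Gᵀ * G)⁻¹ * Gᵀ with hP
  have hPG : P * G = G := by
    rw [hP, Matrix.mul_assoc, Matrix.mul_assoc, Matrix.nonsing_inv_mul _ hu, Matrix.mul_one]
  have hPT : Pᵀ = P := by
    exact gram_symm G
  have hPP : P * P = P := by
    conv_lhs => rw [hP]
    rw [← Matrix.mul_assoc, ← Matrix.mul_assoc, ← hP, hPG]
  have hPc : Contr P := by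
    intro v
    have h1 : (P *ᵥ v) ⬝ᵥ (P *ᵥ v) = (P *ᵥ v) ⬝ᵥ v := by
      rw [mulVec_dot, Matrix.mulVec_mulVec, hPT, hPP, mulVec_dot, hPT]
    have h2 := dot_nn (P *ᵥ v - v)
    simp only [sub_dotProduct, dotProduct_sub] at h2
    rw [dotProduct_comm v (P *ᵥ v)] at h2
    linarith
  set E : Matrix (Fin n) (Fin k) ℝ := (1 : Matrix (Fin n) (Fin n) ℝ).submatrix id (Fin.castLE hkn.le) with hE
  have hGB : G * ((Gᵀ * G)⁻¹ * Gᵀ * E) = P.submatrix id (Fin.castLE hkn.le) := by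
    rw [← Matrix.mul_assoc, ← Matrix.mul_assoc, ← hP, hE]
    ext i j; simp [Matrix.mul_apply, Matrix.one_apply]
  refine ⟨(Gᵀ * G)⁻¹ * Gᵀ * E, ?_, ?_⟩
  · rw [hGB]; exact hPc.submat hkn
  rw [hGB]
  simp only [Matrix.submatrix_apply, id]
  set H := Ω * X with hH
  have hH1 : ∀ j j' : Fin k, H (Fin.castLE hkn.le j) j' = if j = j' then 1 else 0 := by
    intro j j'
    have := congrFun (congrFun hX j) j'
    rw [Matrix.one_apply] at this
    rw [← this]; rfl
  have hkey : P * (Matrix.diagonal lam * H) = Matrix.diagonal lam * H := by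
    have : Matrix.diagonal lam * H = G * X := by rw [hH, ← Matrix.mul_assoc]
    rw [this, ← Matrix.mul_assoc, hPG]
  have hent : ∀ j : Fin k, lam (Fin.castLE hkn.le j) * (1 - P (Fin.castLE hkn.le j) (Fin.castLE hkn.le j)) =
      ∑ i : Fin n, if (i:ℕ) < k then 0 else lam i * (P (Fin.castLE hkn.le j) i * H i j) := by
    intro j
    have h := congrFun (congrFun hkey (Fin.castLE hkn.le j)) j
    rw [Matrix.mul_apply, sum_split hkn.le] at h
    simp only [Matrix.diagonal_mul, hH1] at h
    simp only [mul_ite, mul_one, mul_zero, Finset.sum_ite_eq', Finset.mem_univ, if_true] at h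
    have h2 : tailS k (fun i => P (Fin.castLE hkn.le j) i * (lam i * H i j)) =
       ∑ i : Fin n, if (i:ℕ) < k then 0 else lam i * (P (Fin.castLE hkn.le j) i * H i j) := by
      unfold tailS
      apply Finset.sum_congr rfl; intro i _
      split_ifs
      · rfl
      · ring
    rw [← h2]; linarith
  simp only [hent]
  rw [Finset.sum_comm]
  apply Finset.sum_le_sum
  intro i _
  by_cases hi : (i:ℕ) < k
  · simp [hi]
  simp only [hi, if_false]
  rw [← Finset.mul_sum]
  apply mul_le_mul_of_nonneg_left _ (hl0 i)
  have hsum : ∑ j : Fin k, P (Fin.castLE hkn.le j) i ^ 2 ≤ 1 / 4 := by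
    have h1 : ∑ m, P m i ^ 2 = P i i := by
      have := congrFun (congrFun hPP i) i
      rw [Matrix.mul_apply] at this
      rw [← this]
      apply Finset.sum_congr rfl; intro m _
      have : P i m = P m i := congrFun (congrFun hPT m) i
      rw [this]; ring
    rw [sum_split hkn.le] at h1
    have h2 : P i i ^ 2 ≤ tailS k (fun m => P m i ^ 2) := by
      unfold tailS
      have := Finset.single_le_sum (f := fun m : Fin n => if (m:ℕ) < k then 0 else P m i ^ 2)
        (fun m _ => by split_ifs; exacts [le_rfl, sq_nonneg _]) (Finset.mem_univ i)
      simpa [hi] using this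
    nlinarith [sq_nonneg (P i i - 1/2)]
  have : ∑ j : Fin k, P (Fin.castLE hkn.le j) i * H i j ≤
      ∑ j : Fin k, (a * P (Fin.castLE hkn.le j) i ^ 2 + H i j ^ 2 / (4 * a)) := by
    apply Finset.sum_le_sum; intro j _
    have : a * P (Fin.castLE hkn.le j) i ^ 2 + H i j ^ 2 / (4 * a) - P (Fin.castLE hkn.le j) i * H i j
      = (2 * a * P (Fin.castLE hkn.le j) i - H i j) ^ 2 / (4 * a) := by
      field_simp; ring
    have h2 : 0 ≤ (2 * a * P (Fin.castLE hkn.le j) i - H i j) ^ 2 / (4 * a) := by positivity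
    linarith
  refine this.trans ?_
  rw [Finset.sum_add_distrib, ← Finset.mul_sum, ← Finset.sum_div]
  nlinarith

theorem meas_det {α ι : Type*} [MeasurableSpace α] [Fintype ι] [DecidableEq ι] (A : α → Matrix ι ι ℝ)
    (hA : ∀ i j, Measurable fun x => A x i j) : Measurable fun x => (A x).det := by
  simp only [Matrix.det_apply]
  refine Finset.measurable_sum _ fun σ _ => ?_
  refine Measurable.const_smul ?_ _
  exact Finset.measurable_prod _ fun i _ => hA _ _

theorem meas_inv {α ι : Type*} [MeasurableSpace α] [Fintype ι] [DecidableEq ι] (A : α → Matrix ι ι ℝ)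
    (hA : ∀ i j, Measurable fun x => A x i j) (i j : ι) : Measurable fun x => (A x)⁻¹ i j := by
  simp only [Matrix.inv_def, Matrix.smul_apply, Ring.inverse_eq_inv', smul_eq_mul]
  refine (meas_det A hA).inv.mul ?_
  simp only [Matrix.adjugate_apply]
  refine meas_det _ fun i' j' => ?_
  simp only [Matrix.updateRow_apply]
  split_ifs
  · exact measurable_const
  · exact hA _ _

theorem meas_mul {α p q r : Type*} [MeasurableSpace α] [Fintype q] (A : α → Matrix p q ℝ) (B : α → Matrix q r ℝ)
    (hA : ∀ i j, Measurable fun x => A x i j) (hB : ∀ i j, Measurable fun x => B x i j) (i : p) (j : r) :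
    Measurable fun x => (A x * B x) i j := by
  simp only [Matrix.mul_apply]
  exact Finset.measurable_sum _ fun t _ => (hA _ _).mul (hB _ _)

theorem meas_dot {α q : Type*} [MeasurableSpace α] [Fintype q] (a b : α → q → ℝ)
    (ha : ∀ j, Measurable fun x => a x j) (hb : ∀ j, Measurable fun x => b x j) :
    Measurable fun x => a x ⬝ᵥ b x := by
  simp only [dotProduct]
  exact Finset.measurable_sum _ fun t _ => (ha _).mul (hb _)

theorem meas_mulVec {α p q : Type*} [MeasurableSpace α] [Fintype q] (A : α → Matrix p q ℝ) (b : α → q → ℝ)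
    (hA : ∀ i j, Measurable fun x => A x i j) (hb : ∀ j, Measurable fun x => b x j) (i : p) :
    Measurable fun x => (A x *ᵥ b x) i := by
  simp only [Matrix.mulVec]
  exact meas_dot _ _ (fun j => hA i j) hb

/-- replace a row -/
noncomputable def setrow {p q : Type*} (i : p) (w : q → ℝ) (ω : p × q → ℝ) : p × q → ℝ :=
  fun x => if x.1 = i then w x.2 else ω x

theorem GG_row {p q : Type*} [Fintype p] [Fintype q] (i : p) (f : (p × q → ℝ) → ENNReal) (hf : Measurable f) :
    ∫⁻ ω, ∫⁻ w, f (setrow i w ω) ∂(GG q) ∂(GG (p × q)) = ∫⁻ ω, f ω ∂(GG (p × q)) := by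
  refine GG_lint_adj2 (fun ω w => setrow i w ω) (fun y => fun x => if x.1 = i then 0 else y x)
    (fun y => fun t => y (i, t)) ?_ ?_ f hf
  · intro x w y
    have : w ⬝ᵥ (fun t => y (i, t)) = ∑ z : p × q, if z.1 = i then w z.2 * y z else 0 := by
      rw [Fintype.sum_prod_type, Finset.sum_eq_single i]
      · simp [dotProduct]
      · intro b _ hb; simp [hb]
      · simp
    rw [this]
    simp only [dotProduct, setrow, ← Finset.sum_add_distrib]
    apply Finset.sum_congr rfl
    intro z _
    split_ifs <;> simp
  · intro y
    funext ⟨a, b⟩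
    simp only [setrow]
    split_ifs with h
    · subst h; rfl
    · rfl

theorem mat_setrow {p q : Type*} (i : p) (w : q → ℝ) (ω : p × q → ℝ) (a : p) (b : q) :
    mat (setrow i w ω) a b = if a = i then w b else mat ω a b := by
  simp [mat, setrow]

theorem lint_dot_sq {ι : Type*} [Fintype ι] (w : ι → ℝ) :
    ∫⁻ θ, ENNReal.ofReal ((w ⬝ᵥ θ) ^ 2) ∂(GG ι) = ENNReal.ofReal (w ⬝ᵥ w) := by
  by_cases hw : w = 0
  · subst hw; simp
  have hpos : 0 < w ⬝ᵥ w :=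
    lt_of_le_of_ne (dot_nn w) (Ne.symm (by simpa [dotProduct_self_eq_zero] using hw))
  set r := Real.sqrt (w ⬝ᵥ w) with hr
  have hrp : 0 < r := Real.sqrt_pos.mpr hpos
  have hrr : r * r = w ⬝ᵥ w := Real.mul_self_sqrt hpos.le
  have key := GG_lint_adj (ι := ι) (κ := Unit) (fun θ _ => r⁻¹ * (w ⬝ᵥ θ)) (fun y => (r⁻¹ * y ()) • w)
    (by intro x y; simp [dotProduct_comm, dotProduct_smul]; ring)
    (by intro y; funext u; simp [dotProduct_smul, ← hrr]; field_simp)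
    (fun y => ENNReal.ofReal (r * r * (y () * y ()))) (by fun_prop)
  have e1 : ∀ θ, r * r * ((r⁻¹ * (w ⬝ᵥ θ)) * (r⁻¹ * (w ⬝ᵥ θ))) = (w ⬝ᵥ θ) ^ 2 := by
    intro θ; field_simp
  simp only [e1] at key
  rw [key]
  have hmp := measurePreserving_eval (fun _ : Unit => gaussianReal 0 1) ()
  have h2 : ∫⁻ y, ENNReal.ofReal (r * r * (y () * y ())) ∂(GG Unit) =
      ∫⁻ x, ENNReal.ofReal (r * r * (x * x)) ∂(gaussianReal 0 1) := by
    conv_rhs => rw [← hmp.map_eq]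
    rw [lintegral_map (by fun_prop) hmp.measurable]
  rw [h2]
  have h0 : 0 ≤ r * r := by positivity
  simp_rw [ENNReal.ofReal_mul h0]
  rw [lintegral_const_mul _ (by fun_prop), lint_sq_gauss, mul_one, hrr]

theorem exists_orth {l : ℕ} (V : Submodule ℝ (EuclideanSpace ℝ (Fin l))) (m : ℕ)
    (h : m + Module.finrank ℝ V ≤ l) :
    ∃ B : Matrix (Fin m) (Fin l) ℝ, B * Bᵀ = 1 ∧ ∀ v : Fin l → ℝ, WithLp.toLp 2 v ∈ V → B *ᵥ v = 0 := by
  have h1 : Module.finrank ℝ V + Module.finrank ℝ Vᗮ = l := by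
    rw [Submodule.finrank_add_finrank_orthogonal]; simp
  have hm : m ≤ Module.finrank ℝ Vᗮ := by omega
  set b := stdOrthonormalBasis ℝ Vᗮ with hb
  have hin : ∀ x y : EuclideanSpace ℝ (Fin l), inner ℝ x y = ∑ t, x t * y t := by
    intro x y
    simp [PiLp.inner_apply, mul_comm]
  refine ⟨Matrix.of fun i t => (b (Fin.castLE hm i) : EuclideanSpace ℝ (Fin l)) t, ?_, ?_⟩
  · ext i j
    rw [Matrix.mul_apply]
    simp only [Matrix.of_apply, Matrix.transpose_apply]
    rw [← hin, ← Submodule.coe_inner, orthonormal_iff_ite.mp b.orthonormal, Matrix.one_apply]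
    simp
  · intro v hv
    funext i
    simp only [Matrix.mulVec, dotProduct, Matrix.of_apply, Pi.zero_apply]
    have := (b (Fin.castLE hm i)).2
    rw [Submodule.mem_orthogonal'] at this
    have := this _ hv
    rw [hin] at this
    exact this

theorem exists_orth_rows {k l m : ℕ} (W : Matrix (Fin k) (Fin l) ℝ) (j : Fin k) (h : m + (k - 1) ≤ l) :
    ∃ B : Matrix (Fin m) (Fin l) ℝ, B * Bᵀ = 1 ∧ ∀ j', j' ≠ j → B *ᵥ (W j') = 0 := by
  set b : {j' : Fin k // j' ≠ j} → EuclideanSpace ℝ (Fin l) := fun j' => WithLp.toLp 2 (W j'.1) with hb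
  have h1 : Module.finrank ℝ (Submodule.span ℝ (Set.range b)) ≤ k - 1 := by
    refine (finrank_range_le_card (R := ℝ) b).trans ?_
    simp [Fintype.card_subtype_compl]
  obtain ⟨B, hB, hB'⟩ := exists_orth (Submodule.span ℝ (Set.range b)) m (by omega)
  exact ⟨B, hB, fun j' hj' => hB' _ (Submodule.subset_span ⟨⟨j', hj'⟩, rfl⟩)⟩

theorem dual_le {k l m : ℕ} (W : Matrix (Fin k) (Fin l) ℝ) (j : Fin k)
    (B : Matrix (Fin m) (Fin l) ℝ) (hB : B * Bᵀ = 1) (hB' : ∀ j', j' ≠ j → B *ᵥ (W j') = 0)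
    (hg : (B *ᵥ (W j)) ⬝ᵥ (B *ᵥ (W j)) ≠ 0) :
    ∑ t, (Wᵀ * (W * Wᵀ)⁻¹) t j ^ 2 ≤ ((B *ᵥ (W j)) ⬝ᵥ (B *ᵥ (W j)))⁻¹ := by
  have e0 : ∀ g, (Bᵀ *ᵥ g) ⬝ᵥ (Bᵀ *ᵥ g) = g ⬝ᵥ g := by
    intro g
    rw [mulVec_dot, Matrix.mulVec_mulVec, Matrix.transpose_transpose, hB, Matrix.one_mulVec]
  set g := B *ᵥ (W j) with hgdef
  by_cases hdet : (W * Wᵀ).det = 0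
  · have : (W * Wᵀ)⁻¹ = 0 := by
      rw [Matrix.inv_def, hdet]; simp
    rw [this]; simp only [Matrix.mul_zero, Matrix.zero_apply]
    simpa using dot_nn g
  have hu : IsUnit (W * Wᵀ).det := isUnit_iff_ne_zero.mpr hdet
  set u : Fin k → ℝ := (W * Wᵀ)⁻¹ *ᵥ Pi.single j 1 with hudef
  set xj := Wᵀ *ᵥ u with hxj
  have e1 : ∑ t, (Wᵀ * (W * Wᵀ)⁻¹) t j ^ 2 = xj ⬝ᵥ xj := by
    have : ∀ t, (Wᵀ * (W * Wᵀ)⁻¹) t j = xj t := by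
      intro t
      rw [hxj, hudef, Matrix.mulVec_mulVec]
      simp
    simp only [this, dotProduct, sq]
  have e2 : xj ⬝ᵥ xj = u j := by
    rw [hxj, mulVec_dot, Matrix.transpose_transpose, Matrix.mulVec_mulVec]
    conv_lhs => rw [hudef]
    rw [Matrix.mulVec_mulVec, Matrix.mul_nonsing_inv _ hu, Matrix.one_mulVec]
    simp [hudef]
  set x := (g ⬝ᵥ g)⁻¹ • (Bᵀ *ᵥ g) with hx
  have e3 : W *ᵥ x = Pi.single j 1 := by
    funext j'
    rw [hx, Matrix.mulVec_smul]
    simp only [Pi.smul_apply, smul_eq_mul]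
    have : (W *ᵥ (Bᵀ *ᵥ g)) j' = (B *ᵥ (W j')) ⬝ᵥ g := by
      rw [mulVec_dot]; rfl
    rw [this]
    by_cases hj : j' = j
    · subst hj
      rw [← hgdef]; simp [inv_mul_cancel₀ hg]
    · rw [hB' _ hj]; simp [hj]
  have e4 : x ⬝ᵥ x = (g ⬝ᵥ g)⁻¹ := by
    rw [hx, dotProduct_smul, smul_dotProduct, e0]
    simp [inv_mul_cancel₀ hg]
  have e5 : xj ⬝ᵥ x = u j := by
    rw [hxj, mulVec_dot, Matrix.transpose_transpose, e3]; simp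
  have h2 := dot_nn (x - xj)
  simp only [sub_dotProduct, dotProduct_sub] at h2
  rw [dotProduct_comm x xj, e5, e4, e2] at h2
  rw [e1, e2]; linarith

theorem ae_dot_ne (m : ℕ) (hm : 0 < m) : ∀ᵐ g ∂(GG (Fin m)), g ⬝ᵥ g ≠ 0 := by
  have := ae_submat_det_ne_zero (n := m) (l := 1) (p := 1) (fun _ => ⟨0, hm⟩) id
    (fun _ _ _ => Subsingleton.elim _ _) Function.injective_id
  have h2 := GG_ae_adj (ι := Fin m) (κ := Fin m × Fin 1) (fun x z => x z.1) (fun y i => y (i, 0))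
    (by intro x y; simp [dotProduct, Fintype.sum_prod_type]) (by intro y; funext ⟨a, b⟩; simp [Subsingleton.elim b 0])
    _ this
  filter_upwards [h2] with g hg h0
  rw [dotProduct_self_eq_zero] at h0
  apply hg
  rw [h0]
  simp [mat]

theorem dual_exp {k l : ℕ} (hk : 0 < k) (hkl : k + 2 ≤ l) (W : Matrix (Fin k) (Fin l) ℝ) (j : Fin k) :
    ∫⁻ w, ENNReal.ofReal (∑ t, ((W.updateRow j w)ᵀ * (W.updateRow j w * (W.updateRow j w)ᵀ)⁻¹) t j ^ 2) ∂(GG (Fin l))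
      ≤ ENNReal.ofReal (1 / ((l:ℝ) - k - 1)) := by
  obtain ⟨B, hB, hB'⟩ := exists_orth_rows (m := l - k + 1) W j (by omega)
  have had1 : ∀ (x : Fin l → ℝ) y, (B *ᵥ x) ⬝ᵥ y = x ⬝ᵥ (Bᵀ *ᵥ y) := fun x y => mulVec_dot B x y
  have had2 : ∀ y, B *ᵥ (Bᵀ *ᵥ y) = y := by
    intro y; rw [Matrix.mulVec_mulVec, hB, Matrix.one_mulVec]
  have h1 := GG_ae_adj (fun x => B *ᵥ x) (fun y => Bᵀ *ᵥ y) had1 had2 _ (ae_dot_ne (l - k + 1) (by omega))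
  have h2 := GG_lint_adj (fun x => B *ᵥ x) (fun y => Bᵀ *ᵥ y) had1 had2 (fun g => ENNReal.ofReal ((g ⬝ᵥ g)⁻¹))
    (((by fun_prop : Continuous fun g : Fin (l - k + 1) → ℝ => g ⬝ᵥ g).measurable.inv).ennreal_ofReal)
  calc _ ≤ ∫⁻ w, ENNReal.ofReal (((B *ᵥ w) ⬝ᵥ (B *ᵥ w))⁻¹) ∂(GG (Fin l)) := by
        apply lintegral_mono_ae
        filter_upwards [h1] with w hw
        apply ENNReal.ofReal_le_ofReal
        have hwj : (W.updateRow j w) j = w := by simp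
        have := dual_le (W.updateRow j w) j B hB (fun j' hj' => by
          rw [Matrix.updateRow_ne hj']; exact hB' j' hj') (by rw [hwj]; exact hw)
        rwa [hwj] at this
    _ = _ := h2
    _ ≤ _ := lint_inv_dot _ (by omega)
    _ = _ := by
      congr 2
      have : k ≤ l := by omega
      push_cast [Nat.cast_sub this]; ring

/-- top rows -/
noncomputable def topW {n l k : ℕ} (hkn : k < n) (ω : Fin n × Fin l → ℝ) : Matrix (Fin k) (Fin l) ℝ :=
  (mat ω).submatrix (Fin.castLE hkn.le) id

/-- right inverse of the top rows -/
noncomputable def topX {n l k : ℕ} (hkn : k < n) (ω : Fin n × Fin l → ℝ) : Matrix (Fin l) (Fin k) ℝ :=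
  (topW hkn ω)ᵀ * (topW hkn ω * (topW hkn ω)ᵀ)⁻¹

theorem meas_mat {p q : Type*} (i : p) (j : q) : Measurable fun ω : p × q → ℝ => mat ω i j := by
  unfold mat; simp only [Matrix.of_apply]; exact measurable_pi_apply _

theorem meas_topW {n l k : ℕ} (hkn : k < n) (i : Fin k) (j : Fin l) :
    Measurable fun ω : Fin n × Fin l → ℝ => topW hkn ω i j := meas_mat _ _

theorem meas_topX {n l k : ℕ} (hkn : k < n) (i : Fin l) (j : Fin k) :
    Measurable fun ω : Fin n × Fin l → ℝ => topX hkn ω i j := by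
  unfold topX
  refine meas_mul _ _ (fun i j => meas_topW hkn j i) (meas_inv _ ?_) i j
  exact meas_mul _ _ (fun i j => meas_topW hkn i j) (fun i j => meas_topW hkn j i)

theorem topX_exp {n l k : ℕ} (hk : 0 < k) (hkn : k < n) (hkl : k + 2 ≤ l) (j : Fin k) :
    ∫⁻ ω, ENNReal.ofReal (∑ t, topX hkn ω t j ^ 2) ∂(GG (Fin n × Fin l)) ≤
      ENNReal.ofReal (1 / ((l:ℝ) - k - 1)) := by
  rw [← GG_row (Fin.castLE hkn.le j)]
  swap
  · exact (Finset.measurable_sum _ fun t _ => (meas_topX hkn t j).pow_const 2).ennreal_ofReal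
  calc _ ≤ ∫⁻ _, ENNReal.ofReal (1 / ((l:ℝ) - k - 1)) ∂(GG (Fin n × Fin l)) := by
        apply lintegral_mono
        intro ω
        refine le_trans (le_of_eq ?_) (dual_exp hk hkl (topW hkn ω) j)
        apply lintegral_congr
        intro w
        have : topW hkn (setrow (Fin.castLE hkn.le j) w ω) = (topW hkn ω).updateRow j w := by
          ext a b
          rw [topW, Matrix.submatrix_apply, mat_setrow, Matrix.updateRow_apply]
          simp [topW]
        rw [topX, this]
    _ = _ := by simp

theorem H_exp {n l k : ℕ} (hk : 0 < k) (hkn : k < n) (hkl : k + 2 ≤ l) (i : Fin n) (hi : ¬ (i:ℕ) < k) :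
    ∫⁻ ω, ENNReal.ofReal (∑ j, (mat ω * topX hkn ω) i j ^ 2) ∂(GG (Fin n × Fin l)) ≤
      ENNReal.ofReal (k / ((l:ℝ) - k - 1)) := by
  rw [← GG_row i]
  swap
  · exact (Finset.measurable_sum _ fun t _ => (meas_mul _ _ meas_mat (meas_topX hkn) i t).pow_const 2).ennreal_ofReal
  have e1 : ∀ (ω : Fin n × Fin l → ℝ) w, ENNReal.ofReal (∑ j, (mat (setrow i w ω) * topX hkn (setrow i w ω)) i j ^ 2)
      = ∑ j, ENNReal.ofReal (((fun t => topX hkn ω t j) ⬝ᵥ w) ^ 2) := by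
    intro ω w
    rw [ENNReal.ofReal_sum_of_nonneg (fun j _ => sq_nonneg _)]
    apply Finset.sum_congr rfl
    intro j _
    have hW : topW hkn (setrow i w ω) = topW hkn ω := by
      ext a b
      rw [topW, Matrix.submatrix_apply, mat_setrow, if_neg]
      · rfl
      · intro h; apply hi; rw [← h]; simp
    have hX : topX hkn (setrow i w ω) = topX hkn ω := by rw [topX, hW, topX]
    rw [hX, Matrix.mul_apply]
    congr 2
    apply Finset.sum_congr rfl
    intro t _
    rw [mat_setrow, if_pos rfl, mul_comm]
  simp only [e1]
  have e2 : ∀ ω : Fin n × Fin l → ℝ, ∫⁻ w, ∑ j, ENNReal.ofReal (((fun t => topX hkn ω t j) ⬝ᵥ w) ^ 2) ∂(GG (Fin l)) =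
      ∑ j, ENNReal.ofReal (∑ t, topX hkn ω t j ^ 2) := by
    intro ω
    rw [lintegral_finsetSum]
    · apply Finset.sum_congr rfl
      intro j _
      rw [lint_dot_sq]
      simp only [dotProduct, sq]
    · intro j _
      apply Measurable.ennreal_ofReal
      apply Continuous.measurable
      fun_prop
  simp only [e2]
  rw [lintegral_finsetSum]
  · calc _ ≤ ∑ j : Fin k, ENNReal.ofReal (1 / ((l:ℝ) - k - 1)) :=
          Finset.sum_le_sum fun j _ => topX_exp hk hkn hkl j
      _ = _ := by
        rw [Finset.sum_const, Finset.card_univ, Fintype.card_fin, nsmul_eq_mul, ← ENNReal.ofReal_natCast,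
          ← ENNReal.ofReal_mul (by positivity)]
        congr 1; ring
  · intro j _
    exact (Finset.measurable_sum _ fun t _ => (meas_topX hkn t j).pow_const 2).ennreal_ofReal

theorem lint_tail {α : Type*} [MeasurableSpace α] (μ : Measure α) {n : ℕ} (k : ℕ) (lam : Fin n → ℝ)
    (hl0 : ∀ j, 0 ≤ lam j) (f : Fin n → α → ℝ) (hf0 : ∀ i x, 0 ≤ f i x) (hf : ∀ i, Measurable (f i)) (c : ℝ)
    (hc : 0 ≤ c)
    (h : ∀ i : Fin n, ¬ (i:ℕ) < k → ∫⁻ x, ENNReal.ofReal (f i x) ∂μ ≤ ENNReal.ofReal c) :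
    ∫⁻ x, ENNReal.ofReal (∑ i : Fin n, if (i:ℕ) < k then 0 else lam i * f i x) ∂μ ≤
      ENNReal.ofReal (c * tailS k lam) := by
  have e1 : ∀ x, ENNReal.ofReal (∑ i : Fin n, if (i:ℕ) < k then 0 else lam i * f i x) =
      ∑ i : Fin n, if (i:ℕ) < k then 0 else ENNReal.ofReal (lam i) * ENNReal.ofReal (f i x) := by
    intro x
    rw [ENNReal.ofReal_sum_of_nonneg]
    · apply Finset.sum_congr rfl; intro i _
      split_ifs
      · simp
      · rw [ENNReal.ofReal_mul (hl0 i)]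
    · intro i _
      split_ifs
      exacts [le_rfl, mul_nonneg (hl0 i) (hf0 i x)]
  simp only [e1]
  rw [lintegral_finsetSum]
  · rw [tailS, Finset.mul_sum, ENNReal.ofReal_sum_of_nonneg]
    · apply Finset.sum_le_sum
      intro i _
      by_cases hi : (i:ℕ) < k
      · simp [hi]
      · simp only [hi, if_false]
        rw [lintegral_const_mul _ (hf i).ennreal_ofReal, ENNReal.ofReal_mul hc, mul_comm]
        gcongr
        exact h i hi
    · intro i _
      split_ifs
      · simp
      · exact mul_nonneg hc (hl0 i)
  · intro i _
    split_ifs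
    · exact measurable_const
    · exact (hf i).ennreal_ofReal.const_mul _

theorem caseA {n l k : ℕ} (hk : 0 < k) (hkn : k < n) (hkl : k + 2 ≤ l) (hln : l ≤ n) (lam : Fin n → ℝ)
    (hl0 : ∀ j, 0 ≤ lam j) (hpos : ∀ j : Fin n, (j:ℕ) < l → 0 < lam j) : GoodBound (l := l) hkn lam := by
  have hl : (0:ℝ) < l := by exact_mod_cast (by omega : 0 < l)
  have hk' : (1:ℝ) ≤ k := by exact_mod_cast hk
  have hd : (1:ℝ) ≤ (l:ℝ) - k - 1 := by
    have : (k:ℝ) + 2 ≤ l := by exact_mod_cast hkl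
    linarith
  set a : ℝ := 2 * k / Real.sqrt l with ha
  have hs : 0 < Real.sqrt l := Real.sqrt_pos.mpr hl
  have ha0 : 0 < a := by positivity
  refine ⟨fun ω => ∑ i : Fin n, if (i:ℕ) < k then 0 else
    lam i * (a / 4 + (∑ j, (mat ω * topX hkn ω) i j ^ 2) / (4 * a)), ?_, ?_, ?_⟩
  · refine Finset.measurable_sum _ fun i _ => ?_
    split_ifs
    · exact measurable_const
    · refine Measurable.const_mul (Measurable.const_add (Measurable.div_const ?_ _) _) _
      exact (Finset.measurable_sum _ fun t _ => (meas_mul _ _ meas_mat (meas_topX hkn) i t).pow_const 2)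
  · filter_upwards [ae_submat_det_ne_zero (n := n) (l := l) (Fin.castLE hln) id (Fin.castLE_injective _) Function.injective_id,
      ae_submat_det_ne_zero (n := n) (l := l) (p := k) (Fin.castLE hkn.le) (Fin.castLE (by omega)) (Fin.castLE_injective _)
        (Fin.castLE_injective _)] with ω h1 h2
    refine caseA_det hkn lam hl0 (mat ω) (topX hkn ω) ?_ (inj_of_block hln lam hpos (mat ω) h1) a ha0
    change topW hkn ω * topX hkn ω = 1
    rw [topX, ← Matrix.mul_assoc, Matrix.mul_nonsing_inv]
    rw [isUnit_iff_ne_zero]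
    intro h0
    obtain ⟨v, hv, hv0⟩ := Matrix.exists_mulVec_eq_zero_iff.mpr h0
    apply hv
    have h3 : ((topW hkn ω)ᵀ *ᵥ v) ⬝ᵥ ((topW hkn ω)ᵀ *ᵥ v) = 0 := by
      rw [mulVec_dot, Matrix.mulVec_mulVec, Matrix.transpose_transpose, hv0, dotProduct_zero]
    rw [dotProduct_self_eq_zero] at h3
    rw [← Matrix.det_transpose] at h2
    apply Matrix.eq_zero_of_mulVec_eq_zero h2
    funext t
    exact congrFun h3 (Fin.castLE (by omega) t)
  · refine lint_tail _ k lam hl0 (fun i ω => a / 4 + (∑ j, (mat ω * topX hkn ω) i j ^ 2) / (4 * a)) ?_ ?_ _ ?_ ?_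
    · intro i ω; positivity
    · intro i
      refine (Measurable.const_add (Measurable.div_const ?_ _) _)
      exact (Finset.measurable_sum _ fun t _ => (meas_mul _ _ meas_mat (meas_topX hkn) i t).pow_const 2)
    · positivity
    · intro i hi
      have e : ∀ ω : Fin n × Fin l → ℝ, ENNReal.ofReal (a / 4 + (∑ j, (mat ω * topX hkn ω) i j ^ 2) / (4 * a)) =
          ENNReal.ofReal (a / 4) + ENNReal.ofReal (1 / (4 * a)) *
            ENNReal.ofReal (∑ j, (mat ω * topX hkn ω) i j ^ 2) := by
        intro ω
        rw [← ENNReal.ofReal_mul (by positivity), ← ENNReal.ofReal_add (by positivity) (by positivity)]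
        congr 1; ring
      simp only [e]
      rw [lintegral_add_left measurable_const, lintegral_const_mul]
      · calc _ ≤ ENNReal.ofReal (a / 4) + ENNReal.ofReal (1 / (4 * a)) * ENNReal.ofReal (k / ((l:ℝ) - k - 1)) := by
              rw [lintegral_const, measure_univ, mul_one]
              gcongr
              exact H_exp hk hkn hkl i hi
          _ = ENNReal.ofReal (a / 4 + 1 / (4 * a) * (k / ((l:ℝ) - k - 1))) := by
              rw [ENNReal.ofReal_add (by positivity) (by positivity), ENNReal.ofReal_mul (by positivity)]
          _ ≤ _ := by
              apply ENNReal.ofReal_le_ofReal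
              have hss : Real.sqrt l * Real.sqrt l = l := Real.mul_self_sqrt hl.le
              have h1 : a / 4 = k / Real.sqrt l / 2 := by rw [ha]; ring
              have h2 : 1 / (4 * a) * (k / ((l:ℝ) - k - 1)) = Real.sqrt l / (8 * ((l:ℝ) - k - 1)) := by
                have : (l:ℝ) - k - 1 ≠ 0 := by linarith
                rw [ha]; field_simp; ring
              have h3 : Real.sqrt l / (8 * ((l:ℝ) - k - 1)) ≤ k / Real.sqrt l / 2 := by
                rw [div_div, div_le_div_iff₀ (by linarith) (by positivity)]
                have : (l:ℝ) ≤ 4 * k * ((l:ℝ) - k - 1) := by nlinarith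
                nlinarith
              rw [h1, h2]; linarith
      · exact (Finset.measurable_sum _ fun t _ => (meas_mul _ _ meas_mat (meas_topX hkn) i t).pow_const 2).ennreal_ofReal

/-- the vector appearing in a rank-one row update -/
noncomputable def xv {n k : ℕ} (d : Fin n → ℝ) (Ω : Matrix (Fin n) (Fin k) ℝ) (w : Fin k → ℝ) : Fin n → ℝ :=
  (Matrix.diagonal d * Ω) *ᵥ (((Matrix.diagonal d * Ω)ᵀ * (Matrix.diagonal d * Ω))⁻¹ *ᵥ w)

/-- the loss of one row update in terms of the vector x -/
noncomputable def lossX {n : ℕ} (d : Fin n → ℝ) (μ : ℝ) (x : Fin n → ℝ) : ℝ :=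
  Real.sqrt ((Matrix.diagonal d *ᵥ x) ⬝ᵥ (Matrix.diagonal d *ᵥ x)) / Real.sqrt (x ⬝ᵥ x) *
    (1 - 1 / Real.sqrt (1 + μ ^ 2 * (x ⬝ᵥ x)))

theorem vmv_add {m k : Type*} (u v : m → ℝ) (p : k → ℝ) :
    Matrix.vecMulVec u p + Matrix.vecMulVec v p = Matrix.vecMulVec (u + v) p := by
  ext i j; simp [Matrix.vecMulVec_apply, add_mul]

theorem rank_one_iso {n k : ℕ} (Z : Matrix (Fin n) (Fin k) ℝ) (hZ : Zᵀ * Z = 1)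
    (v : Fin n → ℝ) (p : Fin k → ℝ) (t : ℝ) (hv : Zᵀ *ᵥ v = t • p) (hvv : 2 * t + v ⬝ᵥ v = 0) :
    (Z + Matrix.vecMulVec v p)ᵀ * (Z + Matrix.vecMulVec v p) = 1 := by
  have hv' : v ᵥ* Z = t • p := by rw [← hv, Matrix.mulVec_transpose]
  rw [Matrix.transpose_add, Matrix.transpose_vecMulVec, Matrix.add_mul, Matrix.mul_add, Matrix.mul_add, hZ,
    Matrix.mul_vecMulVec, hv, Matrix.vecMulVec_mul, hv', Matrix.vecMulVec_mul_vecMulVec]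
  ext i j
  simp only [Matrix.add_apply, Matrix.vecMulVec_apply, Pi.smul_apply, smul_eq_mul, Matrix.smul_apply]
  have : v ⬝ᵥ v = -(2 * t) := by linarith
  rw [this]; ring

theorem step_lemma {n k : ℕ} (hkn : k < n) (lam d : Fin n → ℝ) (hd : ∀ j : Fin k, d (Fin.castLE hkn.le j) = lam (Fin.castLE hkn.le j))
    (Y : Matrix (Fin n) (Fin k) ℝ) (i : Fin n) (hi : k ≤ (i:ℕ)) (hYi : ∀ j, Y i j = 0)
    (B : Matrix (Fin k) (Fin k) ℝ) (hZ : (Y * B)ᵀ * (Y * B) = 1) (μ : ℝ) (x : Fin n → ℝ) (u w : Fin k → ℝ)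
    (hxu : x = Y *ᵥ u) (hxw : Yᵀ *ᵥ x = w) :
    ∃ B' : Matrix (Fin k) (Fin k) ℝ,
      ((Y + Matrix.vecMulVec (Pi.single i μ) w) * B')ᵀ * ((Y + Matrix.vecMulVec (Pi.single i μ) w) * B') = 1 ∧
      ∑ j : Fin k, lam (Fin.castLE hkn.le j) * (1 - ((Y + Matrix.vecMulVec (Pi.single i μ) w) * B') (Fin.castLE hkn.le j) j) ≤
      ∑ j : Fin k, lam (Fin.castLE hkn.le j) * (1 - (Y * B) (Fin.castLE hkn.le j) j) + lossX d μ x := by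
  by_cases hx0 : x = 0
  · have hw : w = 0 := by rw [← hxw, hx0, Matrix.mulVec_zero]
    have e : Y + Matrix.vecMulVec (Pi.single i μ) w = Y := by
      rw [hw]; ext a b; simp [Matrix.vecMulVec_apply]
    refine ⟨B, ?_, ?_⟩
    · rw [e]; exact hZ
    · rw [e]; simp [lossX, hx0]
  have hxx : 0 < x ⬝ᵥ x :=
    lt_of_le_of_ne (dot_nn x) (Ne.symm (by simpa [dotProduct_self_eq_zero] using hx0))
  set r := Real.sqrt (x ⬝ᵥ x) with hr
  have hr0 : 0 < r := Real.sqrt_pos.mpr hxx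
  have hrr : r * r = x ⬝ᵥ x := Real.mul_self_sqrt hxx.le
  set q := r⁻¹ • x with hq
  have hqq : q ⬝ᵥ q = 1 := by
    rw [hq, dotProduct_smul, smul_dotProduct, ← hrr, smul_eq_mul, smul_eq_mul]; field_simp
  set s := μ * r with hs
  set c := 1 / Real.sqrt (1 + s ^ 2) with hc
  have hsq : 0 < Real.sqrt (1 + s ^ 2) := Real.sqrt_pos.mpr (by positivity)
  have hcc : c ^ 2 * (1 + s ^ 2) = 1 := by
    rw [hc, div_pow, Real.sq_sqrt (by positivity)]; field_simp
  have hc1 : c ≤ 1 := by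
    rw [hc, div_le_one hsq]; rw [Real.one_le_sqrt]; nlinarith [sq_nonneg s]
  set Z := Y * B with hZdef
  set p := Zᵀ *ᵥ q with hp
  set v : Fin n → ℝ := (-(1 - c)) • q + (s * c) • Pi.single i 1 with hv
  have hxi : x i = 0 := by
    rw [hxu]; simp [Matrix.mulVec, dotProduct, hYi]
  have hqi : q i = 0 := by rw [hq]; simp [hxi]
  have hZi : Zᵀ *ᵥ (Pi.single i 1) = 0 := by
    funext j
    simp [hZdef, Matrix.mul_apply, hYi]
  have hvZ : Zᵀ *ᵥ v = (-(1 - c)) • p := by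
    have h1 := Matrix.mulVec_smul Zᵀ (-(1 - c)) q
    have h2 := Matrix.mulVec_smul Zᵀ (s * c) (Pi.single i 1)
    rw [hv, Matrix.mulVec_add, h1, h2, hZi, smul_zero, add_zero]
  have hvv : v ⬝ᵥ v = (1 - c) ^ 2 + (s * c) ^ 2 := by
    rw [hv]
    simp only [add_dotProduct, dotProduct_add, smul_dotProduct, dotProduct_smul, hqq, smul_eq_mul, dotProduct_single,
      single_dotProduct, hqi, Pi.add_apply, Pi.smul_apply, Pi.single_eq_same]
    ring
  set B' := B - Matrix.vecMulVec ((1 - c) • (r⁻¹ • u)) p with hB'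
  have hqu : Y *ᵥ (r⁻¹ • u) = q := by rw [Matrix.mulVec_smul, ← hxu]
  have hwB : w ᵥ* B = r • p := by
    rw [← hxw, Matrix.mulVec_transpose, Matrix.vecMul_vecMul, ← hZdef, hp, hq, Matrix.mulVec_smul, smul_smul,
      mul_inv_cancel₀ hr0.ne', one_smul, Matrix.mulVec_transpose]
  have hwu : w ⬝ᵥ (r⁻¹ • u) = r := by
    rw [← hxw, mulVec_dot, Matrix.transpose_transpose, hqu, hq, dotProduct_smul, ← hrr, smul_eq_mul]; field_simp
  have hnew : (Y + Matrix.vecMulVec (Pi.single i μ) w) * B' = Z + Matrix.vecMulVec v p := by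
    rw [hB', Matrix.mul_sub, Matrix.add_mul, Matrix.add_mul, ← hZdef, Matrix.vecMulVec_mul, hwB, Matrix.mul_vecMulVec,
      Matrix.mulVec_smul, hqu, Matrix.vecMulVec_mul_vecMulVec, dotProduct_smul, hwu]
    ext a b
    simp only [Matrix.add_apply, Matrix.sub_apply, Matrix.vecMulVec_apply, Pi.smul_apply, Matrix.smul_apply, hv, Pi.add_apply, smul_eq_mul]
    by_cases hai : a = i
    · subst hai; simp; rw [hs]; ring
    · simp [hai]; ring
  refine ⟨B', ?_, ?_⟩
  · rw [hnew]
    exact rank_one_iso Z hZ v p _ hvZ (by rw [hvv]; nlinarith)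
  rw [hnew]
  have e1 : ∀ j : Fin k, (Z + Matrix.vecMulVec v p) (Fin.castLE hkn.le j) j =
      Z (Fin.castLE hkn.le j) j - (1 - c) * (q (Fin.castLE hkn.le j) * p j) := by
    intro j
    have hji : (Fin.castLE hkn.le j) ≠ i := by
      intro h; have := congrArg Fin.val h; simp at this; omega
    simp [Matrix.vecMulVec_apply, hv, hji]; ring
  simp only [e1]
  have e2 : ∑ j : Fin k, lam (Fin.castLE hkn.le j) * (1 - (Z (Fin.castLE hkn.le j) j - (1 - c) * (q (Fin.castLE hkn.le j) * p j))) =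
     ∑ j : Fin k, lam (Fin.castLE hkn.le j) * (1 - Z (Fin.castLE hkn.le j) j) +
      (1 - c) * ∑ j : Fin k, (lam (Fin.castLE hkn.le j) * q (Fin.castLE hkn.le j)) * p j := by
    rw [Finset.mul_sum, ← Finset.sum_add_distrib]
    apply Finset.sum_congr rfl; intro j _; ring
  rw [e2]
  have hpp : p ⬝ᵥ p ≤ 1 := by
    rw [← hqq]; exact (Contr.of_iso hZ).transpose q
  have hcs := dot_cs (fun j : Fin k => lam (Fin.castLE hkn.le j) * q (Fin.castLE hkn.le j)) p
  set A := (fun j : Fin k => lam (Fin.castLE hkn.le j) * q (Fin.castLE hkn.le j)) with hA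
  have hAD : A ⬝ᵥ A ≤ (Matrix.diagonal d *ᵥ q) ⬝ᵥ (Matrix.diagonal d *ᵥ q) := by
    have : (Matrix.diagonal d *ᵥ q) ⬝ᵥ (Matrix.diagonal d *ᵥ q) = ∑ m, (d m * q m) * (d m * q m) := by
      simp [dotProduct, Matrix.mulVec_diagonal]
    rw [this, sum_split hkn.le]
    have h2 : 0 ≤ tailS k (fun m => d m * q m * (d m * q m)) := by
      apply Finset.sum_nonneg; intro m _; split_ifs
      exacts [le_rfl, mul_self_nonneg _]
    simp only [hd]
    have h3 : A ⬝ᵥ A = ∑ j : Fin k, lam (Fin.castLE hkn.le j) * q (Fin.castLE hkn.le j) * (lam (Fin.castLE hkn.le j) * q (Fin.castLE hkn.le j)) := rfl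
    linarith
  have hDq : Real.sqrt ((Matrix.diagonal d *ᵥ q) ⬝ᵥ (Matrix.diagonal d *ᵥ q)) =
      Real.sqrt ((Matrix.diagonal d *ᵥ x) ⬝ᵥ (Matrix.diagonal d *ᵥ x)) / r := by
    rw [hq, Matrix.mulVec_smul, dotProduct_smul, smul_dotProduct, smul_smul, smul_eq_mul,
      Real.sqrt_mul (by positivity), Real.sqrt_mul_self (by positivity)]
    ring
  have hfin : A ⬝ᵥ p ≤ Real.sqrt ((Matrix.diagonal d *ᵥ x) ⬝ᵥ (Matrix.diagonal d *ᵥ x)) / r := by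
    rw [← hDq]
    apply Real.le_sqrt_of_sq_le
    have := dot_nn A
    have := dot_nn p
    nlinarith
  have hloss : lossX d μ x = Real.sqrt ((Matrix.diagonal d *ᵥ x) ⬝ᵥ (Matrix.diagonal d *ᵥ x)) / r * (1 - c) := by
    rw [lossX, hc, hs, mul_pow, ← hrr, sq r]
    rw [Real.sqrt_mul_self hr0.le]
  rw [hloss]
  have : (1 - c) * (A ⬝ᵥ p) ≤ Real.sqrt ((Matrix.diagonal d *ᵥ x) ⬝ᵥ (Matrix.diagonal d *ᵥ x)) / r * (1 - c) := by
    rw [mul_comm]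
    exact mul_le_mul_of_nonneg_right hfin (by linarith)
  have h4 : A ⬝ᵥ p = ∑ j : Fin k, (lam (Fin.castLE hkn.le j) * q (Fin.castLE hkn.le j)) * p j := rfl
  rw [h4] at this
  linarith

/-- truncated weights -/
noncomputable def trunc {n : ℕ} (i : ℕ) (lam : Fin n → ℝ) : Fin n → ℝ := fun r => if (r:ℕ) < i then lam r else 0

theorem chain {n k : ℕ} (hkn : k < n) (lam : Fin n → ℝ) (hpos : ∀ j : Fin n, (j:ℕ) < k → 0 < lam j)
    (Ω : Matrix (Fin n) (Fin k) ℝ) (hdet : (Ω.submatrix (Fin.castLE hkn.le) id).det ≠ 0) (t : ℕ) (hkt : k ≤ t) (htn : t ≤ n) :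
    ∃ B : Matrix (Fin k) (Fin k) ℝ,
      (Matrix.diagonal (trunc t lam) * Ω * B)ᵀ * (Matrix.diagonal (trunc t lam) * Ω * B) = 1 ∧
      ∑ j : Fin k, lam (Fin.castLE hkn.le j) * (1 - (Matrix.diagonal (trunc t lam) * Ω * B) (Fin.castLE hkn.le j) j) ≤
      ∑ i : Fin n, if (i:ℕ) < k then 0 else if (i:ℕ) < t then lossX (trunc i lam) (lam i) (xv (trunc i lam) Ω (Ω i)) else 0 := by
  induction t, hkt using Nat.le_induction with
  | base =>
    set W := Ω.submatrix (Fin.castLE hkn.le) id with hW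
    have hu : IsUnit W.det := isUnit_iff_ne_zero.mpr hdet
    have hWW := Matrix.mul_nonsing_inv W hu
    set B := W⁻¹ * Matrix.diagonal (fun j : Fin k => (lam (Fin.castLE hkn.le j))⁻¹) with hB
    have hZ1 : ∀ (j : Fin k) j', (Matrix.diagonal (trunc k lam) * Ω * B) (Fin.castLE hkn.le j) j' = if j = j' then 1 else 0 := by
      intro j j'
      have h1 : (Ω * B) (Fin.castLE hkn.le j) j' = (W * B) j j' := rfl
      rw [Matrix.mul_assoc, Matrix.diagonal_mul, h1, hB, ← Matrix.mul_assoc, hWW, Matrix.one_mul]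
      have := (hpos (Fin.castLE hkn.le j) (by simp)).ne'
      by_cases hj : j = j'
      · subst hj; simp [trunc, this]
      · simp [hj]
    have hZ2 : ∀ (r : Fin n) j', ¬ (r:ℕ) < k → (Matrix.diagonal (trunc k lam) * Ω * B) r j' = 0 := by
      intro r j' hr
      rw [Matrix.mul_assoc, Matrix.diagonal_mul]; simp [trunc, hr]
    refine ⟨B, ?_, ?_⟩
    · ext j j'
      rw [Matrix.mul_apply, sum_split hkn.le]
      simp only [Matrix.transpose_apply, hZ1]
      have : tailS k (fun r => (Matrix.diagonal (trunc k lam) * Ω * B) r j * (Matrix.diagonal (trunc k lam) * Ω * B) r j') = 0 := by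
        apply Finset.sum_eq_zero; intro r _
        split_ifs with h
        · rfl
        · simp only [hZ2 r j h, zero_mul]
      rw [this, Matrix.one_apply]
      simp [eq_comm]
    · simp only [hZ1]
      simp
      apply Finset.sum_nonneg
      intro i _
      split_ifs <;> simp
  | succ t hkt ih =>
    obtain ⟨B, hB1, hB2⟩ := ih (by omega)
    set i : Fin n := ⟨t, by omega⟩ with hi
    set Y := Matrix.diagonal (trunc t lam) * Ω with hY
    have hYdet : (Yᵀ * Y).det ≠ 0 := by
      apply proj_of_gram
      intro v hv
      exact inj_of_block hkn.le (trunc t lam) (fun j hj => by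
        simp only [trunc]; rw [if_pos (by omega)]; exact hpos j hj) Ω hdet v hv
    have hYu : IsUnit (Yᵀ * Y).det := isUnit_iff_ne_zero.mpr hYdet
    have hnext : Matrix.diagonal (trunc (t+1) lam) * Ω = Y + Matrix.vecMulVec (Pi.single i (lam i)) (Ω i) := by
      ext a b
      rw [hY, Matrix.add_apply, Matrix.diagonal_mul, Matrix.diagonal_mul, Matrix.vecMulVec_apply]
      by_cases ha : a = i
      · subst ha; simp [trunc, hi]
      · have : (a:ℕ) ≠ t := fun h => ha (Fin.ext h)
        have h2 : ((a:ℕ) < t + 1) ↔ (a:ℕ) < t := by omega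
        simp [trunc, ha, h2]
    obtain ⟨B', h1, h2⟩ := step_lemma hkn lam (trunc t lam) (by intro j; simp only [trunc]; rw [if_pos]; simp; omega) Y i (by simp [hi, hkt])
      (by intro j; rw [hY, Matrix.diagonal_mul]; simp [trunc, hi]) B hB1 (lam i) (xv (trunc t lam) Ω (Ω i))
      ((Yᵀ * Y)⁻¹ *ᵥ (Ω i)) (Ω i) rfl (by
        rw [xv, ← hY, Matrix.mulVec_mulVec, Matrix.mulVec_mulVec, Matrix.mul_nonsing_inv _ hYu, Matrix.one_mulVec])
    refine ⟨B', ?_, ?_⟩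
    · rw [hnext]; exact h1
    · rw [hnext]
      refine (h2.trans (add_le_add_left hB2 _)).trans (le_of_eq ?_)
      have : lossX (trunc t lam) (lam i) (xv (trunc t lam) Ω (Ω i)) =
        ∑ m : Fin n, if m = i then lossX (trunc t lam) (lam i) (xv (trunc t lam) Ω (Ω i)) else 0 := by simp
      rw [this, ← Finset.sum_add_distrib]
      apply Finset.sum_congr rfl
      intro m _
      by_cases hm : m = i
      · subst hm
        have : ¬ t < k := by omega
        simp [hi, this]
      · have h1 : (m:ℕ) ≠ t := fun h => hm (Fin.ext h)
        have h2 : ((m:ℕ) < t + 1) ↔ (m:ℕ) < t := by omega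
        simp [hm, h2]

theorem exists_comp {n k : ℕ} (A : Matrix (Fin n) (Fin k) ℝ) :
    ∃ (m : ℕ) (B : Matrix (Fin m) (Fin n) ℝ), B * Bᵀ = 1 ∧ B * A = 0 ∧
      ∀ v, ∃ y, v - Bᵀ *ᵥ (B *ᵥ v) = A *ᵥ y := by
  set f : (Fin k → ℝ) →ₗ[ℝ] EuclideanSpace ℝ (Fin n) :=
    (WithLp.linearEquiv 2 ℝ (Fin n → ℝ)).symm.toLinearMap ∘ₗ A.mulVecLin with hf
  have hfa : ∀ y, f y = WithLp.toLp 2 (A *ᵥ y) := fun y => rfl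
  set V := LinearMap.range f with hV
  set b := stdOrthonormalBasis ℝ Vᗮ with hb
  have hin : ∀ x y : EuclideanSpace ℝ (Fin n), inner ℝ x y = ∑ t, x t * y t := by
    intro x y
    simp [PiLp.inner_apply, mul_comm]
  set B : Matrix (Fin (Module.finrank ℝ Vᗮ)) (Fin n) ℝ :=
    Matrix.of fun i t => (b i : EuclideanSpace ℝ (Fin n)) t with hB
  have hBv : ∀ (v : Fin n → ℝ) i, (B *ᵥ v) i = inner ℝ (b i : EuclideanSpace ℝ (Fin n)) (WithLp.toLp 2 v) := by
    intro v i
    rw [hin]; rfl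
  have hBB : B * Bᵀ = 1 := by
    ext i j
    rw [Matrix.mul_apply]
    simp only [hB, Matrix.of_apply, Matrix.transpose_apply]
    rw [← hin, ← Submodule.coe_inner, orthonormal_iff_ite.mp b.orthonormal, Matrix.one_apply]
  refine ⟨_, B, hBB, ?_, ?_⟩
  · have h1 : ∀ y, B *ᵥ (A *ᵥ y) = 0 := by
      intro y
      funext i
      rw [hBv, ← hfa, Pi.zero_apply]
      have := (b i).2
      rw [Submodule.mem_orthogonal'] at this
      exact this _ ⟨y, rfl⟩
    apply Matrix.ext_of_mulVec_single
    intro j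
    rw [← Matrix.mulVec_mulVec, h1, Matrix.zero_mulVec]
  · intro v
    set u := v - Bᵀ *ᵥ (B *ᵥ v) with hu
    have hBu : B *ᵥ u = 0 := by
      rw [hu, Matrix.mulVec_sub, Matrix.mulVec_mulVec, hBB, Matrix.one_mulVec, sub_self]
    have hmem : (WithLp.toLp 2 u : EuclideanSpace ℝ (Fin n)) ∈ Vᗮᗮ := by
      rw [Submodule.mem_orthogonal]
      intro w hw
      have hrep := b.sum_repr ⟨w, hw⟩
      have hrep2 : w = ∑ i, b.repr ⟨w, hw⟩ i • (b i : EuclideanSpace ℝ (Fin n)) := by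
        have := congrArg (Submodule.subtype _) hrep
        simpa using this.symm
      rw [hrep2, sum_inner]
      apply Finset.sum_eq_zero
      intro i _
      rw [inner_smul_left, ← hBv, hBu]; simp
    rw [Submodule.orthogonal_orthogonal] at hmem
    obtain ⟨y, hy⟩ := hmem
    refine ⟨y, ?_⟩
    rw [hfa] at hy
    have := congrArg (WithLp.ofLp) hy
    simpa using this.symm

theorem GG_col {n k : ℕ} (a : Fin k → ℝ) (ha : a ⬝ᵥ a = 1) (f : (Fin n × Fin k → ℝ) → ENNReal) (hf : Measurable f) :
    ∫⁻ ω, ∫⁻ z, f (unmat (mat ω - Matrix.vecMulVec (mat ω *ᵥ a) a + Matrix.vecMulVec z a)) ∂(GG (Fin n))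
      ∂(GG (Fin n × Fin k)) = ∫⁻ ω, f ω ∂(GG (Fin n × Fin k)) := by
  refine GG_lint_adj2 (fun ω z => unmat (mat ω - Matrix.vecMulVec (mat ω *ᵥ a) a + Matrix.vecMulVec z a))
    (fun y => unmat (mat y - Matrix.vecMulVec (mat y *ᵥ a) a)) (fun y => mat y *ᵥ a) ?_ ?_ f hf
  · intro x z y
    have hv : ∀ (z : Fin n → ℝ) (y : Fin n × Fin k → ℝ), (unmat (Matrix.vecMulVec z a)) ⬝ᵥ y = z ⬝ᵥ (mat y *ᵥ a) := by
      intro z y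
      simp only [dotProduct, unmat, Matrix.vecMulVec_apply, Fintype.sum_prod_type, Matrix.mulVec, mat, Matrix.of_apply,
        Finset.mul_sum]
      apply Finset.sum_congr rfl; intro i _
      apply Finset.sum_congr rfl; intro j _
      ring
    have hadd : ∀ A B : Matrix (Fin n) (Fin k) ℝ, unmat (A + B) = unmat A + unmat B := fun A B => rfl
    have hsub : ∀ A B : Matrix (Fin n) (Fin k) ℝ, unmat (A - B) = unmat A - unmat B := fun A B => rfl
    rw [hadd, hsub, hsub, unmat_mat, unmat_mat, add_dotProduct, sub_dotProduct, dotProduct_sub, hv, hv,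
      dotProduct_comm x (unmat _), hv, dotProduct_comm (mat x *ᵥ a)]
  · intro y
    have : ∀ i, ((mat y - Matrix.vecMulVec (mat y *ᵥ a) a) *ᵥ a) i = 0 := by
      intro i
      rw [Matrix.sub_mulVec, Matrix.vecMulVec_mulVec, ha]; simp
    rw [mat_unmat]
    have h2 : (mat y - Matrix.vecMulVec (mat y *ᵥ a) a) *ᵥ a = 0 := funext this
    rw [h2]
    have h3 : mat y - Matrix.vecMulVec (mat y *ᵥ a) a - Matrix.vecMulVec 0 a + Matrix.vecMulVec (mat y *ᵥ a) a = mat y := by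
      ext i j; simp [Matrix.vecMulVec_apply]
    rw [h3, unmat_mat]

theorem loss_core {n k : ℕ} (d : Fin n → ℝ) (μ ρ : ℝ) (hρ : 0 < ρ) (N : Matrix (Fin n) (Fin k) ℝ) (a : Fin k → ℝ)
    (ha : a ⬝ᵥ a = 1) (hN : N *ᵥ a = 0) :
    ∃ (m : ℕ) (M : Matrix (Fin m) (Fin n) ℝ), ∀ z,
      ENNReal.ofReal (lossX d μ (xv d (N + Matrix.vecMulVec z a) (ρ • a))) ≤ ENNReal.ofReal (coreF M (μ * ρ) z) := by
  set D := Matrix.diagonal d with hD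
  obtain ⟨m, B, hBB, hBA, hBy⟩ := exists_comp (D * N)
  refine ⟨m, B * D, fun z => ?_⟩
  set Y := D * (N + Matrix.vecMulVec z a) with hY
  by_cases hdet : (Yᵀ * Y).det = 0
  · have h0 : (Yᵀ * Y)⁻¹ = 0 := by
      rw [Matrix.inv_def, hdet]; simp
    have : xv d (N + Matrix.vecMulVec z a) (ρ • a) = 0 := by
      rw [xv, ← hD, ← hY, h0]; simp
    rw [this]; simp [lossX]
  have hu : IsUnit (Yᵀ * Y).det := isUnit_iff_ne_zero.mpr hdet
  set M := B * D with hM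
  have hYe : Y = D * N + Matrix.vecMulVec (D *ᵥ z) a := by
    rw [hY, Matrix.mul_add, Matrix.mul_vecMulVec]
  set g := M *ᵥ z with hg
  have hgB : g = B *ᵥ (D *ᵥ z) := by rw [hg, hM, Matrix.mulVec_mulVec]
  obtain ⟨y0, hy0⟩ := hBy (D *ᵥ z)
  rw [← hgB] at hy0
  set h := Bᵀ *ᵥ g with hh
  set y := y0 - (a ⬝ᵥ y0) • a with hy
  have hay : a ⬝ᵥ y = 0 := by
    rw [hy, dotProduct_sub, dotProduct_smul, ha]; simp
  have hDNa : (D * N) *ᵥ a = 0 := by rw [← Matrix.mulVec_mulVec, hN, Matrix.mulVec_zero]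
  have hDNy : (D * N) *ᵥ y = D *ᵥ z - h := by
    rw [hy, Matrix.mulVec_sub, Matrix.mulVec_smul, hDNa, smul_zero, sub_zero, ← hy0]
  have hYg : Y *ᵥ (a - y) = h := by
    rw [hYe, Matrix.add_mulVec, Matrix.mulVec_sub, hDNa, hDNy, Matrix.vecMulVec_mulVec, dotProduct_sub, ha, hay]
    funext i; simp
  have hhh : h ⬝ᵥ h = g ⬝ᵥ g := by
    rw [hh, mulVec_dot, Matrix.mulVec_mulVec, Matrix.transpose_transpose, hBB, Matrix.one_mulVec]
  have hDzh : (D *ᵥ z) ⬝ᵥ h = g ⬝ᵥ g := by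
    rw [hh, dotProduct_comm, mulVec_dot, Matrix.transpose_transpose, ← hgB]
  have hYh : Yᵀ *ᵥ h = (g ⬝ᵥ g) • a := by
    rw [hYe, Matrix.transpose_add, Matrix.add_mulVec, Matrix.transpose_vecMulVec, Matrix.vecMulVec_mulVec, hDzh]
    have : (D * N)ᵀ *ᵥ h = 0 := by
      rw [hh, Matrix.mulVec_mulVec, ← Matrix.transpose_mul, hBA]; simp
    rw [this]; funext i; simp [mul_comm]
  have hg0 : g ⬝ᵥ g ≠ 0 := by
    intro h0
    have hh0 : h = 0 := by rw [h0] at hhh; exact dotProduct_self_eq_zero.mp hhh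
    have h1 : (Yᵀ * Y) *ᵥ (a - y) = 0 := by
      rw [← Matrix.mulVec_mulVec, hYg, hh0, Matrix.mulVec_zero]
    have h2 := Matrix.eq_zero_of_mulVec_eq_zero hdet h1
    have h3 : a ⬝ᵥ (a - y) = 1 := by rw [dotProduct_sub, ha, hay, sub_zero]
    rw [h2] at h3; simp at h3
  have hgp : 0 < g ⬝ᵥ g := lt_of_le_of_ne (dot_nn g) (Ne.symm hg0)
  have hinv : (Yᵀ * Y)⁻¹ *ᵥ a = (g ⬝ᵥ g)⁻¹ • (a - y) := by
    have h1 : (Yᵀ * Y) *ᵥ (a - y) = (g ⬝ᵥ g) • a := by rw [← Matrix.mulVec_mulVec, hYg, hYh]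
    have h2 : a = (g ⬝ᵥ g)⁻¹ • ((Yᵀ * Y) *ᵥ (a - y)) := by
      rw [h1, smul_smul, inv_mul_cancel₀ hg0, one_smul]
    conv_lhs => rw [h2]
    rw [Matrix.mulVec_smul, Matrix.mulVec_mulVec, Matrix.nonsing_inv_mul _ hu, Matrix.one_mulVec]
  have hx : xv d (N + Matrix.vecMulVec z a) (ρ • a) = (ρ * (g ⬝ᵥ g)⁻¹) • h := by
    rw [xv, ← hD, ← hY, Matrix.mulVec_smul, hinv, Matrix.mulVec_smul, Matrix.mulVec_smul, hYg, smul_smul]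
  have hDh : D *ᵥ h = Mᵀ *ᵥ g := by
    rw [hh, hM, Matrix.transpose_mul, Matrix.mulVec_mulVec, hD, Matrix.diagonal_transpose]
  apply ENNReal.ofReal_le_ofReal
  apply le_of_eq
  rw [hx, lossX, coreF, ← hD, Matrix.mulVec_smul, hDh, ← hg]
  simp only [dotProduct_smul, smul_dotProduct, smul_eq_mul]
  rw [hhh]
  set r := Real.sqrt (g ⬝ᵥ g) with hr
  have hr0 : 0 < r := Real.sqrt_pos.mpr hgp
  have hrr : g ⬝ᵥ g = r * r := (Real.mul_self_sqrt hgp.le).symm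
  set q := (Mᵀ *ᵥ g) ⬝ᵥ (Mᵀ *ᵥ g) with hq
  rw [hrr]
  have e1 : Real.sqrt (ρ * (r * r)⁻¹ * (ρ * (r * r)⁻¹ * q)) = ρ * (r * r)⁻¹ * Real.sqrt q := by
    rw [← mul_assoc, Real.sqrt_mul (by positivity), Real.sqrt_mul_self (by positivity)]
  have e2 : ρ * (r * r)⁻¹ * (ρ * (r * r)⁻¹ * (r * r)) = (ρ / r) * (ρ / r) := by
    field_simp
  have e3 : 1 + μ ^ 2 * ((ρ / r) * (ρ / r)) = (r * r + (μ * ρ) ^ 2) / (r * r) := by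
    field_simp
  rw [e1, e2, e3, Real.sqrt_mul_self (by positivity), Real.sqrt_div (by positivity), Real.sqrt_mul_self hr0.le]
  have : 0 < Real.sqrt (r * r + (μ * ρ) ^ 2) := Real.sqrt_pos.mpr (by positivity)
  field_simp

theorem meas_loss {α : Type*} [MeasurableSpace α] {n k : ℕ} (d : Fin n → ℝ) (μ : ℝ)
    (Ω : α → Matrix (Fin n) (Fin k) ℝ) (hΩ : ∀ i j, Measurable fun x => Ω x i j)
    (w : α → Fin k → ℝ) (hw : ∀ j, Measurable fun x => w x j) :
    Measurable fun x => lossX d μ (xv d (Ω x) (w x)) := by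
  have hY : ∀ i j, Measurable fun x => (Matrix.diagonal d * Ω x) i j := by
    intro i j; simp only [Matrix.diagonal_mul]; exact (hΩ i j).const_mul _
  have hx : ∀ i, Measurable fun x => xv d (Ω x) (w x) i := by
    unfold xv
    exact meas_mulVec _ _ hY (meas_mulVec _ _ (meas_inv _ (meas_mul _ _ (fun i j => hY j i) hY)) hw)
  have hxx := meas_dot _ _ hx hx
  have hDx : ∀ i, Measurable fun x => (Matrix.diagonal d *ᵥ xv d (Ω x) (w x)) i := by
    intro i; simp only [Matrix.mulVec_diagonal]; exact (hx i).const_mul _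
  have hDD := meas_dot _ _ hDx hDx
  unfold lossX
  exact (hDD.sqrt.div hxx.sqrt).mul
    (measurable_const.sub (measurable_const.div ((hxx.const_mul _).const_add _).sqrt))

theorem loss_exp {n k : ℕ} (d : Fin n → ℝ) (μ : ℝ) (hμ : 0 ≤ μ) (w : Fin k → ℝ) :
    ∫⁻ ω, ENNReal.ofReal (lossX d μ (xv d (mat ω) w)) ∂(GG (Fin n × Fin k)) ≤
      ENNReal.ofReal (Real.sqrt (2 / Real.pi) * (μ * Real.sqrt (w ⬝ᵥ w))) := by
  by_cases hw : w = 0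
  · subst hw
    simp [xv, lossX]
  have hpos : 0 < w ⬝ᵥ w :=
    lt_of_le_of_ne (dot_nn w) (Ne.symm (by simpa [dotProduct_self_eq_zero] using hw))
  set ρ := Real.sqrt (w ⬝ᵥ w) with hρ
  have hρ0 : 0 < ρ := Real.sqrt_pos.mpr hpos
  have hρρ : ρ * ρ = w ⬝ᵥ w := Real.mul_self_sqrt hpos.le
  set a := ρ⁻¹ • w with ha
  have haa : a ⬝ᵥ a = 1 := by
    rw [ha, dotProduct_smul, smul_dotProduct, ← hρρ, smul_eq_mul, smul_eq_mul]; field_simp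
  have hwa : w = ρ • a := by rw [ha, smul_smul, mul_inv_cancel₀ hρ0.ne', one_smul]
  rw [← GG_col a haa]
  swap
  · exact (meas_loss d μ _ meas_mat (fun _ => w) (fun _ => measurable_const)).ennreal_ofReal
  calc _ ≤ ∫⁻ _, ENNReal.ofReal (Real.sqrt (2 / Real.pi) * (μ * ρ)) ∂(GG (Fin n × Fin k)) := by
        apply lintegral_mono
        intro ω
        obtain ⟨m, M, hM⟩ := loss_core d μ ρ hρ0 (mat ω - Matrix.vecMulVec (mat ω *ᵥ a) a) a haa
          (by rw [Matrix.sub_mulVec, Matrix.vecMulVec_mulVec, haa]; funext i; simp)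
        refine le_trans (lintegral_mono fun z => ?_) (core_lemma M (μ * ρ) (by positivity))
        have := hM z
        rw [← hwa] at this
        exact this
    _ = _ := by simp

theorem row_loss_exp {n k : ℕ} (lam : Fin n → ℝ) (i : Fin n) (hl : 0 ≤ lam i) :
    ∫⁻ ω, ENNReal.ofReal (lossX (trunc i lam) (lam i) (xv (trunc i lam) (mat ω) (mat ω i))) ∂(GG (Fin n × Fin k)) ≤
      ENNReal.ofReal (Real.sqrt (2 / Real.pi) * lam i) * ∫⁻ w, ENNReal.ofReal (Real.sqrt (w ⬝ᵥ w)) ∂(GG (Fin k)) := by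
  have hm1 : Measurable fun w : Fin k → ℝ => Real.sqrt (w ⬝ᵥ w) := by
    apply Continuous.measurable; fun_prop
  rw [← GG_row i]
  swap
  · exact (meas_loss _ _ _ meas_mat (fun ω => mat ω i) (fun j => meas_mat i j)).ennreal_ofReal
  have e : ∀ (ω : Fin n × Fin k → ℝ) w, lossX (trunc i lam) (lam i) (xv (trunc i lam) (mat (setrow i w ω)) (mat (setrow i w ω) i)) =
      lossX (trunc i lam) (lam i) (xv (trunc i lam) (mat ω) w) := by
    intro ω w
    have h1 : mat (setrow i w ω) i = w := by
      funext b; rw [mat_setrow, if_pos rfl]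
    have h2 : Matrix.diagonal (trunc i lam) * mat (setrow i w ω) = Matrix.diagonal (trunc i lam) * mat ω := by
      ext a b
      rw [Matrix.diagonal_mul, Matrix.diagonal_mul, mat_setrow]
      split_ifs with h
      · subst h; simp [trunc]
      · rfl
    rw [xv, h1, h2]; rfl
  simp only [e]
  rw [lintegral_lintegral_swap]
  · rw [← lintegral_const_mul _ hm1.ennreal_ofReal]
    apply lintegral_mono
    intro w
    refine (loss_exp (trunc i lam) (lam i) hl w).trans (le_of_eq ?_)
    beta_reduce
    rw [← ENNReal.ofReal_mul (by positivity), mul_assoc]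
  · apply Measurable.aemeasurable
    apply Measurable.ennreal_ofReal
    refine meas_loss _ _ (fun p : (Fin n × Fin k → ℝ) × (Fin k → ℝ) => mat p.1) ?_ (fun p => p.2) ?_
    · intro a b; exact (meas_mat a b).comp measurable_fst
    · intro j; exact (measurable_pi_apply j).comp measurable_snd


theorem E_norm_le {k : ℕ} (hk : 0 < k) :
    ∫⁻ w, ENNReal.ofReal (Real.sqrt (w ⬝ᵥ w)) ∂(GG (Fin k)) ≤ ENNReal.ofReal (Real.sqrt k) := by
  have hk' : (0:ℝ) < k := by exact_mod_cast hk
  set s := Real.sqrt k with hs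
  have hs0 : 0 < s := Real.sqrt_pos.mpr hk'
  have hss : s * s = k := Real.mul_self_sqrt hk'.le
  have hm1 : Measurable fun w : Fin k → ℝ => ENNReal.ofReal (w ⬝ᵥ w) := by
    apply Measurable.ennreal_ofReal
    apply Continuous.measurable; fun_prop
  calc _ ≤ ∫⁻ w, (ENNReal.ofReal (1 / (2 * s)) * ENNReal.ofReal (w ⬝ᵥ w) + ENNReal.ofReal (s / 2)) ∂(GG (Fin k)) := by
        apply lintegral_mono
        intro w
        beta_reduce
        rw [← ENNReal.ofReal_mul (by positivity), ← ENNReal.ofReal_add (mul_nonneg (by positivity) (dot_nn w)) (by positivity)]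
        apply ENNReal.ofReal_le_ofReal
        have h1 := Real.mul_self_sqrt (dot_nn w)
        set y := Real.sqrt (w ⬝ᵥ w)
        rw [← h1]
        have : 1 / (2 * s) * (y * y) + s / 2 - y = (y - s) ^ 2 / (2 * s) := by
          field_simp; ring
        have h2 : 0 ≤ (y - s) ^ 2 / (2 * s) := by positivity
        linarith
    _ = ENNReal.ofReal s := by
        rw [lintegral_add_right _ measurable_const, lintegral_const_mul _ hm1, lint_dot_self, lintegral_const, measure_univ, mul_one,
          ← ENNReal.ofReal_mul (by positivity), ← ENNReal.ofReal_add (by positivity) (by positivity)]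
        congr 1
        rw [Fintype.card_fin, ← hss]
        field_simp; ring

theorem E_norm_one :
    ∫⁻ w, ENNReal.ofReal (Real.sqrt (w ⬝ᵥ w)) ∂(GG (Fin 1)) = ENNReal.ofReal (Real.sqrt (2 / Real.pi)) := by
  have h := lint_dot_abs (fun _ : Fin 1 => (1:ℝ))
  have h2 : ∀ w : Fin 1 → ℝ, Real.sqrt (w ⬝ᵥ w) = |(fun _ : Fin 1 => (1:ℝ)) ⬝ᵥ w| := by
    intro w
    simp [dotProduct, Real.sqrt_mul_self_eq_abs]
  simp only [h2]
  rw [h]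
  simp [dotProduct]

theorem E_norm_bound {k l : ℕ} (hk : 0 < k) (hl : l = k ∨ l = k + 1) :
    ENNReal.ofReal (Real.sqrt (2 / Real.pi)) * ∫⁻ w, ENNReal.ofReal (Real.sqrt (w ⬝ᵥ w)) ∂(GG (Fin k)) ≤
      ENNReal.ofReal ((k:ℝ) / Real.sqrt l) := by
  have hk' : (1:ℝ) ≤ k := by exact_mod_cast hk
  have hpi := Real.pi_gt_three
  have hl0 : (0:ℝ) < l := by
    rcases hl with h | h <;> rw [h] <;> push_cast <;> linarith
  have h23 : 2 / Real.pi ≤ 2 / 3 := by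
    apply div_le_div_of_nonneg_left <;> linarith
  by_cases h1 : k = 1 ∧ l = 2
  · obtain ⟨rfl, rfl⟩ := h1
    rw [E_norm_one, ← ENNReal.ofReal_mul (by positivity), Real.mul_self_sqrt (by positivity)]
    apply ENNReal.ofReal_le_ofReal
    rw [le_div_iff₀ (by positivity)]
    have : Real.sqrt ((2:ℕ):ℝ) ≤ 3 / 2 := by
      rw [Real.sqrt_le_left (by norm_num)]; norm_num
    have h4 : 0 ≤ Real.sqrt ((2:ℕ):ℝ) := Real.sqrt_nonneg _
    have h5 : 0 ≤ 2 / Real.pi := by positivity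
    push_cast at *
    nlinarith
  · calc _ ≤ ENNReal.ofReal (Real.sqrt (2 / Real.pi)) * ENNReal.ofReal (Real.sqrt k) := by
          gcongr; exact E_norm_le hk
      _ ≤ _ := by
          rw [← ENNReal.ofReal_mul (by positivity), ← Real.sqrt_mul (by positivity)]
          apply ENNReal.ofReal_le_ofReal
          rw [le_div_iff₀ (by positivity), ← Real.sqrt_mul (by positivity), Real.sqrt_le_left (by positivity)]
          have h3 : 2 * (l:ℝ) ≤ 3 * k := by
            have : 2 * l ≤ 3 * k := by omega
            exact_mod_cast this
          have h5 : 0 ≤ 2 / Real.pi := by positivity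
          have h6 : 2 / Real.pi * l ≤ k := by nlinarith
          nlinarith

theorem ofReal_sum_le' {ι : Type*} (s : Finset ι) (f : ι → ℝ) :
    ENNReal.ofReal (∑ i ∈ s, f i) ≤ ∑ i ∈ s, ENNReal.ofReal (f i) := by
  induction s using Finset.induction_on with
  | empty => simp
  | insert a s ha ih =>
    rw [Finset.sum_insert ha, Finset.sum_insert ha]
    exact ENNReal.ofReal_add_le.trans (by gcongr)

theorem row_loss_exp' {n k l : ℕ} (hkl : k ≤ l) (lam : Fin n → ℝ) (i : Fin n) (hl : 0 ≤ lam i) :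
    ∫⁻ ω, ENNReal.ofReal (lossX (trunc i lam) (lam i)
      (xv (trunc i lam) ((mat ω).submatrix id (Fin.castLE hkl)) ((mat ω).submatrix id (Fin.castLE hkl) i))) ∂(GG (Fin n × Fin l)) ≤
      ENNReal.ofReal (Real.sqrt (2 / Real.pi) * lam i) * ∫⁻ w, ENNReal.ofReal (Real.sqrt (w ⬝ᵥ w)) ∂(GG (Fin k)) := by
  have h1 : ∀ (x : Fin n × Fin l → ℝ) (y : Fin n × Fin k → ℝ), (fun z : Fin n × Fin k => x (z.1, Fin.castLE hkl z.2)) ⬝ᵥ y =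
      x ⬝ᵥ (fun z : Fin n × Fin l => if h : (z.2:ℕ) < k then y (z.1, ⟨z.2, h⟩) else 0) := by
    intro x y
    simp only [dotProduct, Fintype.sum_prod_type]
    refine Finset.sum_congr rfl fun a _ => ?_
    have : Function.Injective (Fin.castLE hkl) := Fin.castLE_injective _
    rw [← Finset.sum_subset (Finset.subset_univ (Finset.univ.map ⟨_, this⟩))]
    · rw [Finset.sum_map]
      refine Finset.sum_congr rfl fun b _ => ?_
      simp
    · intro b _ hb
      rw [dif_neg, mul_zero]
      intro h
      apply hb
      simp only [Finset.mem_map, Finset.mem_univ, true_and]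
      exact ⟨⟨b, h⟩, rfl⟩
  have h2 : ∀ (y : Fin n × Fin k → ℝ), (fun z : Fin n × Fin k =>
      (fun z : Fin n × Fin l => if h : (z.2:ℕ) < k then y (z.1, ⟨z.2, h⟩) else 0) (z.1, Fin.castLE hkl z.2)) = y := by
    intro y; funext z; simp
  have h3 := GG_lint_adj _ _ h1 h2 (fun ω => ENNReal.ofReal (lossX (trunc i lam) (lam i) (xv (trunc i lam) (mat ω) (mat ω i))))
    (meas_loss _ _ _ meas_mat (fun ω => mat ω i) (fun j => meas_mat i j)).ennreal_ofReal
  exact h3.le.trans (row_loss_exp lam i hl)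

theorem caseB {n k l : ℕ} (hk : 0 < k) (hkn : k < n) (hkl : k ≤ l) (hl : l = k ∨ l = k + 1)
    (lam : Fin n → ℝ) (hl0 : ∀ j, 0 ≤ lam j)
    (hpos : ∀ j : Fin n, (j:ℕ) < l → 0 < lam j) : GoodBound (k := k) (l := l) hkn lam := by
  have hms : ∀ i : Fin n, Measurable fun ω : Fin n × Fin l → ℝ => lossX (trunc i lam) (lam i)
      (xv (trunc i lam) ((mat ω).submatrix id (Fin.castLE hkl)) ((mat ω).submatrix id (Fin.castLE hkl) i)) := by
    intro i
    exact meas_loss _ _ (fun ω : Fin n × Fin l → ℝ => (mat ω).submatrix id (Fin.castLE hkl)) (fun a b => meas_mat a _)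
      (fun ω => (mat ω).submatrix id (Fin.castLE hkl) i) (fun j => meas_mat i _)
  refine ⟨fun ω => ∑ i : Fin n, if (i:ℕ) < k then 0 else lossX (trunc i lam) (lam i)
      (xv (trunc i lam) ((mat ω).submatrix id (Fin.castLE hkl)) ((mat ω).submatrix id (Fin.castLE hkl) i)), ?_, ?_, ?_⟩
  · refine Finset.measurable_sum _ fun i _ => ?_
    split_ifs
    · exact measurable_const
    · exact hms i
  · filter_upwards [ae_submat_det_ne_zero (n := n) (l := l) (p := k) (Fin.castLE hkn.le) (Fin.castLE hkl) (Fin.castLE_injective _)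
        (Fin.castLE_injective _)] with ω h
    obtain ⟨B, hB1, hB2⟩ := chain hkn lam (fun j hj => hpos j (by omega)) ((mat ω).submatrix id (Fin.castLE hkl)) h n hkn.le le_rfl
    have ht : trunc n lam = lam := by
      funext j; simp [trunc]
    rw [ht] at hB1 hB2
    have he : Matrix.diagonal lam * mat ω * ((1 : Matrix (Fin l) (Fin l) ℝ).submatrix id (Fin.castLE hkl) * B) =
        Matrix.diagonal lam * (mat ω).submatrix id (Fin.castLE hkl) * B := by
      rw [← Matrix.mul_assoc, Matrix.mul_assoc (Matrix.diagonal lam)]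
      congr 2
      ext a b
      simp [Matrix.mul_apply, Matrix.one_apply]
    refine ⟨(1 : Matrix (Fin l) (Fin l) ℝ).submatrix id (Fin.castLE hkl) * B, ?_, ?_⟩
    · rw [he]; exact Contr.of_iso hB1
    · rw [he]
      refine hB2.trans (le_of_eq ?_)
      refine Finset.sum_congr rfl fun i _ => ?_
      simp
  · have hc : 0 ≤ (k:ℝ) / Real.sqrt l := by positivity
    calc _ ≤ ∫⁻ ω, ∑ i : Fin n, ENNReal.ofReal (if (i:ℕ) < k then 0 else lossX (trunc i lam) (lam i)
          (xv (trunc i lam) ((mat ω).submatrix id (Fin.castLE hkl)) ((mat ω).submatrix id (Fin.castLE hkl) i)))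
            ∂(GG (Fin n × Fin l)) := lintegral_mono fun ω => ofReal_sum_le' _ _
      _ = ∑ i : Fin n, ∫⁻ ω, ENNReal.ofReal (if (i:ℕ) < k then 0 else lossX (trunc i lam) (lam i)
          (xv (trunc i lam) ((mat ω).submatrix id (Fin.castLE hkl)) ((mat ω).submatrix id (Fin.castLE hkl) i)))
            ∂(GG (Fin n × Fin l)) := by
          refine lintegral_finsetSum _ fun i _ => Measurable.ennreal_ofReal ?_
          split_ifs
          · exact measurable_const
          · exact hms i
      _ ≤ ∑ i : Fin n, ENNReal.ofReal ((k:ℝ) / Real.sqrt l * (if (i:ℕ) < k then 0 else lam i)) := by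
          refine Finset.sum_le_sum fun i _ => ?_
          split_ifs
          · simp
          · refine (row_loss_exp' hkl lam i (hl0 i)).trans ?_
            rw [ENNReal.ofReal_mul (by positivity), mul_right_comm, ENNReal.ofReal_mul hc]
            gcongr
            exact E_norm_bound hk hl
      _ = _ := by
          rw [← ENNReal.ofReal_sum_of_nonneg, ← Finset.mul_sum]
          · rfl
          · intro i _
            apply mul_nonneg hc
            split_ifs
            · exact le_rfl
            · exact hl0 i



/-- Accuracy of the randomized approximation of the initial
spectral shifting term.  The expectation over the i.i.d. standard Gaussian
matrix `Ω` (encoded as `ω : Fin n × Fin l → ℝ` with product Gaussian measure)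
is expressed as a lower Lebesgue integral. -/
theorem approximate_delta_bar_bound {n l k : ℕ} (hk : 0 < k) (hkl : k ≤ l) (hkn : k < n)
    (K : Matrix (Fin n) (Fin n) ℝ) (hK : K.PosSemidef)
    (hrk : k < K.rank) (hrl : l ≤ K.rank)
    (δbar : ℝ)
    (hδbar : δbar = (K.trace - ∑ j : Fin k, svalsDesc K (Fin.castLE hkn.le j)) / ((n : ℝ) - k))
    (Q : ((Fin n × Fin l) → ℝ) → Matrix (Fin n) (Fin l) ℝ)
    (hQ : ∀ ω : (Fin n × Fin l) → ℝ,
        (K * Matrix.of fun i j => ω (i, j)).rank = l →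
          (Q ω)ᵀ * Q ω = 1 ∧
            LinearMap.range (Q ω).mulVecLin =
              LinearMap.range (K * Matrix.of fun i j => ω (i, j)).mulVecLin)
    (δtil : ((Fin n × Fin l) → ℝ) → ℝ)
    (hδtil : ∀ ω, δtil ω =
        (K.trace - ∑ j : Fin k, svalsDesc ((Q ω)ᵀ * K) (Fin.castLE hkn.le j)) / ((n : ℝ) - k)) :
    ∫⁻ ω, ENNReal.ofReal (|δbar - δtil ω| / δbar)
        ∂(Measure.pi fun _ : Fin n × Fin l => gaussianReal 0 1) ≤
      ENNReal.ofReal ((k : ℝ) / Real.sqrt l) := by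
  exact main_of_good hkl hkn K hK hrl (fun lam hln _ h2 h3 => by
    by_cases h : k + 2 ≤ l
    · exact caseA hk hkn h hln lam h2 h3
    · exact caseB hk hkn hkl (by omega) lam h2 h3) δbar hδbar Q hQ δtil hδtil
end

section
/- Let K be an n×n real symmetric positive semidefinite matrix, let k < n, and let δ̄ = (1/(n−k))(tr(K) − Σ_{j=1}^k σ_j(K)). Then for every δ ∈ (0, δ̄], setting K̄ = K − δ I_n, one has ‖K̄ − K̄_k‖_F² ≤ ‖K − K_k‖_F². -/
open Matrix BigOperators
open scoped Classical

lemma frobSq_eq_trace {n : ℕ} (A : Matrix (Fin n) (Fin n) ℝ) :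
    frobSq A = (Aᵀ * A).trace := by
  simp only [frobSq, Matrix.trace, Matrix.diag, Matrix.mul_apply, Matrix.transpose_apply]
  rw [Finset.sum_comm]
  simp only [sq]

lemma frobSq_nonneg' {n : ℕ} (A : Matrix (Fin n) (Fin n) ℝ) : 0 ≤ frobSq A :=
  Finset.sum_nonneg fun _ _ => Finset.sum_nonneg fun _ _ => sq_nonneg _

lemma frobSq_conj {n : ℕ} (A P : Matrix (Fin n) (Fin n) ℝ) (h : P * Pᵀ = 1) :
    frobSq (Pᵀ * A * P) = frobSq A := by
  rw [frobSq_eq_trace, frobSq_eq_trace]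
  have : (Pᵀ * A * P)ᵀ * (Pᵀ * A * P) = Pᵀ * (Aᵀ * A * P) := by
    simp only [Matrix.transpose_mul, Matrix.transpose_transpose]
    calc _ = Pᵀ * (Aᵀ * (P * Pᵀ) * A * P) := by simp only [Matrix.mul_assoc]
      _ = _ := by rw [h]; simp only [Matrix.mul_assoc, Matrix.mul_one]
  rw [this, Matrix.trace_mul_comm, Matrix.mul_assoc, h, Matrix.mul_one]

lemma exists_spectral {n : ℕ} (A : Matrix (Fin n) (Fin n) ℝ) (hA : A.IsHermitian) :
    ∃ V : Matrix (Fin n) (Fin n) ℝ, V * Vᵀ = 1 ∧ Vᵀ * V = 1 ∧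
      A = V * diagonal hA.eigenvalues * Vᵀ := by
  refine ⟨hA.eigenvectorUnitary, ?_, ?_, ?_⟩
  · have := Unitary.coe_mul_star_self hA.eigenvectorUnitary
    rwa [Unitary.coe_star, Matrix.star_eq_conjTranspose, Matrix.conjTranspose_eq_transpose_of_trivial] at this
  · have := Unitary.coe_star_mul_self hA.eigenvectorUnitary
    rwa [Matrix.star_eq_conjTranspose, Matrix.conjTranspose_eq_transpose_of_trivial] at this
  · have := hA.spectral_theorem
    rw [Unitary.conjStarAlgAut_apply, Matrix.star_eq_conjTranspose,
      Matrix.conjTranspose_eq_transpose_of_trivial] at this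
    exact this

/-- Orthogonal projection onto the column space. -/
lemma exists_proj {n : ℕ} (A : Matrix (Fin n) (Fin n) ℝ) :
    ∃ Q : Matrix (Fin n) (Fin n) ℝ, Qᵀ = Q ∧ Q * Q = Q ∧ Q * A = A ∧ Q.trace = A.rank := by
  have hH : (A * Aᵀ).IsHermitian := by
    have := Matrix.isHermitian_mul_conjTranspose_self A
    rwa [Matrix.conjTranspose_eq_transpose_of_trivial] at this
  obtain ⟨V, h1, h2, h3⟩ := exists_spectral _ hH
  set μ := hH.eigenvalues with hμ
  set e : Fin n → ℝ := fun i => if μ i ≠ 0 then 1 else 0 with he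
  have hee : diagonal e * diagonal e = diagonal e := by
    rw [Matrix.diagonal_mul_diagonal]; congr 1; ext i; simp [he]
  have hem : diagonal e * diagonal μ = diagonal μ := by
    rw [Matrix.diagonal_mul_diagonal]; congr 1; ext i; simp only [he]; split_ifs with h <;> simp_all
  have hQT : (V * diagonal e * Vᵀ)ᵀ = V * diagonal e * Vᵀ := by
    simp [Matrix.transpose_mul, Matrix.mul_assoc]
  have hQA : (V * diagonal e * Vᵀ) * (A * Aᵀ) = A * Aᵀ := by
    rw [h3]
    calc _ = V * (diagonal e * (Vᵀ * V) * diagonal μ) * Vᵀ := by simp only [Matrix.mul_assoc]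
      _ = _ := by rw [h2, Matrix.mul_one, hem]
  refine ⟨V * diagonal e * Vᵀ, hQT, ?_, ?_, ?_⟩
  · calc _ = V * (diagonal e * (Vᵀ * V) * diagonal e) * Vᵀ := by simp only [Matrix.mul_assoc]
      _ = _ := by rw [h2, Matrix.mul_one, hee]
  · set Q := V * diagonal e * Vᵀ
    have : (Q * A - A) * (Q * A - A)ᴴ = 0 := by
      rw [Matrix.conjTranspose_eq_transpose_of_trivial, Matrix.transpose_sub,
        Matrix.transpose_mul, hQT]
      have h4 : Q * A - A = (Q - 1) * A := by rw [Matrix.sub_mul, Matrix.one_mul]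
      have h5 : Aᵀ * Q - Aᵀ = Aᵀ * (Q - 1) := by rw [Matrix.mul_sub, Matrix.mul_one]
      rw [h4, h5, Matrix.mul_assoc, ← Matrix.mul_assoc A, ← Matrix.mul_assoc, Matrix.sub_mul, hQA]
      simp
    rw [Matrix.self_mul_conjTranspose_eq_zero] at this
    exact sub_eq_zero.mp this
  · rw [Matrix.trace_mul_comm, ← Matrix.mul_assoc, h2, Matrix.one_mul, Matrix.trace_diagonal,
      ← Matrix.rank_self_mul_transpose, hH.rank_eq_card_non_zero_eigs, Fintype.card_subtype]
    simp only [he, hμ, Finset.sum_boole]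

lemma kyfan_sum {n k : ℕ} (hkn : k < n) (d q : Fin n → ℝ) (hd : Antitone d) (hd0 : ∀ i, 0 ≤ d i)
    (hq0 : ∀ i, 0 ≤ q i) (hq1 : ∀ i, q i ≤ 1) (hq : ∑ i, q i ≤ k) :
    (∑ i : Fin n, if (i : ℕ) < k then 0 else d i) ≤ ∑ i, d i * (1 - q i) := by
  set c := d ⟨k, hkn⟩
  have key : ∀ i : Fin n, c * ((if (i : ℕ) < k then 1 else 0) - q i) ≤
      d i * (1 - q i) - (if (i : ℕ) < k then 0 else d i) := by
    intro i
    split_ifs with h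
    · have : c ≤ d i := hd (by rw [Fin.le_def]; exact h.le)
      nlinarith [hq1 i]
    · have : d i ≤ c := hd (by rw [Fin.le_def]; simpa using h)
      nlinarith [hq0 i]
  have hs := Finset.sum_le_sum fun i (_ : i ∈ Finset.univ) => key i
  rw [← Finset.mul_sum, Finset.sum_sub_distrib, Finset.sum_sub_distrib] at hs
  have hk : (∑ i : Fin n, if (i : ℕ) < k then (1:ℝ) else 0) = k := by
    rw [Fin.sum_univ_eq_sum_range (fun i => if i < k then (1:ℝ) else 0), Finset.sum_boole]
    have : (Finset.range n).filter (· < k) = Finset.range k := by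
      ext; simp; omega
    rw [this]; simp
  rw [hk] at hs
  have : 0 ≤ c * (k - ∑ i, q i) := mul_nonneg (hd0 _) (by linarith)
  linarith

lemma eckart_young {n k : ℕ} (hkn : k < n) (s : Fin n → ℝ) (hs : Antitone s) (hs0 : ∀ i, 0 ≤ s i)
    (A : Matrix (Fin n) (Fin n) ℝ) (hA : A.rank ≤ k) :
    (∑ i : Fin n, if (i : ℕ) < k then 0 else s i ^ 2) ≤ frobSq (diagonal s - A) := by
  obtain ⟨Q, hT, hQ, hQA, htr⟩ := exists_proj A
  have hd : ∀ i, Q i i = ∑ j, Q i j ^ 2 := by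
    intro i
    conv_lhs => rw [← hQ, Matrix.mul_apply]
    refine Finset.sum_congr rfl fun j _ => ?_
    rw [sq, ← Matrix.transpose_apply Q i j, hT]
  have hq0 : ∀ i, 0 ≤ Q i i := fun i => by
    rw [hd]; exact Finset.sum_nonneg fun _ _ => sq_nonneg _
  have hq1 : ∀ i, Q i i ≤ 1 := fun i => by
    have : Q i i ^ 2 ≤ Q i i := by
      conv_rhs => rw [hd]
      exact Finset.single_le_sum (f := fun j => Q i j ^ 2) (fun _ _ => sq_nonneg _)
        (Finset.mem_univ i)
    nlinarith
  have hsum : ∑ i, Q i i ≤ k := by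
    have : ∑ i, Q i i = A.rank := htr
    rw [this]; exact_mod_cast hA
  refine (kyfan_sum hkn (fun i => s i ^ 2) (fun i => Q i i)
    (fun i j h => pow_le_pow_left₀ (hs0 _) (hs h) 2) (fun i => sq_nonneg _) hq0 hq1 hsum).trans ?_
  set B := diagonal s - A with hB
  have h1 : frobSq B = frobSq (Q * B) + frobSq (B - Q * B) := by
    simp only [frobSq_eq_trace, Matrix.transpose_mul, Matrix.transpose_sub, hT,
      Matrix.sub_mul, Matrix.mul_sub]
    have e1 : Bᵀ * Q * (Q * B) = Bᵀ * Q * B := by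
      rw [Matrix.mul_assoc, ← Matrix.mul_assoc Q Q, hQ, ← Matrix.mul_assoc]
    rw [e1, ← Matrix.mul_assoc]
    simp [Matrix.trace_sub]
  have h2 : B - Q * B = diagonal s - Q * diagonal s := by
    rw [hB, Matrix.mul_sub, hQA]; abel
  have h3 : frobSq (diagonal s - Q * diagonal s) = ∑ i, s i ^ 2 * (1 - Q i i) := by
    simp only [frobSq_eq_trace, Matrix.transpose_mul, Matrix.transpose_sub, hT,
      Matrix.sub_mul, Matrix.mul_sub, Matrix.diagonal_transpose]
    have e1 : diagonal s * Q * (Q * diagonal s) = diagonal s * Q * diagonal s := by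
      rw [Matrix.mul_assoc, ← Matrix.mul_assoc Q Q, hQ, ← Matrix.mul_assoc]
    rw [e1, ← Matrix.mul_assoc]
    simp only [sub_self, sub_zero, Matrix.trace_sub, Matrix.diagonal_mul_diagonal,
      Matrix.trace_diagonal]
    simp only [Matrix.trace, Matrix.diag, Matrix.mul_diagonal, Matrix.diagonal_mul]
    rw [← Finset.sum_sub_distrib]
    exact Finset.sum_congr rfl fun i _ => by ring
  rw [h1, h2, h3]
  linarith [frobSq_nonneg' (Q * B)]

open scoped MatrixOrder Matrix.Norms.L2Operator in
lemma psd_sqrt_unique {n : ℕ} (A B : Matrix (Fin n) (Fin n) ℝ) (hA : A.PosSemidef)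
    (hB : B.PosSemidef) (h : A * A = B * B) : A = B := by
  have h1 := CFC.sqrt_unique h (Matrix.nonneg_iff_posSemidef.mpr hA)
  have h2 := CFC.sqrt_unique rfl (Matrix.nonneg_iff_posSemidef.mpr hB)
  exact h1.symm.trans h2

lemma svals_diag {n : ℕ} (K : Matrix (Fin n) (Fin n) ℝ) (hK : K.PosSemidef) :
    Antitone (svalsDesc K) ∧ (∀ i, 0 ≤ svalsDesc K i) ∧
    ∃ P : Matrix (Fin n) (Fin n) ℝ, P * Pᵀ = 1 ∧ Pᵀ * P = 1 ∧
      K = P * diagonal (svalsDesc K) * Pᵀ := by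
  have hP : (Kᵀ * K).PosSemidef := by
    have := Matrix.posSemidef_conjTranspose_mul_self K
    rwa [Matrix.conjTranspose_eq_transpose_of_trivial] at this
  have hH : (Kᵀ * K).IsHermitian := hP.1
  have hKT : Kᵀ = K := by
    have := hK.1
    rwa [Matrix.IsHermitian, Matrix.conjTranspose_eq_transpose_of_trivial] at this
  set σ := Tuple.sort (fun j => -hH.eigenvalues j) with hσ
  have hs : svalsDesc K = fun i => Real.sqrt (hH.eigenvalues (σ i)) := by
    ext i; simp only [svalsDesc, eigsDesc, dif_pos hH]; rfl
  refine ⟨?_, ?_, ?_⟩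
  · rw [hs]; intro i j hij
    have := Tuple.monotone_sort (fun j => -hH.eigenvalues j) hij
    simp only [Function.comp] at this
    exact Real.sqrt_le_sqrt (neg_le_neg_iff.mp this)
  · rw [hs]; intro i; exact Real.sqrt_nonneg _
  · obtain ⟨V, h1, h2, h3⟩ := exists_spectral _ hH
    have hKV : K = V * diagonal (fun i => Real.sqrt (hH.eigenvalues i)) * Vᵀ := by
      apply psd_sqrt_unique _ _ hK
      · have := (Matrix.PosSemidef.diagonal
          (fun i => Real.sqrt_nonneg (hH.eigenvalues i))).mul_mul_conjTranspose_same V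
        rwa [Matrix.conjTranspose_eq_transpose_of_trivial] at this
      · set D := diagonal (fun i => Real.sqrt (hH.eigenvalues i)) with hD
        have hDD : D * D = diagonal hH.eigenvalues := by
          rw [hD, Matrix.diagonal_mul_diagonal]; congr 1; ext i
          exact Real.mul_self_sqrt (hP.eigenvalues_nonneg i)
        calc K * K = Kᵀ * K := by rw [hKT]
          _ = V * diagonal hH.eigenvalues * Vᵀ := h3
          _ = V * (D * (Vᵀ * V) * D) * Vᵀ := by rw [h2, Matrix.mul_one, hDD]
          _ = _ := by simp only [Matrix.mul_assoc]
    refine ⟨V.submatrix id σ, ?_, ?_, ?_⟩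
    · rw [Matrix.transpose_submatrix, Matrix.submatrix_mul_equiv, h1]; simp
    · rw [Matrix.transpose_submatrix, ← Matrix.submatrix_mul _ _ _ _ _ Function.bijective_id, h2]
      simp
    · have : diagonal (svalsDesc K) =
          (diagonal (fun i => Real.sqrt (hH.eigenvalues i))).submatrix σ σ := by
        rw [Matrix.submatrix_diagonal_equiv, hs]; rfl
      rw [this, Matrix.transpose_submatrix, Matrix.submatrix_mul_equiv,
        Matrix.submatrix_mul_equiv, ← hKV]; simp

/-- Spectral shifting by any `δ ∈ (0, δ̄]` does not increase the
optimal rank-`k` Frobenius approximation error. -/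
theorem spectral_shift_tail_decrease {n k : ℕ} (hkn : k < n)
    (K : Matrix (Fin n) (Fin n) ℝ) (hK : K.PosSemidef)
    (δbar : ℝ)
    (hδbar : δbar = (K.trace - ∑ j : Fin k, svalsDesc K (Fin.castLE hkn.le j)) / ((n : ℝ) - k))
    (δ : ℝ) (hδ0 : 0 < δ) (hδ1 : δ ≤ δbar)
    (Kbar : Matrix (Fin n) (Fin n) ℝ) (hKbar : Kbar = K - δ • (1 : Matrix (Fin n) (Fin n) ℝ))
    (Kbark Kk : Matrix (Fin n) (Fin n) ℝ)
    (hKbark : IsBestRankApprox Kbar Kbark k) (hKk : IsBestRankApprox K Kk k) :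
    frobSq (Kbar - Kbark) ≤ frobSq (K - Kk) := by
  obtain ⟨hanti, hnn, P, hP1, hP2, hKP⟩ := svals_diag K hK
  set s := svalsDesc K with hs
  have hnk : (0:ℝ) < (n:ℝ) - k := by
    have : (k:ℝ) < n := by exact_mod_cast hkn
    linarith
  -- lower bound for the error of `Kk`
  have hlow : (∑ i : Fin n, if (i : ℕ) < k then 0 else s i ^ 2) ≤ frobSq (K - Kk) := by
    rw [← frobSq_conj (K - Kk) P hP1, Matrix.mul_sub, Matrix.sub_mul]
    have h1 : Pᵀ * K * P = diagonal s := by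
      rw [hKP]
      calc _ = (Pᵀ * P) * diagonal s * (Pᵀ * P) := by simp only [Matrix.mul_assoc]
        _ = _ := by rw [hP2]; simp
    rw [h1]
    refine eckart_young hkn s hanti hnn _ ?_
    exact (Matrix.rank_mul_le_left _ _).trans ((Matrix.rank_mul_le_right _ _).trans hKk.1)
  -- upper bound for the error of `Kbark`
  set t : Fin n → ℝ := fun i => if (i : ℕ) < k then s i - δ else 0 with ht
  have hrank : (P * diagonal t * Pᵀ).rank ≤ k := by
    refine (Matrix.rank_mul_le_left _ _).trans ((Matrix.rank_mul_le_right _ _).trans ?_)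
    rw [Matrix.rank_diagonal]
    let f : {i // t i ≠ 0} → Fin k := fun i => ⟨i.1, by
      by_contra h
      exact i.2 (by simp only [ht]; rw [if_neg h])⟩
    have hf : Function.Injective f := by
      intro a b hab
      apply Subtype.ext
      apply Fin.ext
      exact Fin.mk.inj hab
    simpa using Fintype.card_le_of_injective f hf
  have hup : frobSq (Kbar - Kbark) ≤ ∑ i : Fin n, if (i : ℕ) < k then 0 else (s i - δ) ^ 2 := by
    refine (hKbark.2 _ hrank).trans (le_of_eq ?_)
    rw [← frobSq_conj _ P hP1]
    have h1 : Pᵀ * (Kbar - P * diagonal t * Pᵀ) * P =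
        diagonal (fun i : Fin n => if (i : ℕ) < k then 0 else s i - δ) := by
      have h2 : Kbar - P * diagonal t * Pᵀ =
          P * (diagonal s - δ • (1 : Matrix (Fin n) (Fin n) ℝ) - diagonal t) * Pᵀ := by
        rw [hKbar, hKP]
        simp only [Matrix.mul_sub, Matrix.sub_mul, Matrix.mul_smul, Matrix.smul_mul,
          Matrix.mul_one, hP1]
      rw [h2]
      calc _ = (Pᵀ * P) * (diagonal s - δ • (1 : Matrix (Fin n) (Fin n) ℝ) - diagonal t) *
            (Pᵀ * P) := by simp only [Matrix.mul_assoc]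
        _ = _ := by
          rw [hP2, Matrix.mul_one, Matrix.one_mul, Matrix.smul_one_eq_diagonal,
            Matrix.diagonal_sub, Matrix.diagonal_sub]
          congr 1
          ext i
          simp only [ht]
          split_ifs <;> ring
    rw [h1, frobSq_eq_trace, Matrix.diagonal_transpose, Matrix.diagonal_mul_diagonal,
      Matrix.trace_diagonal]
    refine Finset.sum_congr rfl fun i _ => ?_
    split_ifs <;> ring
  -- the tail sum
  have htr : K.trace = ∑ i, s i := by
    rw [hKP, Matrix.trace_mul_comm, ← Matrix.mul_assoc, hP2, Matrix.one_mul,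
      Matrix.trace_diagonal]
  have hsplit : ∀ g : Fin n → ℝ, ∑ j : Fin k, g (Fin.castLE hkn.le j) =
      ∑ i : Fin n, if (i : ℕ) < k then g i else 0 := by
    intro g
    rw [← Finset.sum_filter]
    refine Finset.sum_bij (fun j _ => Fin.castLE hkn.le j) ?_ ?_ ?_ ?_
    · intro j _; simp
    · intro a _ b _ h; exact Fin.castLE_injective _ h
    · intro b hb
      exact ⟨⟨b, by simpa using hb⟩, Finset.mem_univ _, rfl⟩
    · intro j _; rfl
  have htail : (∑ i : Fin n, if (i : ℕ) < k then 0 else s i) = δbar * ((n:ℝ) - k) := by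
    rw [hδbar, div_mul_cancel₀ _ hnk.ne', htr, hsplit, ← Finset.sum_sub_distrib]
    exact Finset.sum_congr rfl fun i _ => by split_ifs <;> simp
  have hcount : (∑ i : Fin n, if (i : ℕ) < k then (0:ℝ) else 1) = (n:ℝ) - k := by
    have h1 := hsplit (fun _ => 1)
    have h2 : (∑ i : Fin n, if (i : ℕ) < k then (0:ℝ) else 1) =
        ∑ i : Fin n, ((1:ℝ) - if (i : ℕ) < k then 1 else 0) :=
      Finset.sum_congr rfl fun i _ => by split_ifs <;> simp
    rw [h2, Finset.sum_sub_distrib, ← h1]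
    simp
  have hexp : (∑ i : Fin n, if (i : ℕ) < k then 0 else (s i - δ) ^ 2) =
      (∑ i : Fin n, if (i : ℕ) < k then 0 else s i ^ 2)
      - 2 * δ * (∑ i : Fin n, if (i : ℕ) < k then 0 else s i)
      + δ ^ 2 * (∑ i : Fin n, if (i : ℕ) < k then (0:ℝ) else 1) := by
    rw [Finset.mul_sum, Finset.mul_sum, ← Finset.sum_sub_distrib, ← Finset.sum_add_distrib]
    exact Finset.sum_congr rfl fun i _ => by split_ifs <;> ring
  rw [htail, hcount] at hexp
  have h1 : 0 ≤ δ * ((n:ℝ) - k) * (2 * δbar - δ) :=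
    mul_nonneg (mul_nonneg hδ0.le hnk.le) (by linarith)
  nlinarith
end

section
/- Let A and B be n×n real matrices, and let σ_A, σ_B ∈ R^n be the vectors of their singular values arranged in descending order. Then Σ_{i=1}^n (σ_i(A) − σ_i(B))² ≤ ‖A − B‖_F². -/
open Matrix BigOperators
open scoped Classical

lemma layer_repr {n : ℕ} (s : Fin n → ℝ) (hs : Antitone s) (h0 : ∀ i, 0 ≤ s i) :
    ∃ a : Fin n → ℝ, (∀ k, 0 ≤ a k) ∧ ∀ i, s i = ∑ k, a k * (if i ≤ k then 1 else 0) := by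
  let f : ℕ → ℝ := fun i => if h : i < n then s ⟨i, h⟩ else 0
  have hf : ∀ i : Fin n, f i = s i := fun i => by simp [f]
  have hfn : f n = 0 := by simp [f]
  refine ⟨fun k => f k - f (k + 1), fun k => ?_, fun i => ?_⟩
  · rw [sub_nonneg, hf]
    by_cases h : (k : ℕ) + 1 < n
    · have : f (k + 1) = s ⟨k + 1, h⟩ := by simp [f, h]
      rw [this]
      apply hs
      rw [Fin.le_def]
      simp
    · have : f (k + 1) = 0 := by simp [f, h]
      rw [this]
      exact h0 k
  · have key : ∀ m : ℕ, ∑ k ∈ Finset.range m, (f k - f (k + 1)) * (if (i : ℕ) ≤ k then 1 else 0)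
        = if (i : ℕ) ≤ m then f i - f m else 0 := by
      intro m
      induction m with
      | zero =>
        by_cases h : (i : ℕ) = 0 <;> simp [h]
      | succ m ih =>
        rw [Finset.sum_range_succ, ih]
        by_cases h : (i : ℕ) ≤ m
        · have h' : (i : ℕ) ≤ m + 1 := by omega
          simp [h, h']
        · by_cases h' : (i : ℕ) = m + 1
          · simp [h']
          · have h'' : ¬ (i : ℕ) ≤ m + 1 := by omega
            simp [h, h'']
    have h1 := key n
    rw [← Fin.sum_univ_eq_sum_range
      (fun k => (f k - f (k + 1)) * (if (i : ℕ) ≤ k then 1 else 0)) n] at h1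
    rw [if_pos i.2.le, hfn, sub_zero, hf] at h1
    rw [← h1]
    rfl

lemma substoch_bound {n : ℕ} (s t : Fin n → ℝ) (hs : Antitone s) (h0 : ∀ i, 0 ≤ s i)
    (ht : Antitone t) (ht0 : ∀ i, 0 ≤ t i) (M : Fin n → Fin n → ℝ) (hM : ∀ i j, 0 ≤ M i j)
    (hr : ∀ i, ∑ j, M i j ≤ 1) (hc : ∀ j, ∑ i, M i j ≤ 1) :
    ∑ i, ∑ j, s i * t j * M i j ≤ ∑ i, s i * t i := by
  obtain ⟨a, ha, hsa⟩ := layer_repr s hs h0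
  obtain ⟨b, hb, htb⟩ := layer_repr t ht ht0
  let e : Fin n → Fin n → ℝ := fun i k => if i ≤ k then 1 else 0
  have he0 : ∀ i k, 0 ≤ e i k := fun i k => by simp only [e]; split_ifs <;> norm_num
  have he1 : ∀ i k, e i k ≤ 1 := fun i k => by simp only [e]; split_ifs <;> norm_num
  have hL : ∑ i, ∑ j, s i * t j * M i j
      = ∑ k, ∑ l, a k * b l * ∑ i, ∑ j, e i k * e j l * M i j := by
    calc _ = ∑ i, ∑ j, ∑ k, ∑ l, a k * b l * (e i k * e j l * M i j) := by
            refine Finset.sum_congr rfl fun i _ => Finset.sum_congr rfl fun j _ => ?_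
            rw [hsa i, htb j, Finset.sum_mul_sum, Finset.sum_mul]
            refine Finset.sum_congr rfl fun k _ => ?_
            rw [Finset.sum_mul]
            refine Finset.sum_congr rfl fun l _ => ?_
            simp only [e]; ring
      _ = ∑ i, ∑ k, ∑ j, ∑ l, a k * b l * (e i k * e j l * M i j) :=
            Finset.sum_congr rfl fun i _ => Finset.sum_comm
      _ = ∑ k, ∑ i, ∑ l, ∑ j, a k * b l * (e i k * e j l * M i j) := by
            rw [Finset.sum_comm]
            exact Finset.sum_congr rfl fun k _ => Finset.sum_congr rfl fun i _ => Finset.sum_comm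
      _ = ∑ k, ∑ l, ∑ i, ∑ j, a k * b l * (e i k * e j l * M i j) :=
            Finset.sum_congr rfl fun i _ => Finset.sum_comm
      _ = _ := by simp only [Finset.mul_sum]
  have hR : ∑ i, s i * t i = ∑ k, ∑ l, a k * b l * ∑ i, e i k * e i l := by
    calc _ = ∑ i, ∑ k, ∑ l, a k * b l * (e i k * e i l) := by
            refine Finset.sum_congr rfl fun i _ => ?_
            rw [hsa i, htb i, Finset.sum_mul_sum]
            refine Finset.sum_congr rfl fun k _ => Finset.sum_congr rfl fun l _ => ?_
            simp only [e]; ring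
      _ = ∑ k, ∑ l, ∑ i, a k * b l * (e i k * e i l) := by
            rw [Finset.sum_comm]
            exact Finset.sum_congr rfl fun k _ => Finset.sum_comm
      _ = _ := by simp only [Finset.mul_sum]
  rw [hL, hR]
  refine Finset.sum_le_sum fun k _ => Finset.sum_le_sum fun l _ => ?_
  refine mul_le_mul_of_nonneg_left ?_ (mul_nonneg (ha k) (hb l))
  rcases le_total k l with hkl | hkl
  · refine Finset.sum_le_sum fun i _ => ?_
    have h2 : e i k * e i l = e i k := by
      simp only [e]
      by_cases h : i ≤ k
      · simp [h, h.trans hkl]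
      · simp [h]
    rw [h2]
    calc ∑ j, e i k * e j l * M i j ≤ ∑ j, e i k * M i j := by
          refine Finset.sum_le_sum fun j _ => ?_
          refine mul_le_mul_of_nonneg_right ?_ (hM i j)
          nlinarith [he0 i k, he1 j l]
      _ = e i k * ∑ j, M i j := by rw [Finset.mul_sum]
      _ ≤ e i k := by nlinarith [he0 i k, hr i]
  · rw [Finset.sum_comm]
    refine Finset.sum_le_sum fun i _ => ?_
    have h2 : e i k * e i l = e i l := by
      simp only [e]
      by_cases h : i ≤ l
      · simp [h, h.trans hkl]
      · simp [h]
    rw [h2]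
    calc ∑ j, e j k * e i l * M j i ≤ ∑ j, e i l * M j i := by
          refine Finset.sum_le_sum fun j _ => ?_
          refine mul_le_mul_of_nonneg_right ?_ (hM j i)
          nlinarith [he0 i l, he1 j k]
      _ = e i l * ∑ j, M j i := by rw [Finset.mul_sum]
      _ ≤ e i l := by nlinarith [he0 i l, hc i]

lemma gram_herm {n : ℕ} (A : Matrix (Fin n) (Fin n) ℝ) : (Aᵀ * A).IsHermitian := by
  have := Matrix.isHermitian_conjTranspose_mul_self A
  rwa [Matrix.conjTranspose_eq_transpose_of_trivial] at this

lemma svals_antitone {n : ℕ} (A : Matrix (Fin n) (Fin n) ℝ) : Antitone (svalsDesc A) := by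
  intro i j hij
  apply Real.sqrt_le_sqrt
  simp only [eigsDesc, dif_pos (gram_herm A)]
  have := Tuple.monotone_sort (fun j => -(gram_herm A).eigenvalues j) hij
  simpa using this

lemma exists_svd {n : ℕ} (A : Matrix (Fin n) (Fin n) ℝ) :
    ∃ (U V : Matrix (Fin n) (Fin n) ℝ) (d : Fin n → ℝ), Vᵀ * V = 1 ∧
      A = U * diagonal (svalsDesc A) * Vᵀ ∧ Uᵀ * U = diagonal d ∧ (∀ i, d i ≤ 1) ∧
      ∑ i, svalsDesc A i ^ 2 = (Aᵀ * A).trace := by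
  have hH := gram_herm A
  have hpos : (Aᵀ * A).PosSemidef := by
    have := Matrix.posSemidef_conjTranspose_mul_self A
    rwa [Matrix.conjTranspose_eq_transpose_of_trivial] at this
  set σ := Tuple.sort (fun j => -hH.eigenvalues j) with hσ
  set s := svalsDesc A with hsdef
  have hs : ∀ i, s i ^ 2 = hH.eigenvalues (σ i) := fun i => by
    simp only [hsdef, svalsDesc, eigsDesc, dif_pos hH]
    exact Real.sq_sqrt (hpos.eigenvalues_nonneg _)
  let E : Matrix (Fin n) (Fin n) ℝ := hH.eigenvectorUnitary
  have hE : Eᵀ * E = 1 := by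
    have := Unitary.coe_star_mul_self hH.eigenvectorUnitary
    rwa [Matrix.star_eq_conjTranspose, Matrix.conjTranspose_eq_transpose_of_trivial] at this
  have hspec : Aᵀ * A = E * diagonal hH.eigenvalues * Eᵀ := by
    have := hH.spectral_theorem
    rw [Unitary.conjStarAlgAut_apply, Matrix.star_eq_conjTranspose,
      Matrix.conjTranspose_eq_transpose_of_trivial] at this
    exact this
  have hdiag : Eᵀ * (Aᵀ * A) * E = diagonal hH.eigenvalues := by
    calc Eᵀ * (Aᵀ * A) * E = Eᵀ * (E * diagonal hH.eigenvalues * Eᵀ) * E :=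
          congrArg (fun X => Eᵀ * X * E) hspec
      _ = (Eᵀ * E) * diagonal hH.eigenvalues * (Eᵀ * E) := by simp only [Matrix.mul_assoc]
      _ = _ := by rw [hE]; simp
  let V := E.submatrix id σ
  have hV : Vᵀ * V = 1 := by
    have : Vᵀ * V = (Eᵀ * E).submatrix σ σ := by
      ext i j; simp [V, Matrix.mul_apply]
    rw [this, hE]
    exact Matrix.submatrix_one_equiv σ
  have hV' : V * Vᵀ = 1 := mul_eq_one_comm.mp hV
  have hG : (A * V)ᵀ * (A * V) = diagonal (fun i => s i ^ 2) := by
    have h1 : (A * V)ᵀ * (A * V) = ((A * E)ᵀ * (A * E)).submatrix σ σ := by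
      ext i j; simp [V, Matrix.mul_apply]
    have h2 : (A * E)ᵀ * (A * E) = diagonal hH.eigenvalues := by
      rw [← hdiag, Matrix.transpose_mul]; simp only [Matrix.mul_assoc]
    rw [h1, h2]
    ext i j
    simp [Matrix.diagonal_apply, hs]
  have hz : ∀ j, s j = 0 → ∀ k, (A * V) k j = 0 := by
    intro j hj
    have h1 : ∑ k, (A * V) k j * (A * V) k j = 0 := by
      have := congrFun (congrFun hG j) j
      rw [Matrix.mul_apply] at this
      simpa [hj] using this
    intro k
    have := (Finset.sum_eq_zero_iff_of_nonneg (fun k _ => mul_self_nonneg _)).mp h1 k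
      (Finset.mem_univ k)
    exact mul_self_eq_zero.mp this
  refine ⟨A * V * diagonal (fun i => (s i)⁻¹), V, fun i => (s i)⁻¹ * s i ^ 2 * (s i)⁻¹,
    hV, ?_, ?_, ?_, ?_⟩
  · have : A * V * diagonal (fun i => (s i)⁻¹) * diagonal s = A * V := by
      ext k j
      rw [Matrix.mul_diagonal, Matrix.mul_diagonal]
      by_cases h : s j = 0
      · rw [hz j h k]; simp
      · field_simp
    rw [this, Matrix.mul_assoc, hV', Matrix.mul_one]
  · rw [Matrix.transpose_mul, Matrix.diagonal_transpose]
    calc _ = diagonal (fun i => (s i)⁻¹) * ((A * V)ᵀ * (A * V)) * diagonal (fun i => (s i)⁻¹) := by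
          simp only [Matrix.mul_assoc]
      _ = _ := by rw [hG]; simp [Matrix.diagonal_mul_diagonal]
  · intro i
    by_cases h : s i = 0
    · simp [h]
    · apply le_of_eq; field_simp
  · have := congrArg Matrix.trace hG
    rw [Matrix.trace_diagonal] at this
    rw [← this, Matrix.trace_mul_comm, Matrix.transpose_mul, Matrix.trace_mul_comm (Aᵀ)]
    congr 1
    calc _ = A * (V * Vᵀ) * Aᵀ := by simp only [Matrix.mul_assoc]
      _ = _ := by rw [hV', Matrix.mul_one]

lemma bessel_mat {n : ℕ} (W : Matrix (Fin n) (Fin n) ℝ) (d : Fin n → ℝ)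
    (hW : Wᵀ * W = diagonal d) (hd : ∀ i, d i ≤ 1) (x : Fin n → ℝ) :
    (Wᵀ *ᵥ x) ⬝ᵥ (Wᵀ *ᵥ x) ≤ x ⬝ᵥ x := by
  set y := Wᵀ *ᵥ x with hy
  have h1 : 0 ≤ (x - W *ᵥ y) ⬝ᵥ (x - W *ᵥ y) :=
    Finset.sum_nonneg fun i _ => mul_self_nonneg _
  have h2 : x ⬝ᵥ (W *ᵥ y) = y ⬝ᵥ y := by
    rw [Matrix.dotProduct_mulVec, ← Matrix.mulVec_transpose]
  have h3 : (W *ᵥ y) ⬝ᵥ (W *ᵥ y) ≤ y ⬝ᵥ y := by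
    rw [Matrix.dotProduct_mulVec, ← Matrix.mulVec_transpose, Matrix.mulVec_mulVec, hW]
    refine Finset.sum_le_sum fun i _ => ?_
    rw [Matrix.mulVec_diagonal]
    nlinarith [hd i, mul_self_nonneg (y i)]
  rw [sub_dotProduct, dotProduct_sub, dotProduct_sub, dotProduct_comm (W *ᵥ y) x, h2] at h1
  linarith

lemma row_bound {n : ℕ} (U W : Matrix (Fin n) (Fin n) ℝ) (c d : Fin n → ℝ)
    (hU : Uᵀ * U = diagonal c) (hc : ∀ i, c i ≤ 1)
    (hW : Wᵀ * W = diagonal d) (hd : ∀ i, d i ≤ 1) (i : Fin n) :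
    ∑ j, (Uᵀ * W) i j ^ 2 ≤ 1 := by
  have h := bessel_mat W d hW hd (fun k => U k i)
  have h1 : (fun k => U k i) ⬝ᵥ (fun k => U k i) = c i := by
    have := congrFun (congrFun hU i) i
    rw [Matrix.mul_apply] at this
    simpa [dotProduct] using this
  have h2 : ∀ j, (Wᵀ *ᵥ (fun k => U k i)) j = (Uᵀ * W) i j := fun j => by
    simp [Matrix.mulVec, dotProduct, Matrix.mul_apply, mul_comm]
  calc _ = (Wᵀ *ᵥ (fun k => U k i)) ⬝ᵥ (Wᵀ *ᵥ (fun k => U k i)) := by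
        simp only [dotProduct, h2, sq]
    _ ≤ 1 := by rw [h1] at h; exact h.trans (hc i)

lemma col_bound {n : ℕ} (U W : Matrix (Fin n) (Fin n) ℝ) (c d : Fin n → ℝ)
    (hU : Uᵀ * U = diagonal c) (hc : ∀ i, c i ≤ 1)
    (hW : Wᵀ * W = diagonal d) (hd : ∀ i, d i ≤ 1) (j : Fin n) :
    ∑ i, (Uᵀ * W) i j ^ 2 ≤ 1 := by
  have h := row_bound W U d c hW hd hU hc j
  have h2 : ∀ i, (Wᵀ * U) j i = (Uᵀ * W) i j := fun i => by
    simp [Matrix.mul_apply, mul_comm]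
  simpa only [h2] using h

lemma frobSq_sub {n : ℕ} (A B : Matrix (Fin n) (Fin n) ℝ) :
    frobSq (A - B) = (Aᵀ * A).trace - 2 * (Aᵀ * B).trace + (Bᵀ * B).trace := by
  simp only [frobSq, Matrix.trace, Matrix.diag, Matrix.mul_apply, Matrix.transpose_apply,
    Matrix.sub_apply]
  rw [Finset.sum_comm, Finset.mul_sum, ← Finset.sum_sub_distrib, ← Finset.sum_add_distrib]
  refine Finset.sum_congr rfl fun i _ => ?_
  rw [Finset.mul_sum, ← Finset.sum_sub_distrib, ← Finset.sum_add_distrib]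
  refine Finset.sum_congr rfl fun j _ => ?_
  ring

lemma trace_svd {n : ℕ} (U V W Z : Matrix (Fin n) (Fin n) ℝ) (s t : Fin n → ℝ) :
    ((U * diagonal s * Vᵀ)ᵀ * (W * diagonal t * Zᵀ)).trace
      = ∑ i, ∑ j, s i * t j * ((Uᵀ * W) i j * (Vᵀ * Z) i j) := by
  have h : ((U * diagonal s * Vᵀ)ᵀ * (W * diagonal t * Zᵀ)).trace
      = ((diagonal s * (Uᵀ * W) * diagonal t) * (Vᵀ * Z)ᵀ).trace := by
    simp only [Matrix.transpose_mul, Matrix.transpose_transpose, Matrix.diagonal_transpose,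
      Matrix.mul_assoc]
    rw [Matrix.trace_mul_comm]
    simp only [Matrix.mul_assoc]
  rw [h, Matrix.trace]
  refine Finset.sum_congr rfl fun i _ => ?_
  rw [Matrix.diag, Matrix.mul_apply]
  refine Finset.sum_congr rfl fun j _ => ?_
  rw [Matrix.mul_diagonal, Matrix.diagonal_mul, Matrix.transpose_apply]
  ring

/-- The vector of sorted singular values is 1-Lipschitz (in ℓ²)
with respect to the Frobenius norm. -/
theorem singular_values_frobenius_lipschitz {n : ℕ} (A B : Matrix (Fin n) (Fin n) ℝ) :
    ∑ i, (svalsDesc A i - svalsDesc B i) ^ 2 ≤ frobSq (A - B) := by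
  obtain ⟨U, V, c, hV, hA, hU, hc, hsA⟩ := exists_svd A
  obtain ⟨W, Z, d, hZ, hB, hW, hd, hsB⟩ := exists_svd B
  have hs0 : ∀ i, 0 ≤ svalsDesc A i := fun i => Real.sqrt_nonneg _
  have ht0 : ∀ i, 0 ≤ svalsDesc B i := fun i => Real.sqrt_nonneg _
  have hV1 : Vᵀ * V = diagonal (fun _ => 1) := by rw [hV, Matrix.diagonal_one]
  have hZ1 : Zᵀ * Z = diagonal (fun _ => 1) := by rw [hZ, Matrix.diagonal_one]
  have key : (Aᵀ * B).trace ≤ ∑ i, svalsDesc A i * svalsDesc B i := by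
    have h1 := trace_svd U V W Z (svalsDesc A) (svalsDesc B)
    rw [← hA, ← hB] at h1
    rw [h1]
    refine le_trans ?_ (substoch_bound _ _ (svals_antitone A) hs0 (svals_antitone B) ht0
      (fun i j => ((Uᵀ * W) i j ^ 2 + (Vᵀ * Z) i j ^ 2) / 2) (fun i j => by positivity) ?_ ?_)
    · refine Finset.sum_le_sum fun i _ => Finset.sum_le_sum fun j _ => ?_
      refine mul_le_mul_of_nonneg_left ?_ (mul_nonneg (hs0 i) (ht0 j))
      nlinarith [sq_nonneg ((Uᵀ * W) i j - (Vᵀ * Z) i j)]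
    · intro i
      have e1 := row_bound U W c d hU hc hW hd i
      have e2 := row_bound V Z _ _ hV1 (fun _ => le_rfl) hZ1 (fun _ => le_rfl) i
      rw [← Finset.sum_div, Finset.sum_add_distrib]
      linarith
    · intro i
      have e1 := col_bound U W c d hU hc hW hd i
      have e2 := col_bound V Z _ _ hV1 (fun _ => le_rfl) hZ1 (fun _ => le_rfl) i
      rw [← Finset.sum_div, Finset.sum_add_distrib]
      linarith
  have hexp : ∑ i, (svalsDesc A i - svalsDesc B i) ^ 2 = ∑ i, svalsDesc A i ^ 2
      - 2 * ∑ i, svalsDesc A i * svalsDesc B i + ∑ i, svalsDesc B i ^ 2 := by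
    rw [Finset.mul_sum, ← Finset.sum_sub_distrib, ← Finset.sum_add_distrib]
    exact Finset.sum_congr rfl fun i _ => by ring
  rw [hexp, frobSq_sub, hsA, hsB]
  linarith
end
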